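/- Fix θ ∈ ℝ. For ℓ ∈ ℕ define the four sets of positive reals Z₁⁺(ℓ) = {k > 0 : J_{ℓ+1}(k) − e^{θ} J_{ℓ+2}(k) = 0}, Z₂⁺(ℓ) = {k > 0 : J_{ℓ+1}(k) + e^{−θ} J_{ℓ+2}(k) = 0}, Z₁⁻(ℓ) = {k > 0 : J_{ℓ+1}(k) + e^{θ} J_{ℓ+2}(k) = 0}, Z₂⁻(ℓ) = {k > 0 : J_{ℓ+1}(k) − e^{−θ} J_{ℓ+2}(k) = 0}, and the degeneracy d_ℓ = (ℓ+1)(ℓ+2). Then: (i) for every s ∈ ℂ with Re s > 4, all the sums ∑_{ℓ=0}^∞ d_ℓ ∑_{k ∈ Z(ℓ)} k^{−s} converge absolutely, so that η(s) := ∑_{ℓ=0}^∞ d_ℓ [ ∑_{k ∈ Z₁⁺(ℓ)} k^{−s} + ∑_{k ∈ Z₂⁺(ℓ)} k^{−s} − ∑_{k ∈ Z₁⁻(ℓ)} k^{−s} − ∑_{k ∈ Z₂⁻(ℓ)} k^{−s} ] is well defined; (ii) there exist a finite set F ⊂ ℂ with 0 ∉ F and a function h holomorphic on {s ∈ ℂ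 : Re s > −1/2} ∖ F such that h(s) = η(s) for all s with Re s > 4, and h(0) = (1/6144) · ( tanh(θ/2) / cosh⁶(θ/2) ) · ( 259 + 344 cosh θ + 161 cosh(2θ) + 16 cosh(3θ) ). (h(0) is the spectral asymmetry η(0, i∂̸) of the Euclidean Dirac operator on the four-dimensional unit ball with chiral bag boundary conditions with parameter θ; the sets Z^±(ℓ) are the moduli of its positive and negative eigenvalues, occurring with multiplicity d_ℓ.) -/

import Mathlib

/-- Bessel function of the first kind of nonnegative integer order `m`,
`J_m(x) = ∑_k (−1)^k (x/2)^{m+2k} / (k! (m+k)!)`. -/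
noncomputable def besselJn (m : ℕ) (x : ℝ) : ℝ :=
  ∑' k : ℕ, (-1 : ℝ) ^ k * (x / 2) ^ (m + 2 * k) /
    ((k.factorial : ℝ) * ((m + k).factorial : ℝ))

/-- Moduli of positive eigenvalues, first family: `J_{ℓ+1}(k) − e^θ J_{ℓ+2}(k) = 0`. -/
def Z1p4 (θ : ℝ) (ℓ : ℕ) : Set ℝ :=
  {k | 0 < k ∧ besselJn (ℓ + 1) k - Real.exp θ * besselJn (ℓ + 2) k = 0}

/-- Moduli of positive eigenvalues, second family: `J_{ℓ+1}(k) + e^{−θ} J_{ℓ+2}(k) = 0`. -/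
def Z2p4 (θ : ℝ) (ℓ : ℕ) : Set ℝ :=
  {k | 0 < k ∧ besselJn (ℓ + 1) k + Real.exp (-θ) * besselJn (ℓ + 2) k = 0}

/-- Moduli of negative eigenvalues, first family: `J_{ℓ+1}(k) + e^θ J_{ℓ+2}(k) = 0`. -/
def Z1m4 (θ : ℝ) (ℓ : ℕ) : Set ℝ :=
  {k | 0 < k ∧ besselJn (ℓ + 1) k + Real.exp θ * besselJn (ℓ + 2) k = 0}

/-- Moduli of negative eigenvalues, second family: `J_{ℓ+1}(k) − e^{−θ} J_{ℓ+2}(k) = 0`. -/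
def Z2m4 (θ : ℝ) (ℓ : ℕ) : Set ℝ :=
  {k | 0 < k ∧ besselJn (ℓ + 1) k - Real.exp (-θ) * besselJn (ℓ + 2) k = 0}

open Filter Topology Set MeasureTheory

noncomputable section

/-- The entire function with `J_m(x) = (x/2)^m B_m(-x²)` and `I_m(x) = (x/2)^m B_m(x²)`. -/
def besselB (m : ℕ) (X : ℝ) : ℝ :=
  ∑' k : ℕ, X ^ k / (4 ^ k * (k.factorial : ℝ) * ((m + k).factorial : ℝ))

theorem besselB_term_abs_le (m k : ℕ) (X : ℝ) :
    |X ^ k / (4 ^ k * (k.factorial : ℝ) * ((m + k).factorial : ℝ))|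
      ≤ |X| ^ k / (k.factorial : ℝ) / (m.factorial : ℝ) := by
  rw [abs_div, abs_pow, abs_of_pos (by positivity : (0 : ℝ) < 4 ^ k * k.factorial * (m + k).factorial),
    div_div]
  have h1 : (1 : ℝ) ≤ 4 ^ k := one_le_pow₀ (by norm_num)
  have h2 : (m.factorial : ℝ) ≤ (m + k).factorial := by
    exact_mod_cast Nat.factorial_le (Nat.le_add_right m k)
  have h3 : (0 : ℝ) < k.factorial := by positivity
  gcongr
  nlinarith

theorem summable_besselB_abs (m : ℕ) (X : ℝ) :
    Summable fun k : ℕ => |X ^ k / (4 ^ k * (k.factorial : ℝ) * ((m + k).factorial : ℝ))| :=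
  Summable.of_nonneg_of_le (fun _ => abs_nonneg _) (fun k => besselB_term_abs_le m k X)
    ((Real.summable_pow_div_factorial |X|).div_const _)

theorem summable_besselB (m : ℕ) (X : ℝ) :
    Summable fun k : ℕ => X ^ k / (4 ^ k * (k.factorial : ℝ) * ((m + k).factorial : ℝ)) :=
  (summable_besselB_abs m X).of_abs

theorem abs_besselB_le (m : ℕ) (X : ℝ) :
    |besselB m X| ≤ Real.exp |X| / (m.factorial : ℝ) := by
  have h0 : |besselB m X| ≤
      ∑' k : ℕ, |X ^ k / (4 ^ k * (k.factorial : ℝ) * ((m + k).factorial : ℝ))| :=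
    norm_tsum_le_tsum_norm (summable_besselB m X).norm
  have h1 : HasSum (fun k : ℕ => |X| ^ k / (k.factorial : ℝ)) (Real.exp |X|) := by
    rw [Real.exp_eq_exp_ℝ]
    exact NormedSpace.expSeries_div_hasSum_exp |X|
  have h2 := h1.div_const (m.factorial : ℝ)
  exact h0.trans ((summable_besselB_abs m X).tsum_le_of_sum_le fun s =>
    (Finset.sum_le_sum fun k _ => besselB_term_abs_le m k X).trans
      (sum_le_hasSum s (fun k _ => by positivity) h2))

theorem besselB_pos (m : ℕ) {X : ℝ} (hX : 0 ≤ X) : 0 < besselB m X :=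
  (summable_besselB m X).tsum_pos (fun _ => by positivity) 0 (by simp; positivity)

theorem besselB_recurrence (m : ℕ) (X : ℝ) :
    besselB m X = (m + 1) * besselB (m + 1) X + X / 4 * besselB (m + 2) X := by
  have key : ∀ k : ℕ, X ^ k / (4 ^ k * (k.factorial : ℝ) * ((m + k).factorial : ℝ)) -
      (m + 1) * (X ^ k / (4 ^ k * (k.factorial : ℝ) * ((m + 1 + k).factorial : ℝ))) =
      k * (X ^ k / (4 ^ k * (k.factorial : ℝ) * ((m + 1 + k).factorial : ℝ))) := by
    intro k
    have : ((m + 1 + k).factorial : ℝ) = (m + 1 + k) * (m + k).factorial := by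
      rw [show m + 1 + k = (m + k) + 1 by ring, Nat.factorial_succ]; push_cast; ring
    rw [this]
    have h3 : (k.factorial : ℝ) ≠ 0 := by positivity
    have h4 : ((m + k).factorial : ℝ) ≠ 0 := by positivity
    have h5 : (m + 1 + k : ℝ) ≠ 0 := by positivity
    field_simp
    ring
  have hs := (summable_besselB m X).sub ((summable_besselB (m + 1) X).mul_left ((m : ℝ) + 1))
  have h1 : besselB m X - (m + 1) * besselB (m + 1) X = X / 4 * besselB (m + 2) X := by
    unfold besselB
    rw [← tsum_mul_left, ← (summable_besselB m X).tsum_sub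
      ((summable_besselB (m + 1) X).mul_left ((m : ℝ) + 1)), hs.tsum_eq_zero_add, key,
      ← tsum_mul_left]
    simp only [CharP.cast_eq_zero, zero_mul, zero_add]
    refine tsum_congr fun k => ?_
    rw [key, Nat.factorial_succ, show m + 1 + (k + 1) = m + 2 + k by ring]
    have h3 : (k.factorial : ℝ) ≠ 0 := by positivity
    have h4 : ((m + 2 + k).factorial : ℝ) ≠ 0 := by positivity
    have h5 : ((k : ℝ) + 1) ≠ 0 := by positivity
    push_cast
    field_simp
    ring
  linarith

theorem hasDerivAt_besselB (m : ℕ) (X : ℝ) :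
    HasDerivAt (besselB m) (besselB (m + 1) X / 4) X := by
  set R := |X| + 1
  have hX : X ∈ Ioo (-R) R := by
    constructor <;> simp only [R] <;> linarith [neg_abs_le X, le_abs_self X]
  have hsum : Summable fun k : ℕ => (k : ℝ) * R ^ (k - 1) / (k.factorial : ℝ) := by
    rw [← summable_nat_add_iff 1]
    refine (Real.summable_pow_div_factorial R).congr fun k => ?_
    rw [Nat.factorial_succ]
    push_cast
    have h5 : ((k : ℝ) + 1) ≠ 0 := by positivity
    field_simp
  have h := hasDerivAt_tsum_of_isPreconnected hsum isOpen_Ioo isPreconnected_Ioo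
    (g := fun k Y => Y ^ k / (4 ^ k * (k.factorial : ℝ) * ((m + k).factorial : ℝ)))
    (g' := fun k Y => k * Y ^ (k - 1) / (4 ^ k * (k.factorial : ℝ) * ((m + k).factorial : ℝ)))
    (fun k Y _ => (hasDerivAt_pow k Y).div_const _)
    (fun k Y hY => by
      rw [Real.norm_eq_abs, abs_div, abs_mul, abs_pow, Nat.abs_cast,
        abs_of_pos (by positivity : (0 : ℝ) < 4 ^ k * k.factorial * (m + k).factorial)]
      have h1 : (1 : ℝ) ≤ 4 ^ k := one_le_pow₀ (by norm_num)
      have h2 : (1 : ℝ) ≤ (m + k).factorial := by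
        exact_mod_cast Nat.succ_le_of_lt (Nat.factorial_pos _)
      have h3 : (0 : ℝ) < k.factorial := by positivity
      have h4 : |Y| ≤ R := abs_le.2 ⟨hY.1.le, hY.2.le⟩
      gcongr
      calc (k.factorial : ℝ) = 1 * k.factorial * 1 := by ring
        _ ≤ _ := by gcongr)
    hX (summable_besselB m X) hX
  refine h.congr_deriv (Eq.symm ?_)
  have hs : Summable fun k : ℕ =>
      k * X ^ (k - 1) / (4 ^ k * (k.factorial : ℝ) * ((m + k).factorial : ℝ)) := by
    rw [← summable_nat_add_iff 1]
    refine ((summable_besselB (m + 1) X).div_const 4).congr fun k => ?_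
    rw [Nat.factorial_succ, show m + (k + 1) = m + 1 + k by ring]
    push_cast
    have h5 : ((k : ℝ) + 1) ≠ 0 := by positivity
    field_simp
    ring
  rw [hs.tsum_eq_zero_add, besselB, ← tsum_div_const]
  simp only [CharP.cast_eq_zero, zero_mul, zero_div, zero_add]
  refine tsum_congr fun k => ?_
  rw [Nat.factorial_succ, show m + (k + 1) = m + 1 + k by ring]
  push_cast
  have h5 : ((k : ℝ) + 1) ≠ 0 := by positivity
  field_simp
  ring

theorem contDiff_besselB (m : ℕ) : ContDiff ℝ (⊤ : ℕ∞) (besselB m) := by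
  rw [contDiff_infty]
  intro n
  induction n generalizing m with
  | zero =>
    exact contDiff_zero.2 (continuous_iff_continuousAt.2
      fun X => (hasDerivAt_besselB m X).continuousAt)
  | succ n ih =>
    have : deriv (besselB m) = fun X => besselB (m + 1) X / 4 :=
      funext fun X => (hasDerivAt_besselB m X).deriv
    push_cast
    rw [contDiff_succ_iff_deriv]
    refine ⟨fun X => (hasDerivAt_besselB m X).differentiableAt, by simp, ?_⟩
    rw [this]
    exact (ih (m + 1)).div_const 4

theorem besselJn_eq (m : ℕ) (x : ℝ) : besselJn m x = (x / 2) ^ m * besselB m (-x ^ 2) := by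
  unfold besselJn besselB
  rw [← tsum_mul_left]
  refine tsum_congr fun k => ?_
  rw [neg_pow (x ^ 2), pow_add, pow_mul, div_pow x 2 2]
  have h3 : (k.factorial : ℝ) ≠ 0 := by positivity
  have h4 : ((m + k).factorial : ℝ) ≠ 0 := by positivity
  rw [div_pow (x ^ 2)]
  norm_num
  field_simp

theorem besselJn_neg (m : ℕ) (x : ℝ) : besselJn m (-x) = (-1) ^ m * besselJn m x := by
  rw [besselJn_eq, besselJn_eq, neg_sq, neg_div, neg_pow, mul_assoc]

theorem besselJn_recurrence (m : ℕ) (x : ℝ) :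
    x * (besselJn m x + besselJn (m + 2) x) = 2 * (m + 1) * besselJn (m + 1) x := by
  simp only [besselJn_eq]
  rw [besselB_recurrence m]
  ring

section

open scoped lp InnerProductSpace

theorem memlp_two_of_summable {f : ℕ → ℂ} (hf : Summable fun n => ‖f n‖ ^ 2) :
    Memℓp f 2 :=
  memℓp_gen (by simpa using hf)

theorem summable_norm_sq_lp (f : ℓ²(ℕ, ℂ)) : Summable fun n => ‖f n‖ ^ 2 := by
  simpa using (lp.memℓp f).summable (by norm_num)

theorem norm_sq_lp (f : ℓ²(ℕ, ℂ)) : ‖f‖ ^ 2 = ∑' n, ‖f n‖ ^ 2 := by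
  simpa using lp.norm_rpow_eq_tsum (p := 2) (by norm_num) f

theorem norm_lp_le_of_coord {f g : ℓ²(ℕ, ℂ)} {C : ℝ} (hC : 0 ≤ C)
    (h : ∑' n, ‖f n‖ ^ 2 ≤ C ^ 2 * ∑' n, ‖g n‖ ^ 2) : ‖f‖ ≤ C * ‖g‖ := by
  rw [← norm_sq_lp, ← norm_sq_lp, ← mul_pow] at h
  exact le_of_sq_le_sq h (by positivity)

/-- The diagonal operator on `ℓ²` with the real bounded symbol `c`. -/
def diagOp (c : ℕ → ℝ) (hc : ∀ n, |c n| ≤ 1) : ℓ²(ℕ, ℂ) →L[ℂ] ℓ²(ℕ, ℂ) :=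
  LinearMap.mkContinuous
    { toFun := fun f => ⟨fun n => (c n : ℂ) * f n, memlp_two_of_summable <|
        Summable.of_nonneg_of_le (fun _ => by positivity)
          (fun n => by
            rw [norm_mul, mul_pow, Complex.norm_real, Real.norm_eq_abs]
            exact mul_le_of_le_one_left (by positivity) (pow_le_one₀ (abs_nonneg _) (hc n)))
          (summable_norm_sq_lp f)⟩
      map_add' := fun f g => by ext n; exact mul_add _ _ _
      map_smul' := fun a f => by ext n; simp; ring } 1 (fun f => by
        refine norm_lp_le_of_coord zero_le_one ?_
        rw [one_pow, one_mul]
        have hle : ∀ n, ‖(c n : ℂ) * f n‖ ^ 2 ≤ ‖f n‖ ^ 2 := fun n => by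
          rw [norm_mul, mul_pow, Complex.norm_real, Real.norm_eq_abs]
          exact mul_le_of_le_one_left (by positivity) (pow_le_one₀ (abs_nonneg _) (hc n))
        exact (Summable.of_nonneg_of_le (fun _ => by positivity) hle
          (summable_norm_sq_lp f)).tsum_le_tsum hle (summable_norm_sq_lp f))

@[simp]
theorem diagOp_apply (c : ℕ → ℝ) (hc : ∀ n, |c n| ≤ 1) (f : ℓ²(ℕ, ℂ)) (n : ℕ) :
    diagOp c hc f n = (c n : ℂ) * f n := rfl

/-- The backward shift on `ℓ²`. -/
def backShift : ℓ²(ℕ, ℂ) →L[ℂ] ℓ²(ℕ, ℂ) :=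
  LinearMap.mkContinuous
    { toFun := fun f => ⟨fun n => f (n + 1), memlp_two_of_summable
        ((summable_nat_add_iff 1).2 (summable_norm_sq_lp f))⟩
      map_add' := fun f g => by ext n; rfl
      map_smul' := fun a f => by ext n; simp } 1 (fun f => by
        refine norm_lp_le_of_coord zero_le_one ?_
        rw [one_pow, one_mul, (summable_norm_sq_lp f).tsum_eq_zero_add]
        exact le_add_of_nonneg_left (by positivity))

@[simp]
theorem backShift_apply (f : ℓ²(ℕ, ℂ)) (n : ℕ) : backShift f n = f (n + 1) := rfl

theorem lp_coord_eq_inner (f : ℓ²(ℕ, ℂ)) (n : ℕ) : f n = ⟪lp.single 2 n (1 : ℂ), f⟫_ℂ := by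
  rw [lp.inner_single_left]
  simp

theorem adjoint_backShift_zero (f : ℓ²(ℕ, ℂ)) : backShift.adjoint f 0 = 0 := by
  rw [lp_coord_eq_inner, ContinuousLinearMap.adjoint_inner_right]
  have : backShift (lp.single 2 0 (1 : ℂ)) = 0 := by
    ext n
    simp [lp.single_apply]
  rw [this, inner_zero_left]

theorem adjoint_backShift_succ (f : ℓ²(ℕ, ℂ)) (n : ℕ) :
    backShift.adjoint f (n + 1) = f n := by
  rw [lp_coord_eq_inner, ContinuousLinearMap.adjoint_inner_right]
  have : backShift (lp.single 2 (n + 1) (1 : ℂ)) = lp.single 2 n (1 : ℂ) := by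
    ext k
    by_cases h : k = n
    · subst h; simp [lp.single_apply]
    · simp [lp.single_apply, h]
  rw [this, ← lp_coord_eq_inner]

theorem diagOp_symm (c : ℕ → ℝ) (hc : ∀ n, |c n| ≤ 1) (f g : ℓ²(ℕ, ℂ)) :
    ⟪diagOp c hc f, g⟫_ℂ = ⟪f, diagOp c hc g⟫_ℂ := by
  rw [lp.inner_eq_tsum, lp.inner_eq_tsum]
  refine tsum_congr fun n => ?_
  simp
  ring

theorem isCompactOperator_rankOne (n : ℕ) :
    IsCompactOperator ((lp.singleContinuousLinearMap ℂ (fun _ : ℕ => ℂ) 2 n).comp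
      (lp.evalCLM ℂ (fun _ : ℕ => ℂ) 2 n)) :=
  (isCompactOperator_of_locallyCompactSpace_dom
    (lp.evalCLM ℂ (fun _ : ℕ => ℂ) 2 n)).clm_comp (lp.singleContinuousLinearMap ℂ (fun _ : ℕ => ℂ) 2 n)

theorem isCompactOperator_diagOp (c : ℕ → ℝ) (hc : ∀ n, |c n| ≤ 1) (hanti : ∀ n m, n ≤ m → |c m| ≤ |c n|)
    (h0 : Tendsto c atTop (𝓝 0)) : IsCompactOperator (diagOp c hc) := by
  let T : ℕ → ℓ²(ℕ, ℂ) →L[ℂ] ℓ²(ℕ, ℂ) := fun N => ∑ n ∈ Finset.range N, (c n : ℂ) •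
    (lp.singleContinuousLinearMap ℂ (fun _ : ℕ => ℂ) 2 n).comp (lp.evalCLM ℂ (fun _ : ℕ => ℂ) 2 n)
  have hT : ∀ N, IsCompactOperator (T N) := by
    intro N
    induction N with
    | zero => simpa [T] using! isCompactOperator_zero
    | succ N ih =>
      have : T (N + 1) = T N + (c N : ℂ) • (lp.singleContinuousLinearMap ℂ (fun _ : ℕ => ℂ) 2 N).comp
          (lp.evalCLM ℂ (fun _ : ℕ => ℂ) 2 N) := Finset.sum_range_succ _ _
      rw [this]
      exact ih.add ((isCompactOperator_rankOne N).smul (c N : ℂ))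
  have hTa : ∀ N f n, T N f n = if n < N then (c n : ℂ) * f n else 0 := by
    intro N f n
    have : T N f n = ∑ k ∈ Finset.range N, ((c k : ℂ) * (lp.single 2 k (f k) : ℓ²(ℕ, ℂ)) n) := by
      simp only [T, _root_.sum_apply]
      rw [lp.coeFn_sum]
      simp
      rfl
    rw [this]
    simp only [lp.single_apply]
    split_ifs with h
    · rw [Finset.sum_eq_single n]
      · simp
      · intro b _ hb
        simp [Ne.symm hb]
      · simp [h]
    · refine Finset.sum_eq_zero fun k hk => ?_
      have : n ≠ k := by rintro rfl; exact h (Finset.mem_range.1 hk)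
      simp [this]
  refine isCompactOperator_of_tendsto (l := atTop) (F := T) ?_ (Eventually.of_forall hT)
  rw [tendsto_iff_norm_sub_tendsto_zero]
  refine squeeze_zero (fun _ => norm_nonneg _) (fun N => ?_) (by simpa using h0.abs)
  refine ContinuousLinearMap.opNorm_le_bound _ (abs_nonneg _) fun f => ?_
  refine norm_lp_le_of_coord (abs_nonneg _) ?_
  have hle : ∀ n, ‖(T N - diagOp c hc) f n‖ ^ 2 ≤ |c N| ^ 2 * ‖f n‖ ^ 2 := by
    intro n
    have : (T N - diagOp c hc) f n = T N f n - diagOp c hc f n := rfl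
    rw [this, hTa, diagOp_apply]
    split_ifs with h
    · simp; positivity
    · rw [zero_sub, norm_neg, norm_mul, mul_pow, Complex.norm_real, Real.norm_eq_abs]
      have := hanti N n (not_lt.1 h)
      gcongr
  have hs := (summable_norm_sq_lp f).mul_left (|c N| ^ 2)
  rw [← tsum_mul_left]
  exact (Summable.of_nonneg_of_le (fun _ => by positivity) hle hs).tsum_le_tsum hle hs

/-- The weights `1 / √(2(ν + 1 + n))`. -/
def besselWeight (ν n : ℕ) : ℝ := (√(2 * (ν + 1 + n)))⁻¹

theorem besselWeight_pos (ν n : ℕ) : 0 < besselWeight ν n := by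
  unfold besselWeight; positivity

theorem besselWeight_sq (ν n : ℕ) : besselWeight ν n ^ 2 = 1 / (2 * (ν + 1 + n)) := by
  unfold besselWeight
  rw [inv_pow, Real.sq_sqrt (by positivity), one_div]

theorem besselWeight_mul_sqrt (ν n : ℕ) : besselWeight ν n * √(2 * (ν + 1 + n)) = 1 := by
  unfold besselWeight
  exact inv_mul_cancel₀ (by positivity)

theorem besselWeight_antitone (ν : ℕ) {n m : ℕ} (h : n ≤ m) :
    besselWeight ν m ≤ besselWeight ν n := by
  unfold besselWeight
  gcongr

theorem abs_besselWeight_le_one (ν n : ℕ) : |besselWeight ν n| ≤ 1 := by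
  rw [abs_of_pos (besselWeight_pos ν n)]
  unfold besselWeight
  refine inv_le_one_of_one_le₀ (Real.one_le_sqrt.2 ?_)
  have : (0 : ℝ) ≤ ν := by positivity
  have : (0 : ℝ) ≤ n := by positivity
  linarith

theorem tendsto_besselWeight (ν : ℕ) : Tendsto (besselWeight ν) atTop (𝓝 0) := by
  unfold besselWeight
  refine tendsto_inv_atTop_zero.comp (Real.tendsto_sqrt_atTop.comp ?_)
  refine Tendsto.const_mul_atTop two_pos ?_
  exact tendsto_atTop_add_const_left _ _ tendsto_natCast_atTop_atTop

/-- The Jacobi operator on `ℓ²` whose eigenvalues are the reciprocals of the nonzero real zeros of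
`J_ν - a J_{ν+1}`. -/
def besselOp (ν : ℕ) (a : ℝ) : ℓ²(ℕ, ℂ) →L[ℂ] ℓ²(ℕ, ℂ) :=
  diagOp _ (abs_besselWeight_le_one ν) ∘L (backShift + backShift.adjoint) ∘L
    diagOp _ (abs_besselWeight_le_one ν) +
  ((a / (2 * (ν + 1)) : ℝ) : ℂ) • (lp.singleContinuousLinearMap ℂ (fun _ : ℕ => ℂ) 2 0).comp
      (lp.evalCLM ℂ (fun _ : ℕ => ℂ) 2 0)

theorem besselOp_zero (ν : ℕ) (a : ℝ) (f : ℓ²(ℕ, ℂ)) :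
    besselOp ν a f 0 = besselWeight ν 0 * (besselWeight ν 1 * f 1) +
      ((a / (2 * (ν + 1)) : ℝ) : ℂ) * f 0 := by
  have : besselOp ν a f 0 = besselWeight ν 0 * (besselWeight ν 1 * f 1 +
      backShift.adjoint (diagOp _ (abs_besselWeight_le_one ν) f) 0) +
      ((a / (2 * (ν + 1)) : ℝ) : ℂ) * (lp.single 2 0 (f 0) : ℓ²(ℕ, ℂ)) 0 := rfl
  rw [this, adjoint_backShift_zero, lp.single_apply_self, add_zero]

theorem besselOp_succ (ν : ℕ) (a : ℝ) (f : ℓ²(ℕ, ℂ)) (n : ℕ) :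
    besselOp ν a f (n + 1) = besselWeight ν (n + 1) *
      (besselWeight ν (n + 2) * f (n + 2) + besselWeight ν n * f n) := by
  have : besselOp ν a f (n + 1) = besselWeight ν (n + 1) * (besselWeight ν (n + 2) * f (n + 2) +
      backShift.adjoint (diagOp _ (abs_besselWeight_le_one ν) f) (n + 1)) +
      ((a / (2 * (ν + 1)) : ℝ) : ℂ) * (lp.single 2 0 (f 0) : ℓ²(ℕ, ℂ)) (n + 1) := rfl
  rw [this, adjoint_backShift_succ, lp.single_apply_ne _ _ _ (Nat.succ_ne_zero n), mul_zero,
    add_zero, diagOp_apply]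

theorem besselOp_isSymmetric (ν : ℕ) (a : ℝ) : (besselOp ν a).IsSymmetric := by
  intro f g
  have h1 : ∀ f, (besselOp ν a) f = diagOp _ (abs_besselWeight_le_one ν)
      (backShift (diagOp _ (abs_besselWeight_le_one ν) f) +
        backShift.adjoint (diagOp _ (abs_besselWeight_le_one ν) f)) +
      ((a / (2 * (ν + 1)) : ℝ) : ℂ) • (lp.single 2 0 (f 0) : ℓ²(ℕ, ℂ)) := fun f => rfl
  change ⟪besselOp ν a f, g⟫_ℂ = ⟪f, besselOp ν a g⟫_ℂ
  rw [h1, h1, inner_add_left, inner_add_right, diagOp_symm _ _ _ g, ← diagOp_symm _ _ f, inner_add_left,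
    inner_add_right, ContinuousLinearMap.adjoint_inner_left,
    ContinuousLinearMap.adjoint_inner_right, inner_smul_left, inner_smul_right,
    lp.inner_single_left, lp.inner_single_right, add_comm ⟪backShift _, _⟫_ℂ, Complex.conj_ofReal]

theorem besselOp_isCompactOperator (ν : ℕ) (a : ℝ) : IsCompactOperator (besselOp ν a) := by
  refine IsCompactOperator.add ?_ ((isCompactOperator_rankOne 0).smul _)
  exact (isCompactOperator_diagOp _ (abs_besselWeight_le_one ν) (fun n m h => by
    rw [abs_of_pos (besselWeight_pos ν n), abs_of_pos (besselWeight_pos ν m)]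
    exact besselWeight_antitone ν h) (tendsto_besselWeight ν)).comp_clm _

/-- The complex-argument companion of `besselJn`, with the square of the argument kept real. -/
def besselC (z : ℂ) (X : ℝ) (m : ℕ) : ℂ := (z / 2) ^ m * (besselB m X : ℂ)

theorem besselC_recurrence {z : ℂ} {X : ℝ} (hz : z ^ 2 = -X) (m : ℕ) :
    z * (besselC z X m + besselC z X (m + 2)) = 2 * (m + 1) * besselC z X (m + 1) := by
  unfold besselC
  have h : (besselB m X : ℂ) = (m + 1) * besselB (m + 1) X + X / 4 * besselB (m + 2) X := by
    exact_mod_cast besselB_recurrence m X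
  have hX : (X : ℂ) = -z ^ 2 := by rw [hz, neg_neg]
  rw [h, hX]
  ring

theorem besselC_ofReal (k : ℝ) (m : ℕ) : besselC k (-k ^ 2) m = besselJn m k := by
  rw [besselC, besselJn_eq]
  push_cast
  rfl

theorem norm_besselC_le (z : ℂ) (X : ℝ) (m : ℕ) :
    ‖besselC z X m‖ ≤ Real.exp |X| * ((‖z‖ / 2) ^ m / m.factorial) := by
  rw [besselC, norm_mul, norm_pow, norm_div, Complex.norm_real, Real.norm_eq_abs]
  calc _ ≤ (‖z‖ / ‖(2 : ℂ)‖) ^ m * (Real.exp |X| / m.factorial) := by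
        gcongr; exact abs_besselB_le m X
    _ = _ := by rw [Complex.norm_ofNat]; ring

theorem summable_besselC_sq (z : ℂ) (X : ℝ) :
    Summable fun m : ℕ => (m : ℝ) * ‖besselC z X m‖ ^ 2 := by
  refine Summable.of_nonneg_of_le (fun _ => by positivity) (fun m => ?_)
    ((Real.summable_pow_div_factorial ‖z‖).mul_left (Real.exp |X| ^ 2 * Real.exp (‖z‖ / 2)))
  have h1 := norm_besselC_le z X m
  have h2 : (‖z‖ / 2) ^ m / m.factorial ≤ Real.exp (‖z‖ / 2) :=
    Real.pow_div_factorial_le_exp _ (by positivity) m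
  have h3 : (m : ℝ) ≤ 2 ^ m := by exact_mod_cast Nat.lt_two_pow_self.le
  calc (m : ℝ) * ‖besselC z X m‖ ^ 2
      ≤ 2 ^ m * (Real.exp |X| * ((‖z‖ / 2) ^ m / m.factorial)) ^ 2 := by gcongr
    _ = Real.exp |X| ^ 2 * ((‖z‖ / 2) ^ m / m.factorial) * (2 ^ m * (‖z‖ / 2) ^ m / m.factorial) := by
        ring
    _ ≤ Real.exp |X| ^ 2 * Real.exp (‖z‖ / 2) * (2 ^ m * (‖z‖ / 2) ^ m / m.factorial) := by gcongr
    _ = _ := by rw [← mul_pow]; congr 3; ring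

/-- The vector with coordinates `√(2(ν+1+n)) J_{ν+1+n}`. -/
def besselVec (ν : ℕ) (z : ℂ) (X : ℝ) : ℓ²(ℕ, ℂ) :=
  ⟨fun n => (√(2 * (ν + 1 + n)) : ℝ) * besselC z X (ν + 1 + n), memlp_two_of_summable <| by
    have h := ((summable_besselC_sq z X).mul_left 2).comp_injective
      (add_right_injective (ν + 1))
    refine h.congr fun n => ?_
    rw [norm_mul, mul_pow, Complex.norm_real, Real.norm_eq_abs, sq_abs, Real.sq_sqrt (by positivity)]
    simp only [Function.comp]
    push_cast
    ring⟩

theorem besselVec_apply (ν : ℕ) (z : ℂ) (X : ℝ) (n : ℕ) :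
    besselVec ν z X n = (√(2 * (ν + 1 + n)) : ℝ) * besselC z X (ν + 1 + n) := rfl

theorem besselWeight_mul_besselVec (ν : ℕ) (z : ℂ) (X : ℝ) (n : ℕ) :
    besselWeight ν n * besselVec ν z X n = besselC z X (ν + 1 + n) := by
  rw [besselVec_apply, ← mul_assoc, ← Complex.ofReal_mul, besselWeight_mul_sqrt]
  simp

theorem besselVec_eq (ν : ℕ) (z : ℂ) (X : ℝ) (n : ℕ) :
    besselVec ν z X n = besselWeight ν n * (2 * (ν + 1 + n) * besselC z X (ν + 1 + n)) := by
  have h : (√(2 * (ν + 1 + n) : ℝ)) = besselWeight ν n * (2 * (ν + 1 + n)) := by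
    have h1 := besselWeight_mul_sqrt ν n
    have h2 := Real.mul_self_sqrt (show (0 : ℝ) ≤ 2 * (ν + 1 + n) by positivity)
    calc _ = (besselWeight ν n * √(2 * (ν + 1 + n))) * √(2 * (ν + 1 + n)) := by rw [h1, one_mul]
      _ = besselWeight ν n * (√(2 * (ν + 1 + n)) * √(2 * (ν + 1 + n))) := by ring
      _ = _ := by rw [h2]
  rw [besselVec_apply, h]
  push_cast
  ring

/-- `(1 - z K) V` is a multiple of the first basis vector. -/
theorem besselOp_besselVec (ν : ℕ) (a : ℝ) {z : ℂ} {X : ℝ} (hz : z ^ 2 = -X) :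
    besselVec ν z X - z • besselOp ν a (besselVec ν z X) =
      (besselWeight ν 0 * z * (besselC z X ν - a * besselC z X (ν + 1))) •
        lp.single 2 0 (1 : ℂ) := by
  ext n
  rw [lp.coeFn_sub, lp.coeFn_smul, lp.coeFn_smul, Pi.sub_apply, Pi.smul_apply, Pi.smul_apply,
    smul_eq_mul, smul_eq_mul]
  cases n with
  | zero =>
    rw [besselOp_zero, lp.single_apply_self, besselWeight_mul_besselVec, mul_one, besselVec_eq]
    have h := besselC_recurrence hz ν
    have hw : (besselWeight ν 0 : ℂ) ^ 2 = 1 / (2 * (ν + 1)) := by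
      have := besselWeight_sq ν 0
      rw [← Complex.ofReal_pow, this]
      push_cast
      ring
    have hν : (ν : ℂ) + 1 ≠ 0 := Nat.cast_add_one_ne_zero ν
    push_cast
    simp only [add_zero]
    rw [show ν + 1 + 1 = ν + 2 from rfl]
    field_simp
    linear_combination (-(besselWeight ν 0 : ℂ)) * h
  | succ n =>
    rw [besselOp_succ, lp.single_apply_ne _ _ _ (Nat.succ_ne_zero n), besselWeight_mul_besselVec,
      besselWeight_mul_besselVec, besselVec_eq, mul_zero]
    have h := besselC_recurrence hz (ν + 1 + n)
    rw [show ν + 1 + (n + 2) = ν + 1 + n + 2 from rfl, show ν + 1 + (n + 1) = ν + 1 + n + 1 from rfl]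
    push_cast at h ⊢
    linear_combination (-(besselWeight ν (n + 1) : ℂ)) * h

/-- The nonzero real zeros of `J_ν - a J_{ν+1}`. -/
def besselZeros (ν : ℕ) (a : ℝ) : Set ℝ :=
  {k | k ≠ 0 ∧ besselJn ν k - a * besselJn (ν + 1) k = 0}

theorem besselB_zero_right (m : ℕ) : besselB m 0 = 1 / m.factorial := by
  unfold besselB
  rw [tsum_eq_single 0]
  · simp
  · intro k hk
    simp [hk]

theorem exists_besselB_ne_zero (X : ℝ) (N : ℕ) : ∃ m ≥ N, besselB m X ≠ 0 := by
  obtain ⟨M, hM⟩ := exists_nat_gt (|X| * Real.exp |X|)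
  refine ⟨max N M, le_max_left _ _, fun h0 => ?_⟩
  set m := max N M
  have h1 : ‖besselB m X - besselB m 0‖ ≤ (Real.exp |X| / (m + 1).factorial / 4) * ‖X - 0‖ := by
    refine (convex_uIcc 0 X).norm_image_sub_le_of_norm_hasDerivWithin_le
      (fun x _ => (hasDerivAt_besselB m x).hasDerivWithinAt) (fun x hx => ?_)
      left_mem_uIcc right_mem_uIcc
    rw [norm_div, Real.norm_eq_abs, Real.norm_of_nonneg (by norm_num : (0 : ℝ) ≤ 4)]
    have hx' : |x| ≤ |X| := by
      rcases le_total 0 X with h | h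
      · rw [uIcc_of_le h] at hx
        rw [abs_of_nonneg h, abs_of_nonneg hx.1]; exact hx.2
      · rw [uIcc_of_ge h] at hx
        rw [abs_of_nonpos h, abs_of_nonpos hx.2]; linarith [hx.1]
    gcongr
    refine (abs_besselB_le _ _).trans ?_
    gcongr
  rw [h0, besselB_zero_right, zero_sub, norm_neg, sub_zero, Real.norm_eq_abs, Real.norm_eq_abs,
    abs_of_pos (by positivity), Nat.factorial_succ] at h1
  push_cast at h1
  have hf : (0 : ℝ) < m.factorial := by positivity
  have hm : (M : ℝ) ≤ m := by exact_mod_cast le_max_right N M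
  rw [div_div, div_mul_eq_mul_div, div_le_div_iff₀ hf (by positivity)] at h1
  have : ((m : ℝ) + 1) * 4 ≤ Real.exp |X| * |X| := by
    by_contra hc
    push Not at hc
    nlinarith
  nlinarith [Nat.cast_nonneg (α := ℝ) m]

theorem besselJn_ne_zero_of_mem {ν : ℕ} {a k : ℝ} (hk : k ∈ besselZeros ν a) :
    besselJn (ν + 1) k ≠ 0 := by
  intro h0
  have h1 : besselJn ν k = 0 := by simpa [h0] using hk.2
  have hall : ∀ n, besselJn (ν + n) k = 0 ∧ besselJn (ν + n + 1) k = 0 := by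
    intro n
    induction n with
    | zero => exact ⟨h1, h0⟩
    | succ n ih =>
      refine ⟨ih.2, ?_⟩
      have := besselJn_recurrence (ν + n) k
      rw [ih.1, ih.2, mul_zero, zero_add] at this
      exact (mul_eq_zero.1 this).resolve_left hk.1
  obtain ⟨m, hm, hne⟩ := exists_besselB_ne_zero (-k ^ 2) ν
  obtain ⟨n, rfl⟩ := Nat.exists_eq_add_of_le hm
  have := (hall n).1
  rw [besselJn_eq] at this
  exact (mul_ne_zero (pow_ne_zero _ (div_ne_zero hk.1 two_ne_zero)) hne) this

/-- The eigenvector attached to a zero `k`. -/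
def besselEig (ν : ℕ) (k : ℝ) : ℓ²(ℕ, ℂ) := besselVec ν k (-k ^ 2)

theorem besselEig_apply (ν : ℕ) (k : ℝ) (n : ℕ) :
    besselEig ν k n = ((√(2 * (ν + 1 + n)) * besselJn (ν + 1 + n) k : ℝ) : ℂ) := by
  rw [besselEig, besselVec_apply, besselC_ofReal, Complex.ofReal_mul]

theorem besselOp_besselEig {ν : ℕ} {a k : ℝ} (hk : k ∈ besselZeros ν a) :
    besselOp ν a (besselEig ν k) = ((k⁻¹ : ℝ) : ℂ) • besselEig ν k := by
  have h := besselOp_besselVec ν a (z := k) (X := -k ^ 2) (by push_cast; ring)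
  have h2 : (besselJn ν k : ℂ) - a * besselJn (ν + 1) k = 0 := by exact_mod_cast hk.2
  rw [besselC_ofReal, besselC_ofReal, h2, mul_zero, zero_smul, sub_eq_zero] at h
  change besselEig ν k = (k : ℂ) • besselOp ν a (besselEig ν k) at h
  have hk0 : (k : ℂ) ≠ 0 := Complex.ofReal_ne_zero.2 hk.1
  conv_rhs => rw [h]
  rw [smul_smul, ← Complex.ofReal_mul, inv_mul_cancel₀ hk.1, Complex.ofReal_one, one_smul]

theorem tendsto_lp_coord (f : ℓ²(ℕ, ℂ)) : Tendsto (fun n => f n) atTop (𝓝 0) := by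
  rw [tendsto_zero_iff_norm_tendsto_zero]
  have := (summable_norm_sq_lp f).tendsto_atTop_zero
  simpa using this.sqrt

theorem besselOp_eigenvector {ν : ℕ} {a : ℝ} {κ : ℝ} {f : ℓ²(ℕ, ℂ)} (hf : f ≠ 0)
    (h : besselOp ν a f = (κ : ℂ) • f) :
    ∃ k ∈ besselZeros ν a, κ = k⁻¹ ∧ ∃ c : ℂ, f = c • besselEig ν k := by
  set u : ℕ → ℂ := fun n => besselWeight ν n * f n with hu
  have hw : ∀ n, (besselWeight ν n : ℂ) ≠ 0 := fun n =>
    Complex.ofReal_ne_zero.2 (besselWeight_pos ν n).ne'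
  have hw2 : ∀ n, (besselWeight ν n : ℂ) ^ 2 * (2 * (ν + 1 + n)) = 1 := fun n => by
    have h1 := besselWeight_sq ν n
    rw [eq_div_iff (by positivity)] at h1
    exact_mod_cast h1
  have hfu : ∀ n, f n = 2 * (ν + 1 + n) * besselWeight ν n * u n := fun n => by
    simp only [hu]
    linear_combination (-f n) * hw2 n
  have h0 : u 1 + a * u 0 = κ * (2 * (ν + 1)) * u 0 := by
    have := congrArg (fun g : ℓ²(ℕ, ℂ) => g 0) h
    simp only [besselOp_zero] at this
    rw [lp.coeFn_smul, Pi.smul_apply, smul_eq_mul, hfu 0] at this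
    have hν : (ν : ℂ) + 1 ≠ 0 := Nat.cast_add_one_ne_zero ν
    have h1 : (besselWeight ν 1 : ℂ) * f 1 = u 1 := rfl
    rw [h1] at this
    push_cast at this
    field_simp at this
    refine mul_left_cancel₀ (mul_ne_zero (hw 0) hν) ?_
    linear_combination this
  have hs : ∀ n, u (n + 2) + u n = κ * (2 * (ν + 2 + n)) * u (n + 1) := fun n => by
    have := congrArg (fun g : ℓ²(ℕ, ℂ) => g (n + 1)) h
    simp only [besselOp_succ] at this
    rw [lp.coeFn_smul, Pi.smul_apply, smul_eq_mul, hfu (n + 1)] at this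
    refine mul_left_cancel₀ (hw (n + 1)) ?_
    rw [this]
    push_cast
    ring
  have hu0 : u 0 ≠ 0 := by
    intro h00
    have h1 : u 1 = 0 := by simpa [h00] using h0
    have hall : ∀ n, u n = 0 ∧ u (n + 1) = 0 := by
      intro n
      induction n with
      | zero => exact ⟨h00, h1⟩
      | succ n ih => exact ⟨ih.2, by simpa [ih.1, ih.2] using hs n⟩
    apply hf
    ext n
    rw [hfu, (hall n).1]
    simp
  have hut : Tendsto u atTop (𝓝 0) := by
    have h1 : Tendsto (fun n => (besselWeight ν n : ℂ)) atTop (𝓝 ((0 : ℝ) : ℂ)) :=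
      (Complex.continuous_ofReal.tendsto 0).comp (tendsto_besselWeight ν)
    simpa using h1.mul (tendsto_lp_coord f)
  have hκ : κ ≠ 0 := by
    rintro rfl
    have hev : ∀ n, ‖u (2 * n)‖ = ‖u 0‖ := by
      intro n
      induction n with
      | zero => rfl
      | succ n ih =>
        have := hs (2 * n)
        rw [Complex.ofReal_zero, zero_mul, zero_mul] at this
        rw [mul_add, mul_one, eq_neg_of_add_eq_zero_left this, norm_neg, ih]
    have h2 : Tendsto (fun n => ‖u (2 * n)‖) atTop (𝓝 0) :=
      tendsto_zero_iff_norm_tendsto_zero.1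
        (hut.comp (tendsto_id.const_mul_atTop' (by norm_num : 0 < 2)))
    simp only [hev] at h2
    exact hu0 (norm_eq_zero.1 (tendsto_nhds_unique tendsto_const_nhds h2))
  set k := κ⁻¹ with hkdef
  have hk0 : k ≠ 0 := inv_ne_zero hκ
  have hκk : κ = k⁻¹ := by simp [hkdef]
  set j : ℕ → ℂ := fun n => (besselJn (ν + 1 + n) k : ℂ) with hj
  have hj0 : j 1 + besselJn ν k = κ * (2 * (ν + 1)) * j 0 := by
    have := besselJn_recurrence ν k
    have h2 : besselJn (ν + 1 + 1) k + besselJn ν k = κ * (2 * (ν + 1)) * besselJn (ν + 1 + 0) k := by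
      rw [hκk, add_zero, show ν + 1 + 1 = ν + 2 from rfl]
      field_simp
      linear_combination this
    simp only [hj]
    exact_mod_cast h2
  have hjs : ∀ n, j (n + 2) + j n = κ * (2 * (ν + 2 + n)) * j (n + 1) := fun n => by
    have := besselJn_recurrence (ν + 1 + n) k
    have h2 : besselJn (ν + 1 + (n + 2)) k + besselJn (ν + 1 + n) k =
        κ * (2 * (ν + 2 + n)) * besselJn (ν + 1 + (n + 1)) k := by
      rw [hκk, show ν + 1 + (n + 2) = ν + 1 + n + 2 from rfl,
        show ν + 1 + (n + 1) = ν + 1 + n + 1 from rfl]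
      push_cast at this
      field_simp
      linear_combination this
    simp only [hj]
    exact_mod_cast h2
  have hjt : Tendsto j atTop (𝓝 0) := by
    have h1 : Tendsto (fun n => (besselWeight ν n : ℂ)) atTop (𝓝 ((0 : ℝ) : ℂ)) :=
      (Complex.continuous_ofReal.tendsto 0).comp (tendsto_besselWeight ν)
    have h2 := h1.mul (tendsto_lp_coord (besselEig ν k))
    simp only [besselEig, besselWeight_mul_besselVec, besselC_ofReal, Complex.ofReal_zero,
      mul_zero] at h2
    exact h2
  have hW : ∀ n, u n * j (n + 1) - u (n + 1) * j n = u 0 * j 1 - u 1 * j 0 := by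
    intro n
    induction n with
    | zero => rfl
    | succ n ih =>
      rw [← ih]
      linear_combination u (n + 1) * hjs n - j (n + 1) * hs n
  have hW0 : u 0 * j 1 - u 1 * j 0 = 0 := by
    have h1 : Tendsto (fun n => u n * j (n + 1) - u (n + 1) * j n) atTop (𝓝 (0 * 0 - 0 * 0)) :=
      (hut.mul (hjt.comp (tendsto_add_atTop_nat 1))).sub
        ((hut.comp (tendsto_add_atTop_nat 1)).mul hjt)
    simp only [hW] at h1
    simpa using tendsto_nhds_unique tendsto_const_nhds h1
  have hmem : k ∈ besselZeros ν a := by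
    refine ⟨hk0, ?_⟩
    have h1 : u 0 * ((besselJn ν k : ℂ) - a * j 0) = 0 := by
      linear_combination (-1 : ℂ) * hW0 + u 0 * hj0 - j 0 * h0
    have h2 := (mul_eq_zero.1 h1).resolve_left hu0
    simp only [hj, add_zero] at h2
    exact_mod_cast h2
  have hj00 : j 0 ≠ 0 := Complex.ofReal_ne_zero.2 (besselJn_ne_zero_of_mem hmem)
  have hprop : ∀ n, j 0 * u n = u 0 * j n ∧ j 0 * u (n + 1) = u 0 * j (n + 1) := by
    intro n
    induction n with
    | zero => exact ⟨mul_comm _ _, by linear_combination (-1 : ℂ) * hW0⟩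
    | succ n ih =>
      refine ⟨ih.2, ?_⟩
      linear_combination j 0 * hs n - u 0 * hjs n - ih.1 + κ * (2 * (ν + 2 + n)) * ih.2
  refine ⟨k, hmem, hκk, u 0 / j 0, ?_⟩
  ext n
  rw [lp.coeFn_smul, Pi.smul_apply, smul_eq_mul, hfu, besselEig, besselVec_eq, besselC_ofReal]
  have h1 : u n = u 0 / j 0 * j n := by
    field_simp
    linear_combination (hprop n).1
  rw [h1]
  simp only [hj]
  ring

theorem norm_sq_besselEig (ν : ℕ) (k : ℝ) :
    ‖besselEig ν k‖ ^ 2 = k ^ 2 * (besselJn ν k ^ 2 + besselJn (ν + 1) k ^ 2) -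
      (2 * ν + 1) * k * besselJn ν k * besselJn (ν + 1) k := by
  set T : ℕ → ℝ := fun m => k ^ 2 * (besselJn m k ^ 2 + besselJn (m + 1) k ^ 2) -
      (2 * m + 1) * k * besselJn m k * besselJn (m + 1) k with hT
  have hstep : ∀ m : ℕ, 2 * ((m : ℝ) + 1) * besselJn (m + 1) k ^ 2 = T m - T (m + 1) := by
    intro m
    have h := besselJn_recurrence m k
    simp only [hT, show m + 1 + 1 = m + 2 from rfl]
    push_cast
    linear_combination (-k * (besselJn m k - besselJn (m + 2) k) - besselJn (m + 1) k) * h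
  have hs : Summable fun m : ℕ => (m : ℝ) * besselJn m k ^ 2 := by
    refine (summable_besselC_sq k (-k ^ 2)).congr fun m => ?_
    rw [besselC_ofReal, Complex.norm_real, Real.norm_eq_abs, sq_abs]
  have h0 : Tendsto (fun m : ℕ => (m : ℝ) * besselJn m k ^ 2) atTop (𝓝 0) := hs.tendsto_atTop_zero
  have h1 : Tendsto (fun m : ℕ => ((m + 1 : ℕ) : ℝ) * besselJn (m + 1) k ^ 2) atTop (𝓝 0) :=
    h0.comp (tendsto_add_atTop_nat 1)
  have hT0 : Tendsto (fun n => T (n + 1)) atTop (𝓝 0) := by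
    have hb : ∀ᶠ m : ℕ in atTop, ‖T m‖ ≤ (k ^ 2 + 3 * |k|) * ((m : ℝ) * besselJn m k ^ 2 +
        ((m + 1 : ℕ) : ℝ) * besselJn (m + 1) k ^ 2) := by
      filter_upwards [eventually_ge_atTop 1] with m hm
      have hm' : (1 : ℝ) ≤ m := by exact_mod_cast hm
      simp only [hT]
      set p := besselJn m k
      set q := besselJn (m + 1) k
      have hpq : |p * q| ≤ (p ^ 2 + q ^ 2) / 2 := by
        rw [abs_le]; constructor <;> nlinarith [sq_nonneg (p + q), sq_nonneg (p - q)]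
      have e1 : ‖k ^ 2 * (p ^ 2 + q ^ 2)‖ ≤ k ^ 2 * (m * p ^ 2 + (m + 1) * q ^ 2) := by
        rw [Real.norm_of_nonneg (by positivity)]
        gcongr <;> nlinarith [sq_nonneg p, sq_nonneg q]
      have e2 : ‖(2 * (m : ℝ) + 1) * k * p * q‖ ≤ 3 * |k| * (m * p ^ 2 + (m + 1) * q ^ 2) := by
        rw [Real.norm_eq_abs, mul_assoc, abs_mul, abs_mul,
          abs_of_pos (by positivity : (0 : ℝ) < 2 * m + 1)]
        calc (2 * (m : ℝ) + 1) * |k| * |p * q| ≤ (3 * m) * |k| * ((p ^ 2 + q ^ 2) / 2) := by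
              gcongr; linarith
          _ ≤ (3 * m) * |k| * (p ^ 2 + q ^ 2) := by
              gcongr; nlinarith [sq_nonneg p, sq_nonneg q]
          _ = 3 * |k| * (m * p ^ 2 + m * q ^ 2) := by ring
          _ ≤ _ := by gcongr; linarith
      refine (norm_sub_le _ _).trans ?_
      push_cast
      linarith
    have hz : Tendsto (fun m : ℕ => (k ^ 2 + 3 * |k|) * ((m : ℝ) * besselJn m k ^ 2 +
        ((m + 1 : ℕ) : ℝ) * besselJn (m + 1) k ^ 2)) atTop (𝓝 0) := by
      simpa using (h0.add h1).const_mul (k ^ 2 + 3 * |k|)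
    exact (squeeze_zero_norm' hb hz).comp (tendsto_add_atTop_nat 1)
  rw [norm_sq_lp]
  refine HasSum.tsum_eq ?_
  rw [hasSum_iff_tendsto_nat_of_nonneg (fun _ => by positivity)]
  have hpart : ∀ N, ∑ n ∈ Finset.range N, ‖besselEig ν k n‖ ^ 2 = T ν - T (ν + N) := by
    intro N
    induction N with
    | zero => simp
    | succ N ih =>
      rw [Finset.sum_range_succ, ih, besselEig_apply, Complex.norm_real, Real.norm_eq_abs, sq_abs,
        mul_pow, Real.sq_sqrt (by positivity)]
      have := hstep (ν + N)
      rw [show ν + (N + 1) = ν + N + 1 from rfl, show ν + 1 + N = ν + N + 1 by ring]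
      push_cast at this
      linarith
  simp only [hpart]
  have h2 : Tendsto (fun N => T ν - T (ν + N)) atTop (𝓝 (T ν - 0)) := by
    refine tendsto_const_nhds.sub ?_
    have h3 := (tendsto_add_atTop_iff_nat (f := T) 1).1 hT0
    exact h3.comp (tendsto_add_atTop_nat ν |>.congr fun n => add_comm _ _)
  rwa [sub_zero] at h2

/-- The spectral weight of the zero `k`. -/
def besselSpecWeight (ν : ℕ) (a k : ℝ) : ℝ :=
  2 * (ν + 1) * (k⁻¹) ^ 2 / (1 + a ^ 2 - (2 * ν + 1) * a * k⁻¹)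

theorem norm_sq_besselEig_of_mem {ν : ℕ} {a k : ℝ} (hk : k ∈ besselZeros ν a) :
    ‖besselEig ν k‖ ^ 2 = besselJn (ν + 1) k ^ 2 * k ^ 2 *
      (1 + a ^ 2 - (2 * ν + 1) * a * k⁻¹) := by
  have h : besselJn ν k = a * besselJn (ν + 1) k := sub_eq_zero.1 hk.2
  have hk0 := hk.1
  rw [norm_sq_besselEig, h]
  field_simp
  ring

theorem besselEig_ne_zero {ν : ℕ} {a k : ℝ} (hk : k ∈ besselZeros ν a) : besselEig ν k ≠ 0 := by
  intro h0
  have h1 : besselEig ν k 0 = 0 := by rw [h0]; rfl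
  rw [besselEig_apply, Complex.ofReal_eq_zero, mul_eq_zero] at h1
  refine h1.elim (fun h => ?_) (besselJn_ne_zero_of_mem hk)
  rw [Real.sqrt_eq_zero (by positivity)] at h
  have : (0 : ℝ) ≤ ν := by positivity
  simp at h
  linarith

theorem besselDenom_pos {ν : ℕ} {a k : ℝ} (hk : k ∈ besselZeros ν a) :
    0 < 1 + a ^ 2 - (2 * ν + 1) * a * k⁻¹ := by
  have h1 := norm_sq_besselEig_of_mem hk
  have h2 : 0 < ‖besselEig ν k‖ ^ 2 := by
    have := norm_pos_iff.2 (besselEig_ne_zero hk); positivity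
  rw [h1] at h2
  exact (mul_pos_iff_of_pos_left (by
    have := besselJn_ne_zero_of_mem hk
    have := hk.1
    positivity)).1 h2

/-- The orthonormal eigenbasis. -/
def besselEigN (ν : ℕ) (k : ℝ) : ℓ²(ℕ, ℂ) := ((‖besselEig ν k‖⁻¹ : ℝ) : ℂ) • besselEig ν k

theorem orthonormal_besselEigN (ν : ℕ) (a : ℝ) :
    Orthonormal ℂ fun k : besselZeros ν a => besselEigN ν k := by
  refine ⟨fun k => ?_, fun k l hkl => ?_⟩
  · simp only [besselEigN]
    rw [norm_smul, Complex.norm_real, norm_inv, norm_norm]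
    exact inv_mul_cancel₀ (norm_ne_zero_iff.2 (besselEig_ne_zero k.2))
  · simp only [besselEigN]
    rw [inner_smul_left, inner_smul_right]
    have hs := besselOp_isSymmetric ν a (besselEig ν k) (besselEig ν l)
    change ⟪besselOp ν a (besselEig ν k), besselEig ν l⟫_ℂ =
      ⟪besselEig ν k, besselOp ν a (besselEig ν l)⟫_ℂ at hs
    rw [besselOp_besselEig k.2, besselOp_besselEig l.2, inner_smul_left, inner_smul_right,
      Complex.conj_ofReal, ← sub_eq_zero, ← sub_mul, mul_eq_zero] at hs
    rcases hs with hs | hs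
    · exfalso
      rw [sub_eq_zero, Complex.ofReal_inj, inv_inj] at hs
      exact hkl (Subtype.ext hs)
    · rw [hs, mul_zero, mul_zero]

theorem span_besselEigN (ν : ℕ) (a : ℝ) :
    (Submodule.span ℂ (Set.range fun k : besselZeros ν a => besselEigN ν k))ᗮ = ⊥ := by
  rw [eq_bot_iff, ← ContinuousLinearMap.orthogonalComplement_iSup_eigenspaces_eq_bot
    (besselOp_isCompactOperator ν a) (besselOp_isSymmetric ν a)]
  refine Submodule.orthogonal_le (iSup_le fun κ f hf => ?_)
  by_cases hf0 : f = 0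
  · rw [hf0]; exact zero_mem _
  rw [Module.End.mem_eigenspace_iff] at hf
  have hev : Module.End.HasEigenvalue (besselOp ν a : Module.End ℂ ℓ²(ℕ, ℂ)) κ :=
    Module.End.hasEigenvalue_of_hasEigenvector
      (x := f) ⟨Module.End.mem_eigenspace_iff.2 hf, hf0⟩
  have hconj := (besselOp_isSymmetric ν a).conj_eigenvalue_eq_self hev
  obtain ⟨r, rfl⟩ := Complex.conj_eq_iff_real.1 hconj
  obtain ⟨k, hk, -, c, rfl⟩ := besselOp_eigenvector hf0 hf
  have h1 : c • besselEig ν k = (c * (‖besselEig ν k‖ : ℂ)) • besselEigN ν k := by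
    rw [besselEigN, smul_smul, mul_assoc, ← Complex.ofReal_mul,
      mul_inv_cancel₀ (norm_ne_zero_iff.2 (besselEig_ne_zero hk)), Complex.ofReal_one, mul_one]
  rw [h1]
  exact Submodule.smul_mem _ _ (Submodule.subset_span ⟨⟨k, hk⟩, rfl⟩)

theorem hasSum_besselSpecWeight (ν : ℕ) (a : ℝ) (f : ℓ²(ℕ, ℂ)) (φ : ℝ → ℂ)
    (h : ∀ k ∈ besselZeros ν a, ⟪besselEig ν k, f⟫_ℂ =
      φ k * ⟪besselEig ν k, lp.single 2 0 (1 : ℂ)⟫_ℂ) :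
    HasSum (fun k : besselZeros ν a => (besselSpecWeight ν a k : ℂ) * φ k) (f 0) := by
  have hb := (HilbertBasis.mkOfOrthogonalEqBot (orthonormal_besselEigN ν a)
    (span_besselEigN ν a)).hasSum_inner_mul_inner (lp.single 2 0 (1 : ℂ)) f
  rw [← lp_coord_eq_inner] at hb
  refine hb.congr_fun ?_
  intro k
  rw [HilbertBasis.coe_mkOfOrthogonalEqBot]
  simp only [besselEigN]
  rw [← lp_coord_eq_inner, inner_smul_left, h k k.2, lp.coeFn_smul, Pi.smul_apply, smul_eq_mul,
    Complex.conj_ofReal, ← inner_conj_symm, ← lp_coord_eq_inner, besselEig_apply,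
    Complex.conj_ofReal]
  have hw : besselSpecWeight ν a k = (‖besselEig ν k‖ ^ 2)⁻¹ *
      (√(2 * (ν + 1 + (0 : ℕ))) * besselJn (ν + 1 + 0) k) ^ 2 := by
    rw [norm_sq_besselEig_of_mem k.2, mul_pow, Real.sq_sqrt (by positivity), besselSpecWeight]
    have h1 := besselJn_ne_zero_of_mem k.2
    have h2 := k.2.1
    have h3 := (besselDenom_pos k.2).ne'
    rw [add_zero]
    field_simp
    simp
  rw [hw]
  push_cast
  ring

/-- Half the ratio `B_{ν+1}/B_ν`, so that `I_{ν+1}(y)/I_ν(y) = y * besselG ν (y^2)`. -/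
def besselG (ν : ℕ) (x : ℝ) : ℝ := besselB (ν + 1) x / (2 * besselB ν x)

theorem besselG_pos (ν : ℕ) {x : ℝ} (hx : 0 ≤ x) : 0 < besselG ν x := by
  have := besselB_pos ν hx
  have := besselB_pos (ν + 1) hx
  unfold besselG
  positivity

theorem hasSum_specWeight_one (ν : ℕ) (a : ℝ) :
    HasSum (fun k : besselZeros ν a => besselSpecWeight ν a k) 1 := by
  have h := hasSum_besselSpecWeight ν a (lp.single 2 0 (1 : ℂ)) (fun _ => 1) (by simp)
  rw [lp.single_apply_self] at h
  simpa using Complex.hasSum_re h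

theorem inner_besselEig_besselOp {ν : ℕ} {a k : ℝ} (hk : k ∈ besselZeros ν a) (f : ℓ²(ℕ, ℂ)) :
    ⟪besselEig ν k, besselOp ν a f⟫_ℂ = ((k⁻¹ : ℝ) : ℂ) * ⟪besselEig ν k, f⟫_ℂ := by
  have h := besselOp_isSymmetric ν a (besselEig ν k) f
  change ⟪besselOp ν a (besselEig ν k), f⟫_ℂ = ⟪besselEig ν k, besselOp ν a f⟫_ℂ at h
  rw [← h, besselOp_besselEig hk, inner_smul_left, Complex.conj_ofReal]

theorem hasSum_specWeight_inv (ν : ℕ) (a : ℝ) :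
    HasSum (fun k : besselZeros ν a => besselSpecWeight ν a k * (k : ℝ)⁻¹)
      (a / (2 * (ν + 1))) := by
  have h := hasSum_besselSpecWeight ν a (besselOp ν a (lp.single 2 0 (1 : ℂ)))
    (fun k => ((k⁻¹ : ℝ) : ℂ)) (fun k hk => inner_besselEig_besselOp hk _)
  rw [besselOp_zero, lp.single_apply_self, lp.single_apply_ne _ _ _ one_ne_zero, mul_zero, mul_zero,
    zero_add, mul_one] at h
  have h2 := Complex.hasSum_re h
  rw [Complex.ofReal_re] at h2
  refine h2.congr_fun fun k => ?_
  rw [← Complex.ofReal_mul, Complex.ofReal_re]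

theorem hasSum_specWeight_resolvent (ν : ℕ) (a : ℝ) {y : ℝ} (hy : 0 < y) :
    HasSum (fun k : besselZeros ν a =>
        (besselSpecWeight ν a k : ℂ) * (1 - Complex.I * y * ((k : ℝ)⁻¹ : ℝ))⁻¹)
      (2 * (ν + 1) * besselG ν (y ^ 2) / (1 - Complex.I * (a * y * besselG ν (y ^ 2) : ℝ))) := by
  set z : ℂ := Complex.I * y with hzdef
  have hz : z ^ 2 = -((y ^ 2 : ℝ) : ℂ) := by
    rw [hzdef, mul_pow, Complex.I_sq]; push_cast; ring
  set C := (besselWeight ν 0 * z * (besselC z (y ^ 2) ν - a * besselC z (y ^ 2) (ν + 1))) with hC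
  have hB : 0 < besselB ν (y ^ 2) := besselB_pos ν (by positivity)
  have hBc : (besselB ν (y ^ 2) : ℂ) ≠ 0 := Complex.ofReal_ne_zero.2 hB.ne'
  have hz0 : z ≠ 0 := mul_ne_zero Complex.I_ne_zero (Complex.ofReal_ne_zero.2 hy.ne')
  have hre : ∀ r : ℝ, (1 - Complex.I * (r : ℂ)) ≠ 0 := fun r h => by
    have := congrArg Complex.re h
    simp at this
  have hG : (besselB (ν + 1) (y ^ 2) : ℂ) = 2 * besselB ν (y ^ 2) * besselG ν (y ^ 2) := by
    rw [besselG]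
    push_cast
    field_simp
  have hCeq : C = besselWeight ν 0 * z * (z / 2) ^ ν * besselB ν (y ^ 2) *
      (1 - Complex.I * (a * y * besselG ν (y ^ 2) : ℝ)) := by
    rw [hC, besselC, besselC, hG, pow_succ, hzdef]
    push_cast
    ring
  have hw0 : (besselWeight ν 0 : ℂ) ≠ 0 := Complex.ofReal_ne_zero.2 (besselWeight_pos ν 0).ne'
  have hC0 : C ≠ 0 := by
    rw [hCeq]
    exact mul_ne_zero (mul_ne_zero (mul_ne_zero (mul_ne_zero hw0 hz0)
      (pow_ne_zero _ (div_ne_zero hz0 two_ne_zero))) hBc) (hre _)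
  have hker : ∀ r : ℝ, 1 - z * (r : ℂ) ≠ 0 := fun r => by
    have := hre (y * r)
    rw [hzdef]
    push_cast at this
    rwa [mul_assoc]
  have h := hasSum_besselSpecWeight ν a (besselVec ν z (y ^ 2))
    (fun k => C * (1 - z * ((k⁻¹ : ℝ) : ℂ))⁻¹) (fun k hk => by
      have h1 := congrArg (fun f => ⟪besselEig ν k, f⟫_ℂ) (besselOp_besselVec ν a hz)
      simp only [inner_sub_right, inner_smul_right, inner_besselEig_besselOp hk] at h1
      rw [← hC] at h1
      have := hker k⁻¹
      change _ = C * (1 - z * ((k⁻¹ : ℝ) : ℂ))⁻¹ * _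
      rw [mul_right_comm, ← div_eq_mul_inv, eq_div_iff this]
      linear_combination h1)
  have h2 := h.mul_left C⁻¹
  have hval : C⁻¹ * besselVec ν z (y ^ 2) 0 =
      2 * (ν + 1) * besselG ν (y ^ 2) / (1 - Complex.I * (a * y * besselG ν (y ^ 2) : ℝ)) := by
    rw [hCeq, besselVec_eq, besselC, add_zero, hG, pow_succ (z / 2)]
    have := hre (a * y * besselG ν (y ^ 2))
    have hzz : (z / 2) ^ ν ≠ 0 := pow_ne_zero _ (div_ne_zero hz0 two_ne_zero)
    rw [inv_mul_eq_div, div_eq_div_iff (by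
      exact mul_ne_zero (mul_ne_zero (mul_ne_zero (mul_ne_zero hw0 hz0) hzz) hBc) this) this]
    push_cast
    ring
  rw [hval] at h2
  refine h2.congr_fun fun k => ?_
  field_simp

theorem re_inv_one_sub_I_mul (r : ℝ) : ((1 - Complex.I * (r : ℂ))⁻¹).re = (1 + r ^ 2)⁻¹ := by
  rw [Complex.inv_re, Complex.normSq_apply]
  simp [← sq]

theorem im_inv_one_sub_I_mul (r : ℝ) : ((1 - Complex.I * (r : ℂ))⁻¹).im = r / (1 + r ^ 2) := by
  rw [Complex.inv_im, Complex.normSq_apply]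
  simp [← sq]

theorem hasSum_specWeight_even (ν : ℕ) (a : ℝ) {x : ℝ} (hx : 0 < x) :
    HasSum (fun k : besselZeros ν a => besselSpecWeight ν a k / (1 + (k : ℝ)⁻¹ ^ 2 * x))
      (2 * (ν + 1) * besselG ν x / (1 + a ^ 2 * x * besselG ν x ^ 2)) := by
  have h := Complex.hasSum_re (hasSum_specWeight_resolvent ν a (Real.sqrt_pos.2 hx))
  have hxx : √x ^ 2 = x := Real.sq_sqrt hx.le
  rw [hxx] at h
  convert! h using 1
  · ext k
    rw [mul_assoc, ← Complex.ofReal_mul, Complex.re_ofReal_mul, re_inv_one_sub_I_mul, mul_pow, hxx]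
    ring
  · rw [div_eq_mul_inv _ (1 - Complex.I * _),
      show (2 * ((ν : ℂ) + 1) * (besselG ν x : ℂ)) = ((2 * (ν + 1) * besselG ν x : ℝ) : ℂ) by
        push_cast; ring, Complex.re_ofReal_mul, re_inv_one_sub_I_mul, mul_pow, mul_pow, hxx]
    ring

theorem hasSum_specWeight_odd (ν : ℕ) (a : ℝ) {x : ℝ} (hx : 0 < x) :
    HasSum (fun k : besselZeros ν a => besselSpecWeight ν a k * (k : ℝ)⁻¹ / (1 + (k : ℝ)⁻¹ ^ 2 * x))
      (2 * (ν + 1) * a * besselG ν x ^ 2 / (1 + a ^ 2 * x * besselG ν x ^ 2)) := by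
  have hs := Real.sqrt_pos.2 hx
  have h := (Complex.hasSum_im (hasSum_specWeight_resolvent ν a hs)).mul_left (√x)⁻¹
  have hxx : √x ^ 2 = x := Real.sq_sqrt hx.le
  rw [hxx] at h
  convert! h using 1
  · ext k
    rw [mul_assoc _ (√x : ℂ), ← Complex.ofReal_mul, Complex.im_ofReal_mul, im_inv_one_sub_I_mul,
      mul_pow, hxx, mul_comm x]
    rw [mul_comm (√x), mul_div_right_comm _ (√x), mul_comm _ (√x), ← mul_assoc, ← mul_assoc,
      mul_comm _ (√x), ← mul_assoc, mul_inv_cancel₀ hs.ne']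
    ring
  · rw [div_eq_mul_inv _ (1 - Complex.I * _),
      show (2 * ((ν : ℂ) + 1) * (besselG ν x : ℂ)) = ((2 * (ν + 1) * besselG ν x : ℝ) : ℂ) by
        push_cast; ring, Complex.im_ofReal_mul, im_inv_one_sub_I_mul, mul_pow, mul_pow, hxx]
    field_simp

end

theorem hasSum_specWeight_affine (ν : ℕ) (a : ℝ) :
    HasSum (fun k : besselZeros ν a => ((k : ℝ)⁻¹) ^ 2)
      ((1 + a ^ 2 - (2 * ν + 1) * a * (a / (2 * (ν + 1)))) / (2 * (ν + 1))) := by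
  have h := (((hasSum_specWeight_one ν a).mul_left (1 + a ^ 2)).sub
    ((hasSum_specWeight_inv ν a).mul_left ((2 * ν + 1) * a))).div_const (2 * (ν + 1))
  rw [mul_one] at h
  refine h.congr_fun fun k => ?_
  have := (besselDenom_pos k.2).ne'
  have hν : (0 : ℝ) < 2 * (ν + 1) := by positivity
  have hw : besselSpecWeight ν a k * (1 + a ^ 2 - (2 * ν + 1) * a * (k : ℝ)⁻¹) =
      2 * (ν + 1) * (k : ℝ)⁻¹ ^ 2 := by
    rw [besselSpecWeight, div_mul_cancel₀ _ this]
  rw [eq_div_iff hν.ne']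
  linear_combination -hw

theorem summable_besselZeros_sq (ν : ℕ) (a : ℝ) :
    Summable fun k : besselZeros ν a => ((k : ℝ)⁻¹) ^ 2 :=
  (hasSum_specWeight_affine ν a).summable

theorem tsum_besselZeros_sq_le (ν : ℕ) (a : ℝ) :
    ∑' k : besselZeros ν a, ((k : ℝ)⁻¹) ^ 2 ≤ (1 + a ^ 2) / (ν + 1) := by
  rw [(hasSum_specWeight_affine ν a).tsum_eq]
  have h1 : 0 ≤ (2 * ν + 1) * a * (a / (2 * (ν + 1))) := by
    rw [show (2 * ν + 1) * a * (a / (2 * (ν + 1))) = (2 * ν + 1) * a ^ 2 / (2 * (ν + 1)) by ring]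
    positivity
  have hν : (0 : ℝ) < ν + 1 := by positivity
  gcongr
  · linarith
  · linarith

theorem abs_inv_besselZeros_le {ν : ℕ} {a k : ℝ} (hk : k ∈ besselZeros ν a) :
    |k⁻¹| ≤ (2 + |a|) / (2 * (ν + 1)) := by
  set u : ℕ → ℝ := fun n => |besselJn (ν + 1 + n) k| with hu
  have hb : BddAbove (Set.range u) := by
    have h := (tendsto_besselWeight ν).mul
      (tendsto_zero_iff_norm_tendsto_zero.1 (tendsto_lp_coord (besselEig ν k)))
    have h2 : Tendsto u atTop (𝓝 (0 * 0)) := by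
      refine h.congr fun n => ?_
      have := besselWeight_mul_besselVec ν k (-k ^ 2) n
      rw [besselC_ofReal] at this
      have h3 := congrArg norm this
      rw [norm_mul, Complex.norm_real, Complex.norm_real, Real.norm_eq_abs, Real.norm_eq_abs,
        abs_of_pos (besselWeight_pos ν n)] at h3
      exact h3
    exact h2.bddAbove_range
  set M := ⨆ n, u n with hM
  have hle : ∀ n, u n ≤ M := fun n => le_ciSup hb n
  have hM0 : 0 < M := lt_of_lt_of_le (abs_pos.2 (besselJn_ne_zero_of_mem hk)) (hle 0)
  have hk0 : k ≠ 0 := hk.1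
  have hstep : ∀ n, |k⁻¹| * (2 * (ν + 1)) * u n ≤ (2 + |a|) * M := by
    intro n
    have h1 : |k⁻¹| * (2 * (ν + 1)) * u n ≤ |k⁻¹| * (2 * (ν + 1 + n)) * u n := by
      have : 0 ≤ u n := abs_nonneg _
      have hn : (0 : ℝ) ≤ n := by positivity
      exact mul_le_mul_of_nonneg_right
        (mul_le_mul_of_nonneg_left (by linarith) (abs_nonneg _)) this
    refine h1.trans ?_
    have h2 : |k⁻¹| * (2 * (ν + 1 + n)) * u n =
        |besselJn (ν + n) k + besselJn (ν + n + 2) k| := by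
      have := besselJn_recurrence (ν + n) k
      have h3 : besselJn (ν + n) k + besselJn (ν + n + 2) k =
          k⁻¹ * (2 * (ν + 1 + n)) * besselJn (ν + 1 + n) k := by
        rw [show ν + 1 + n = ν + n + 1 by ring]
        push_cast at this
        field_simp
        linear_combination this
      rw [h3, abs_mul, abs_mul, abs_of_pos (by positivity : (0 : ℝ) < 2 * (ν + 1 + n))]
    rw [h2]
    refine (abs_add_le _ _).trans ?_
    have h4 : |besselJn (ν + n + 2) k| ≤ M := by
      have := hle (n + 1)
      simp only [hu] at this
      rwa [show ν + 1 + (n + 1) = ν + n + 2 by ring] at this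
    have h5 : |besselJn (ν + n) k| ≤ (1 + |a|) * M := by
      cases n with
      | zero =>
        have h6 : besselJn ν k = a * besselJn (ν + 1) k := sub_eq_zero.1 hk.2
        have h7 := hle 0
        simp only [hu, add_zero] at h7
        rw [add_zero, h6, abs_mul]
        nlinarith [abs_nonneg a]
      | succ n =>
        have h7 := hle n
        simp only [hu] at h7
        rw [show ν + 1 + n = ν + (n + 1) by ring] at h7
        nlinarith [abs_nonneg a]
    linarith
  rw [le_div_iff₀ (by positivity)]
  have h8 : M ≤ (2 + |a|) * M / (|k⁻¹| * (2 * (ν + 1))) := by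
    refine ciSup_le fun n => ?_
    rw [le_div_iff₀ (by have := abs_pos.2 (inv_ne_zero hk0); positivity)]
    linarith [hstep n]
  rw [le_div_iff₀ (by have := abs_pos.2 (inv_ne_zero hk0); positivity)] at h8
  nlinarith

/-- The generating function of the odd power sums of the reciprocal zeros. -/
def besselH (ν : ℕ) (a x : ℝ) : ℝ :=
  a * (1 - x * besselG ν x ^ 2 - (2 * ν + 1) * besselG ν x) / (1 + a ^ 2 * x * besselG ν x ^ 2)

theorem hasSum_besselH (ν : ℕ) (a : ℝ) {x : ℝ} (hx : 0 < x) :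
    HasSum (fun k : besselZeros ν a => (k : ℝ)⁻¹ ^ 3 * x / (1 + (k : ℝ)⁻¹ ^ 2 * x))
      (a / (2 * (ν + 1)) - besselH ν a x) := by
  have h := (((hasSum_specWeight_odd ν a hx).mul_left ((1 + a ^ 2) * x)).sub
    (((hasSum_specWeight_one ν a).sub (hasSum_specWeight_even ν a hx)).mul_left
      ((2 * ν + 1) * a))).div_const (2 * (ν + 1))
  convert! h using 1
  · ext k
    have h1 := (besselDenom_pos k.2).ne'
    have h2 : 1 + (k : ℝ)⁻¹ ^ 2 * x ≠ 0 := by positivity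
    have hν : (0 : ℝ) < 2 * (ν + 1) := by positivity
    set w := besselSpecWeight ν a k with hw
    have hw' : w * (1 + a ^ 2 - (2 * ν + 1) * a * (k : ℝ)⁻¹) = 2 * (ν + 1) * (k : ℝ)⁻¹ ^ 2 := by
      rw [hw, besselSpecWeight, div_mul_cancel₀ _ h1]
    set κ := (k : ℝ)⁻¹
    rw [eq_div_iff hν.ne', div_mul_eq_mul_div, div_eq_iff h2]
    have h3 : w / (1 + κ ^ 2 * x) * (1 + κ ^ 2 * x) = w := div_mul_cancel₀ _ h2
    have h4 : w * κ / (1 + κ ^ 2 * x) * (1 + κ ^ 2 * x) = w * κ := div_mul_cancel₀ _ h2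
    linear_combination (-x * κ) * hw' - ((1 + a ^ 2) * x) * h4 - (2 * ν + 1) * a * h3
  · have hν : (0 : ℝ) < 2 * (ν + 1) := by positivity
    have hD : 1 + a ^ 2 * x * besselG ν x ^ 2 ≠ 0 := by positivity
    rw [besselH]
    field_simp
    ring

theorem mul_one_add_inv_cube_comp {b : ℂ} {y : ℝ} (hy : y ∈ Ioo (0 : ℝ) 1) :
    |-(y ^ 2)⁻¹| • (((y⁻¹ - 1 : ℝ) : ℂ) ^ (b - 1) • (((1 + (y⁻¹ - 1)) ^ 3)⁻¹ : ℝ) : ℂ) =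
      (y : ℂ) ^ (3 - b - 1) * (1 - (y : ℂ)) ^ (b - 1) := by
  obtain ⟨h0, h1⟩ := hy
  have e1 : y⁻¹ - 1 = (1 - y) * y⁻¹ := by field_simp
  have e2 : ((y⁻¹ - 1 : ℝ) : ℂ) ^ (b - 1) = (1 - (y : ℂ)) ^ (b - 1) * (y : ℂ) ^ (-(b - 1)) := by
    rw [e1, Complex.ofReal_mul, Complex.mul_cpow_ofReal_nonneg (by linarith) (by positivity),
      Complex.ofReal_inv, Complex.inv_cpow _ _ (by
        rw [Complex.arg_ofReal_of_nonneg h0.le]; exact Real.pi_pos.ne), Complex.cpow_neg]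
    push_cast
    ring
  have e3 : (y : ℂ) ^ (3 - b - 1) = (y : ℂ) * (y : ℂ) ^ (-(b - 1)) := by
    rw [show (3 : ℂ) - b - 1 = 1 + -(b - 1) by ring,
      Complex.cpow_add _ _ (by exact_mod_cast h0.ne'), Complex.cpow_one]
  have e4 : |-(y ^ 2)⁻¹| = (y ^ 2)⁻¹ := by rw [abs_neg, abs_of_pos (by positivity)]
  have hy0 : (y : ℂ) ≠ 0 := by exact_mod_cast h0.ne'
  rw [e2, e3, e4, Complex.real_smul, smul_eq_mul, add_sub_cancel]
  push_cast
  field_simp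

theorem image_inv_sub_one_Ioo : (fun y : ℝ => y⁻¹ - 1) '' Ioo 0 1 = Ioi 0 := by
  ext t
  constructor
  · rintro ⟨y, ⟨h0, h1⟩, rfl⟩
    have := (one_lt_inv₀ h0).2 h1
    simpa using this
  · intro ht
    have ht' : 0 < t := ht
    refine ⟨(1 + t)⁻¹, ⟨by positivity, inv_lt_one_of_one_lt₀ (by linarith)⟩, ?_⟩
    simp

/-- The Mellin transform of `t ↦ (1 + t)⁻³`. -/
theorem hasMellin_one_add_inv_cube {b : ℂ} (h0 : 0 < b.re) (h3 : b.re < 3) :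
    HasMellin (fun t : ℝ => ((((1 + t) ^ 3)⁻¹ : ℝ) : ℂ)) b
      (Complex.Gamma b * Complex.Gamma (3 - b) / 2) := by
  have hd : ∀ y ∈ Ioo (0 : ℝ) 1,
      HasDerivWithinAt (fun y : ℝ => y⁻¹ - 1) (-(y ^ 2)⁻¹) (Ioo 0 1) y := fun y hy =>
    ((hasDerivAt_inv hy.1.ne').sub_const 1).hasDerivWithinAt
  have hinj : InjOn (fun y : ℝ => y⁻¹ - 1) (Ioo 0 1) := by
    intro y _ z _ h
    simpa using h
  have h3' : 0 < (3 - b).re := by simp; linarith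
  constructor
  · rw [MellinConvergent, ← image_inv_sub_one_Ioo,
      MeasureTheory.integrableOn_image_iff_integrableOn_abs_deriv_smul measurableSet_Ioo hd hinj]
    have h := Complex.betaIntegral_convergent h3' h0
    rw [intervalIntegrable_iff_integrableOn_Ioo_of_le zero_le_one] at h
    exact h.congr_fun (fun y hy => (mul_one_add_inv_cube_comp hy).symm) measurableSet_Ioo
  · rw [mellin, ← image_inv_sub_one_Ioo,
      MeasureTheory.integral_image_eq_integral_abs_deriv_smul measurableSet_Ioo hd hinj,
      MeasureTheory.setIntegral_congr_fun measurableSet_Ioo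
        (fun y hy => mul_one_add_inv_cube_comp hy), mul_comm (Complex.Gamma b),
      Complex.Gamma_mul_Gamma_eq_betaIntegral h3' h0, Complex.betaIntegral,
      intervalIntegral.integral_of_le zero_le_one, MeasureTheory.integral_Ioc_eq_integral_Ioo]
    have : Complex.Gamma (3 - b + b) = 2 := by
      rw [sub_add_cancel]
      have := Complex.Gamma_nat_eq_factorial 2
      rw [show ((2 : ℕ) : ℂ) + 1 = 3 by norm_num] at this
      rw [this]
      norm_num
    rw [this]
    ring

section TermwiseDerivative

variable {ι : Type*} {κ : ι → ℝ} {B : ℝ}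

theorem hasDerivAt_cauchy_term (c : ℝ) {x : ℝ} (hx : 0 < x) :
    HasDerivAt (fun x => c ^ 3 * x / (1 + c ^ 2 * x)) (c ^ 3 / (1 + c ^ 2 * x) ^ 2) x := by
  have h0 : 1 + c ^ 2 * x ≠ 0 := by positivity
  have h1 : HasDerivAt (fun x : ℝ => 1 + c ^ 2 * x) (c ^ 2 * 1) x :=
    ((hasDerivAt_id x).const_mul _).const_add _
  have h2 : HasDerivAt (fun x : ℝ => c ^ 3 * x) (c ^ 3 * 1) x := (hasDerivAt_id x).const_mul _
  refine (h2.div h1 h0).congr_deriv ?_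
  field_simp
  ring

theorem hasDerivAt_cauchy_term_sq (c : ℝ) {x : ℝ} (hx : 0 < x) :
    HasDerivAt (fun x => c ^ 3 / (1 + c ^ 2 * x) ^ 2) (-(2 * c ^ 5 / (1 + c ^ 2 * x) ^ 3)) x := by
  have h0 : 1 + c ^ 2 * x ≠ 0 := by positivity
  have h1 : HasDerivAt (fun x : ℝ => 1 + c ^ 2 * x) (c ^ 2 * 1) x :=
    ((hasDerivAt_id x).const_mul _).const_add _
  refine ((hasDerivAt_const x (c ^ 3)).div (h1.fun_pow 2) (pow_ne_zero 2 h0)).congr_deriv ?_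
  field_simp
  ring

theorem abs_div_one_add_pow_le (c d : ℝ) (n : ℕ) {x : ℝ} (hx : 0 < x) :
    |c / (1 + d ^ 2 * x) ^ n| ≤ |c| := by
  have h1 : (1 : ℝ) ≤ 1 + d ^ 2 * x := by nlinarith [mul_nonneg (sq_nonneg d) hx.le]
  have h0 : (1 : ℝ) ≤ (1 + d ^ 2 * x) ^ n := one_le_pow₀ h1
  rw [abs_div, abs_of_pos (by linarith : 0 < (1 + d ^ 2 * x) ^ n)]
  exact div_le_self (abs_nonneg _) h0

theorem abs_cube_le {c : ℝ} (hB : |c| ≤ B) : |c ^ 3| ≤ B * c ^ 2 := by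
  rw [abs_pow, pow_succ, sq_abs, mul_comm]
  gcongr

theorem abs_fifth_le {c : ℝ} (hB : |c| ≤ B) : |2 * c ^ 5| ≤ 2 * B ^ 3 * c ^ 2 := by
  rw [abs_mul, abs_two, abs_pow, show 5 = 3 + 2 from rfl, pow_add, sq_abs, mul_assoc]
  gcongr

theorem summable_cauchy_fifth (hs : Summable fun i => κ i ^ 2) (hB : ∀ i, |κ i| ≤ B) {x : ℝ}
    (hx : 0 < x) : Summable fun i => 2 * κ i ^ 5 / (1 + κ i ^ 2 * x) ^ 3 :=
  Summable.of_norm_bounded (hs.mul_left (2 * B ^ 3)) fun i =>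
    (abs_div_one_add_pow_le _ _ 3 hx).trans (abs_fifth_le (hB i))

theorem hasDerivAt_tsum_cauchy (hs : Summable fun i => κ i ^ 2) (hB : ∀ i, |κ i| ≤ B) {x : ℝ}
    (hx : 0 < x) : HasDerivAt (fun x => ∑' i, κ i ^ 3 * x / (1 + κ i ^ 2 * x))
      (∑' i, κ i ^ 3 / (1 + κ i ^ 2 * x) ^ 2) x := by
  refine hasDerivAt_tsum_of_isPreconnected (hs.mul_left B) isOpen_Ioi isPreconnected_Ioi
    (fun i y hy => hasDerivAt_cauchy_term (κ i) hy)
    (fun i y hy => (abs_div_one_add_pow_le _ _ 2 hy).trans (abs_cube_le (hB i)))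
    (y₀ := 1) (mem_Ioi.2 one_pos) ?_ hx
  refine Summable.of_norm_bounded (hs.mul_left B) fun i => ?_
  have := abs_div_one_add_pow_le (κ i ^ 3) (κ i) 1 one_pos
  simp only [mul_one, pow_one] at this ⊢
  exact this.trans (abs_cube_le (hB i))

theorem hasDerivAt_tsum_cauchy_sq (hs : Summable fun i => κ i ^ 2) (hB : ∀ i, |κ i| ≤ B) {x : ℝ}
    (hx : 0 < x) : HasDerivAt (fun x => ∑' i, κ i ^ 3 / (1 + κ i ^ 2 * x) ^ 2)
      (-∑' i, 2 * κ i ^ 5 / (1 + κ i ^ 2 * x) ^ 3) x := by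
  rw [← tsum_neg]
  refine hasDerivAt_tsum_of_isPreconnected (hs.mul_left (2 * B ^ 3)) isOpen_Ioi isPreconnected_Ioi
    (fun i y hy => hasDerivAt_cauchy_term_sq (κ i) hy)
    (fun i y hy => ?_) (y₀ := 1) (mem_Ioi.2 one_pos) ?_ hx
  · rw [norm_neg]
    exact (abs_div_one_add_pow_le _ _ 3 hy).trans (abs_fifth_le (hB i))
  · exact Summable.of_norm_bounded (hs.mul_left B) fun i =>
      (abs_div_one_add_pow_le _ _ 2 one_pos).trans (abs_cube_le (hB i))

end TermwiseDerivative

theorem hasSum_besselH_deriv_deriv {ν : ℕ} {a : ℝ} {H₁ H₂ : ℝ → ℝ}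
    (h₁ : ∀ x, 0 < x → HasDerivAt (besselH ν a) (H₁ x) x)
    (h₂ : ∀ x, 0 < x → HasDerivAt H₁ (H₂ x) x) {x : ℝ} (hx : 0 < x) :
    HasSum (fun k : besselZeros ν a => 2 * (k : ℝ)⁻¹ ^ 5 / (1 + (k : ℝ)⁻¹ ^ 2 * x) ^ 3)
      (H₂ x) := by
  have hs := summable_besselZeros_sq ν a
  have hB : ∀ k : besselZeros ν a, |(k : ℝ)⁻¹| ≤ (2 + |a|) / (2 * (ν + 1)) := fun k =>
    abs_inv_besselZeros_le k.2
  have e1 : ∀ y, 0 < y → H₁ y =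
      -∑' k : besselZeros ν a, (k : ℝ)⁻¹ ^ 3 / (1 + (k : ℝ)⁻¹ ^ 2 * y) ^ 2 := by
    intro y hy
    refine (h₁ y hy).unique ?_
    refine (((hasDerivAt_tsum_cauchy hs hB hy).const_sub (a / (2 * (ν + 1))))).congr_of_eventuallyEq
      ?_
    filter_upwards [lt_mem_nhds hy] with z hz
    rw [(hasSum_besselH ν a hz).tsum_eq]
    ring
  have e2 : H₂ x = ∑' k : besselZeros ν a, 2 * (k : ℝ)⁻¹ ^ 5 / (1 + (k : ℝ)⁻¹ ^ 2 * x) ^ 3 := by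
    refine (h₂ x hx).unique ?_
    have := (hasDerivAt_tsum_cauchy_sq hs hB hx).neg
    rw [neg_neg] at this
    refine this.congr_of_eventuallyEq ?_
    filter_upwards [lt_mem_nhds hx] with z hz
    exact e1 z hz
  rw [e2]
  exact (summable_cauchy_fifth hs hB hx).hasSum

/-- The odd Dirichlet series of the zeros. -/
def besselOddZeta (ν : ℕ) (a : ℝ) (s : ℂ) : ℂ :=
  ∑' k : besselZeros ν a, ((SignType.sign (k : ℝ) : ℝ) : ℂ) * ((|(k : ℝ)| : ℝ) : ℂ) ^ (-s)

theorem hasMellin_cauchy_fifth {k : ℝ} (hk : k ≠ 0) {b : ℂ} (h0 : 0 < b.re) (h3 : b.re < 3) :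
    HasMellin (fun x : ℝ => ((2 * k⁻¹ ^ 5 / (1 + k⁻¹ ^ 2 * x) ^ 3 : ℝ) : ℂ)) b
      (Complex.Gamma b * Complex.Gamma (3 - b) *
        (((SignType.sign k : ℝ) : ℂ) * ((|k| : ℝ) : ℂ) ^ (-(5 - 2 * b)))) := by
  have hpos : 0 < k⁻¹ ^ 2 := by positivity
  have h := hasMellin_one_add_inv_cube h0 h3
  have e : (fun x : ℝ => ((2 * k⁻¹ ^ 5 / (1 + k⁻¹ ^ 2 * x) ^ 3 : ℝ) : ℂ)) =
      fun x : ℝ => ((2 * k⁻¹ ^ 5 : ℝ) : ℂ) •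
        (fun t : ℝ => ((((1 + t) ^ 3)⁻¹ : ℝ) : ℂ)) (k⁻¹ ^ 2 * x) := by
    ext x
    rw [smul_eq_mul, ← Complex.ofReal_mul, div_eq_mul_inv]
  rw [e]
  constructor
  · exact ((MellinConvergent.comp_mul_left hpos).2 h.1).const_smul _
  · rw [mellin_const_smul, mellin_comp_mul_left (fun t : ℝ => ((((1 + t) ^ 3)⁻¹ : ℝ) : ℂ)) b hpos, h.2]
    have hk' : (0 : ℝ) < |k| := abs_pos.2 hk
    have hkc : ((|k| : ℝ) : ℂ) ≠ 0 := by exact_mod_cast hk'.ne'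
    have e1 : ((k⁻¹ ^ 2 : ℝ) : ℂ) ^ (-b) = ((|k| : ℝ) : ℂ) ^ (2 * b) := by
      have : (k⁻¹ ^ 2 : ℝ) = (|k| ^ 2)⁻¹ := by rw [sq_abs, inv_pow]
      rw [this, Complex.ofReal_inv, Complex.inv_cpow _ _ (by
        rw [Complex.arg_ofReal_of_nonneg (by positivity)]; exact Real.pi_pos.ne), Complex.cpow_neg,
        inv_inv, pow_two, Complex.ofReal_mul, Complex.mul_cpow_ofReal_nonneg hk'.le hk'.le,
        ← pow_two, ← Complex.cpow_nat_mul]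
      norm_num
    have e2 : (k⁻¹ ^ 5 : ℝ) = SignType.sign k * |k|⁻¹ ^ 5 := by
      rcases hk.lt_or_gt with h | h
      · rw [sign_neg h, abs_of_neg h]; simp only [inv_neg, SignType.coe_neg, SignType.coe_one]; ring
      · rw [sign_pos h, abs_of_pos h]; simp
    have e3 : ((|k| : ℝ) : ℂ) ^ (-(5 - 2 * b)) = ((|k| : ℝ) : ℂ)⁻¹ ^ 5 * ((|k| : ℝ) : ℂ) ^ (2 * b) := by
      rw [show -(5 - 2 * b) = 2 * b - (5 : ℕ) by push_cast; ring, Complex.cpow_sub _ _ hkc,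
        Complex.cpow_natCast, inv_pow, div_eq_mul_inv, mul_comm]
    rw [e1, e2, e3, smul_eq_mul, smul_eq_mul]
    push_cast
    ring

theorem rpow_neg_abs_besselZeros_le {ν : ℕ} {a k : ℝ} (hk : k ∈ besselZeros ν a) {σ : ℝ}
    (hσ : 2 ≤ σ) :
    |k| ^ (-σ) ≤ ((2 + |a|) / (2 * (ν + 1))) ^ (σ - 2) * k⁻¹ ^ 2 := by
  have hk' : 0 < |k| := abs_pos.2 hk.1
  have e : |k| ^ (-σ) = |k⁻¹| ^ (σ - 2) * k⁻¹ ^ 2 := by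
    rw [abs_inv, Real.inv_rpow hk'.le, ← Real.rpow_neg hk'.le, ← sq_abs k⁻¹, abs_inv, inv_pow,
      ← Real.rpow_natCast |k| 2, ← Real.rpow_neg hk'.le, ← Real.rpow_add hk']
    congr 1
    push_cast
    ring
  rw [e]
  gcongr
  exact abs_inv_besselZeros_le hk

theorem summable_rpow_neg_abs_besselZeros (ν : ℕ) (a : ℝ) {σ : ℝ} (hσ : 2 ≤ σ) :
    Summable fun k : besselZeros ν a => |(k : ℝ)| ^ (-σ) :=
  Summable.of_nonneg_of_le (fun _ => Real.rpow_nonneg (abs_nonneg _) _)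
    (fun k => rpow_neg_abs_besselZeros_le k.2 hσ) ((summable_besselZeros_sq ν a).mul_left _)

theorem tsum_rpow_neg_abs_besselZeros_le (ν : ℕ) (a : ℝ) {σ : ℝ} (hσ : 2 ≤ σ) :
    ∑' k : besselZeros ν a, |(k : ℝ)| ^ (-σ) ≤
      ((2 + |a|) / (2 * (ν + 1))) ^ (σ - 2) * ((1 + a ^ 2) / (ν + 1)) := by
  calc _ ≤ ∑' k : besselZeros ν a, ((2 + |a|) / (2 * (ν + 1))) ^ (σ - 2) * (k : ℝ)⁻¹ ^ 2 :=
        (summable_rpow_neg_abs_besselZeros ν a hσ).tsum_le_tsum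
          (fun k => rpow_neg_abs_besselZeros_le k.2 hσ) ((summable_besselZeros_sq ν a).mul_left _)
    _ ≤ _ := by
        rw [tsum_mul_left]
        gcongr
        exact tsum_besselZeros_sq_le ν a

theorem countable_besselZeros (ν : ℕ) (a : ℝ) : Countable (besselZeros ν a) := by
  have h := (summable_besselZeros_sq ν a).countable_support
  rw [show Function.support (fun k : besselZeros ν a => ((k : ℝ)⁻¹) ^ 2) = univ from
    eq_univ_of_forall fun k => by
      have := k.2.1
      simp [this]] at h
  exact countable_univ_iff.1 h

theorem integral_norm_cauchy_fifth {k : ℝ} (hk : k ≠ 0) {b : ℂ} (h0 : 0 < b.re) (h3 : b.re < 3) :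
    ∫ x in Ioi (0 : ℝ), ‖(x : ℂ) ^ (b - 1) • ((2 * k⁻¹ ^ 5 / (1 + k⁻¹ ^ 2 * x) ^ 3 : ℝ) : ℂ)‖ =
      ‖Complex.Gamma b.re * Complex.Gamma (3 - b.re)‖ * |k| ^ (-(5 - 2 * b.re)) := by
  have hk' : 0 < |k| := abs_pos.2 hk
  have h := hasMellin_cauchy_fifth (k := |k|) hk'.ne' (b := (b.re : ℂ)) (by simpa) (by simpa)
  have e : ((∫ x in Ioi (0 : ℝ),
      ‖(x : ℂ) ^ (b - 1) • ((2 * k⁻¹ ^ 5 / (1 + k⁻¹ ^ 2 * x) ^ 3 : ℝ) : ℂ)‖ : ℝ) : ℂ) =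
      mellin (fun x : ℝ => ((2 * |k|⁻¹ ^ 5 / (1 + |k|⁻¹ ^ 2 * x) ^ 3 : ℝ) : ℂ)) b.re := by
    rw [mellin, ← integral_complex_ofReal]
    refine MeasureTheory.setIntegral_congr_fun measurableSet_Ioi fun x hx => ?_
    have hx' : 0 < x := hx
    have h1 : (0 : ℝ) < 1 + k⁻¹ ^ 2 * x := by positivity
    simp only [smul_eq_mul]
    rw [norm_mul, Complex.norm_cpow_eq_rpow_re_of_pos hx', Complex.norm_real, Complex.ofReal_mul,
      Complex.ofReal_cpow hx'.le, Real.norm_eq_abs, abs_div, abs_mul, abs_two, abs_pow,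
      abs_of_pos (pow_pos h1 3), abs_inv, ← abs_inv k, sq_abs]
    simp
  have e2 : 0 ≤ ∫ x in Ioi (0 : ℝ),
      ‖(x : ℂ) ^ (b - 1) • ((2 * k⁻¹ ^ 5 / (1 + k⁻¹ ^ 2 * x) ^ 3 : ℝ) : ℂ)‖ :=
    MeasureTheory.integral_nonneg fun _ => norm_nonneg _
  rw [← abs_of_nonneg e2, ← Real.norm_eq_abs, ← Complex.norm_real, e, h.2, norm_mul, norm_mul,
    sign_pos hk', abs_abs, norm_mul, Complex.norm_cpow_eq_rpow_re_of_pos hk']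
  simp

theorem mellin_besselH_deriv_deriv {ν : ℕ} {a : ℝ} {H₁ H₂ : ℝ → ℝ}
    (h₁ : ∀ x, 0 < x → HasDerivAt (besselH ν a) (H₁ x) x)
    (h₂ : ∀ x, 0 < x → HasDerivAt H₁ (H₂ x) x) {b : ℂ} (h0 : 0 < b.re) (h3 : b.re ≤ 3 / 2) :
    mellin (fun x => (H₂ x : ℂ)) b =
      Complex.Gamma b * Complex.Gamma (3 - b) * besselOddZeta ν a (5 - 2 * b) := by
  have := countable_besselZeros ν a
  have hb3 : b.re < 3 := by linarith
  have key := MeasureTheory.hasSum_integral_of_summable_integral_norm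
    (μ := MeasureTheory.volume.restrict (Ioi (0 : ℝ)))
    (F := fun (k : besselZeros ν a) (x : ℝ) => (x : ℂ) ^ (b - 1) •
      ((2 * (k : ℝ)⁻¹ ^ 5 / (1 + (k : ℝ)⁻¹ ^ 2 * x) ^ 3 : ℝ) : ℂ))
    (fun k => (hasMellin_cauchy_fifth k.2.1 h0 hb3).1)
    (by
      refine ((summable_rpow_neg_abs_besselZeros ν a (σ := 5 - 2 * b.re) (by linarith)).mul_left
        ‖Complex.Gamma b.re * Complex.Gamma (3 - b.re)‖).congr fun k => ?_
      exact (integral_norm_cauchy_fifth k.2.1 h0 hb3).symm)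
  have e1 : mellin (fun x => (H₂ x : ℂ)) b = ∫ x in Ioi (0 : ℝ), ∑' k : besselZeros ν a,
      (x : ℂ) ^ (b - 1) • ((2 * (k : ℝ)⁻¹ ^ 5 / (1 + (k : ℝ)⁻¹ ^ 2 * x) ^ 3 : ℝ) : ℂ) := by
    rw [mellin]
    refine MeasureTheory.setIntegral_congr_fun measurableSet_Ioi fun x hx => ?_
    have := (Complex.hasSum_ofReal (L := SummationFilter.unconditional _)).2 (hasSum_besselH_deriv_deriv h₁ h₂ hx)
    exact ((this.const_smul ((x : ℂ) ^ (b - 1))).tsum_eq).symm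
  rw [e1, ← key.tsum_eq, besselOddZeta, ← tsum_mul_left]
  exact tsum_congr fun k => (hasMellin_cauchy_fifth k.2.1 h0 hb3).2

/-- The shifted order `ν + 1/2` for `ν = i + 1`. -/
def bagMu (i : ℕ) : ℝ := i + 3 / 2

theorem bagMu_ge (i : ℕ) : 3 / 2 ≤ bagMu i := by
  have : (0 : ℝ) ≤ i := Nat.cast_nonneg i
  rw [bagMu]; linarith

theorem bagMu_pos (i : ℕ) : 0 < bagMu i := by linarith [bagMu_ge i]

theorem bagMu_ne_zero (i : ℕ) : bagMu i ≠ 0 := (bagMu_pos i).ne'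

/-- Families of functions on `(0, 1]` that are, together with `n` derivatives, uniformly
bounded by a multiple of `(bagMu i)⁻ᵏ`. -/
def SymbolBound : ℕ → ℕ → (ℕ → ℝ → ℝ) → Prop
  | 0, k, f => ∃ C, ∀ i, ∀ τ ∈ Ioc (0 : ℝ) 1, |f i τ| * bagMu i ^ k ≤ C
  | n + 1, k, f => (∃ C, ∀ i, ∀ τ ∈ Ioc (0 : ℝ) 1, |f i τ| * bagMu i ^ k ≤ C) ∧
      ∃ f' : ℕ → ℝ → ℝ, (∀ i, ∀ τ ∈ Ioc (0 : ℝ) 1,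
        HasDerivWithinAt (f i) (f' i τ) (Ioc 0 1) τ) ∧ SymbolBound n k f'

namespace SymbolBound

variable {n k l : ℕ} {f g f' : ℕ → ℝ → ℝ}

theorem bound (h : SymbolBound n k f) :
    ∃ C, ∀ i, ∀ τ ∈ Ioc (0 : ℝ) 1, |f i τ| * bagMu i ^ k ≤ C := by
  cases n with
  | zero => exact h
  | succ n => exact h.1

theorem uniqueDiffOn : UniqueDiffOn ℝ (Ioc (0 : ℝ) 1) := uniqueDiffOn_Ioc 0 1

theorem congr (h : SymbolBound n k f) (hfg : ∀ i, ∀ τ ∈ Ioc (0 : ℝ) 1, g i τ = f i τ) :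
    SymbolBound n k g := by
  have hb : ∃ C, ∀ i, ∀ τ ∈ Ioc (0 : ℝ) 1, |g i τ| * bagMu i ^ k ≤ C := by
    obtain ⟨C, hC⟩ := h.bound
    exact ⟨C, fun i τ hτ => by rw [hfg i τ hτ]; exact hC i τ hτ⟩
  cases n with
  | zero => exact hb
  | succ n =>
    obtain ⟨f', hf', hs⟩ := h.2
    exact ⟨hb, f', fun i τ hτ => (hf' i τ hτ).congr (hfg i) (hfg i τ hτ), hs⟩

theorem deriv_right (h : SymbolBound (n + 1) k f)
    (hf' : ∀ i, ∀ τ ∈ Ioc (0 : ℝ) 1, HasDerivWithinAt (f i) (f' i τ) (Ioc 0 1) τ) :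
    SymbolBound n k f' := by
  obtain ⟨f₁, h₁, hs⟩ := h.2
  refine hs.congr fun i τ hτ => ?_
  exact (uniqueDiffOn τ hτ).eq_deriv _ (hf' i τ hτ) (h₁ i τ hτ)

theorem of_succ : ∀ {n : ℕ} {f : ℕ → ℝ → ℝ}, SymbolBound (n + 1) k f → SymbolBound n k f
  | 0, _, h => h.1
  | _ + 1, _, ⟨hb, f', hf', hs⟩ => ⟨hb, f', hf', of_succ hs⟩

theorem succ_left_of_succ_right : ∀ {n : ℕ} {f : ℕ → ℝ → ℝ},
    SymbolBound n (k + 1) f → SymbolBound n k f := by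
  have key : ∀ f : ℕ → ℝ → ℝ, (∃ C, ∀ i, ∀ τ ∈ Ioc (0 : ℝ) 1, |f i τ| * bagMu i ^ (k + 1) ≤ C) →
      ∃ C, ∀ i, ∀ τ ∈ Ioc (0 : ℝ) 1, |f i τ| * bagMu i ^ k ≤ C := by
    rintro f ⟨C, hC⟩
    refine ⟨C, fun i τ hτ => le_trans ?_ (hC i τ hτ)⟩
    rw [pow_succ, ← mul_assoc]
    refine le_mul_of_one_le_right ?_ (by linarith [bagMu_ge i])
    have := bagMu_pos i
    positivity
  intro n
  induction n with
  | zero => exact fun h => key _ h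
  | succ n ih =>
    rintro f ⟨hb, f', hf', hs⟩
    exact ⟨key _ hb, f', hf', ih hs⟩

theorem mono_right (h : SymbolBound n l f) (hkl : k ≤ l) : SymbolBound n k f := by
  induction l, hkl using Nat.le_induction with
  | base => exact h
  | succ l _ ih => exact ih h.succ_left_of_succ_right

theorem add (hf : SymbolBound n k f) (hg : SymbolBound n k g) :
    SymbolBound n k fun i τ => f i τ + g i τ := by
  have key : ∀ f g : ℕ → ℝ → ℝ, (∃ C, ∀ i, ∀ τ ∈ Ioc (0 : ℝ) 1, |f i τ| * bagMu i ^ k ≤ C) →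
      (∃ C, ∀ i, ∀ τ ∈ Ioc (0 : ℝ) 1, |g i τ| * bagMu i ^ k ≤ C) →
      ∃ C, ∀ i, ∀ τ ∈ Ioc (0 : ℝ) 1, |f i τ + g i τ| * bagMu i ^ k ≤ C := by
    rintro f g ⟨C, hC⟩ ⟨D, hD⟩
    refine ⟨C + D, fun i τ hτ => (mul_le_mul_of_nonneg_right (abs_add_le _ _)
      (pow_pos (bagMu_pos i) k).le).trans ?_⟩
    rw [add_mul]
    exact add_le_add (hC i τ hτ) (hD i τ hτ)
  induction n generalizing f g with
  | zero => exact key _ _ hf hg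
  | succ n ih =>
    obtain ⟨hb, f', hf', hs⟩ := hf
    obtain ⟨hb₂, g', hg', hs₂⟩ := hg
    exact ⟨key _ _ hb hb₂, fun i τ => f' i τ + g' i τ,
      fun i τ hτ => (hf' i τ hτ).add (hg' i τ hτ), ih hs hs₂⟩

theorem mul (hf : SymbolBound n k f) (hg : SymbolBound n l g) :
    SymbolBound n (k + l) fun i τ => f i τ * g i τ := by
  have key : ∀ f g : ℕ → ℝ → ℝ, (∃ C, ∀ i, ∀ τ ∈ Ioc (0 : ℝ) 1, |f i τ| * bagMu i ^ k ≤ C) →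
      (∃ C, ∀ i, ∀ τ ∈ Ioc (0 : ℝ) 1, |g i τ| * bagMu i ^ l ≤ C) →
      ∃ C, ∀ i, ∀ τ ∈ Ioc (0 : ℝ) 1, |f i τ * g i τ| * bagMu i ^ (k + l) ≤ C := by
    rintro f g ⟨C, hC⟩ ⟨D, hD⟩
    refine ⟨C * D, fun i τ hτ => ?_⟩
    have h0 := bagMu_pos i
    rw [abs_mul, pow_add, show |f i τ| * |g i τ| * (bagMu i ^ k * bagMu i ^ l) =
      (|f i τ| * bagMu i ^ k) * (|g i τ| * bagMu i ^ l) by ring]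
    exact mul_le_mul (hC i τ hτ) (hD i τ hτ) (by positivity)
      (le_trans (by positivity) (hC i τ hτ))
  induction n generalizing f g with
  | zero => exact key _ _ hf hg
  | succ n ih =>
    have hf₀ := hf.of_succ
    have hg₀ := hg.of_succ
    obtain ⟨hb, f', hf', hs⟩ := hf
    obtain ⟨hb₂, g', hg', hs₂⟩ := hg
    exact ⟨key _ _ hb hb₂, fun i τ => f' i τ * g i τ + f i τ * g' i τ,
      fun i τ hτ => (hf' i τ hτ).mul (hg' i τ hτ), (ih hs hg₀).add (ih hf₀ hs₂)⟩

theorem of_contDiff {q : ℝ → ℝ} (hq : ContDiff ℝ (⊤ : ℕ∞) q) : SymbolBound n 0 fun _ => q := by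
  have key : ∀ q : ℝ → ℝ, ContDiff ℝ (⊤ : ℕ∞) q →
      ∃ C, ∀ i, ∀ τ ∈ Ioc (0 : ℝ) 1, |q τ| * bagMu i ^ 0 ≤ C := by
    intro q hq
    obtain ⟨C, hC⟩ := isCompact_Icc.exists_bound_of_continuousOn
      (s := Icc (0 : ℝ) 1) hq.continuous.continuousOn
    refine ⟨C, fun i τ hτ => ?_⟩
    rw [pow_zero, mul_one]
    exact hC τ ⟨hτ.1.le, hτ.2⟩
  induction n generalizing q with
  | zero => exact key q hq
  | succ n ih =>
    refine ⟨key q hq, fun _ => deriv q, fun i τ hτ => ?_, ih ?_⟩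
    · exact ((hq.differentiable (by simp)) τ).hasDerivAt.hasDerivWithinAt
    · exact (contDiff_infty_iff_deriv.1 hq).2

theorem const (c : ℝ) : SymbolBound n 0 fun _ _ => c := of_contDiff contDiff_const

theorem const_mul (c : ℝ) (hf : SymbolBound n k f) : SymbolBound n k fun i τ => c * f i τ := by
  simpa using (const c).mul hf

theorem neg (hf : SymbolBound n k f) : SymbolBound n k fun i τ => -f i τ := by
  simpa using hf.const_mul (-1)

theorem sub (hf : SymbolBound n k f) (hg : SymbolBound n k g) :
    SymbolBound n k fun i τ => f i τ - g i τ := by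
  simpa [sub_eq_add_neg] using hf.add hg.neg

theorem coeff_mul {q : ℝ → ℝ} (hq : ContDiff ℝ (⊤ : ℕ∞) q) (hf : SymbolBound n k f) :
    SymbolBound n k fun i τ => q τ * f i τ := by
  simpa using (of_contDiff hq).mul hf

theorem mu_mul : ∀ {n : ℕ} {f : ℕ → ℝ → ℝ}, SymbolBound n (k + 1) f →
    SymbolBound n k fun i τ => bagMu i * f i τ := by
  have key : ∀ f : ℕ → ℝ → ℝ, (∃ C, ∀ i, ∀ τ ∈ Ioc (0 : ℝ) 1, |f i τ| * bagMu i ^ (k + 1) ≤ C) →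
      ∃ C, ∀ i, ∀ τ ∈ Ioc (0 : ℝ) 1, |bagMu i * f i τ| * bagMu i ^ k ≤ C := by
    rintro f ⟨C, hC⟩
    refine ⟨C, fun i τ hτ => le_of_eq_of_le ?_ (hC i τ hτ)⟩
    rw [abs_mul, abs_of_pos (bagMu_pos i)]
    ring
  intro n
  induction n with
  | zero => exact fun h => key _ h
  | succ n ih =>
    rintro f ⟨hb, f', hf', hs⟩
    exact ⟨key _ hb, fun i τ => bagMu i * f' i τ, fun i τ hτ => (hf' i τ hτ).const_mul _, ih hs⟩

theorem inv_mu_mul : ∀ {n : ℕ} {f : ℕ → ℝ → ℝ}, SymbolBound n k f →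
    SymbolBound n (k + 1) fun i τ => (bagMu i)⁻¹ * f i τ := by
  have key : ∀ f : ℕ → ℝ → ℝ, (∃ C, ∀ i, ∀ τ ∈ Ioc (0 : ℝ) 1, |f i τ| * bagMu i ^ k ≤ C) →
      ∃ C, ∀ i, ∀ τ ∈ Ioc (0 : ℝ) 1, |(bagMu i)⁻¹ * f i τ| * bagMu i ^ (k + 1) ≤ C := by
    rintro f ⟨C, hC⟩
    refine ⟨C, fun i τ hτ => le_of_eq_of_le ?_ (hC i τ hτ)⟩
    have := bagMu_ne_zero i
    rw [abs_mul, abs_inv, abs_of_pos (bagMu_pos i)]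
    field_simp
    ring
  intro n
  induction n with
  | zero => exact fun h => key _ h
  | succ n ih =>
    rintro f ⟨hb, f', hf', hs⟩
    exact ⟨key _ hb, fun i τ => (bagMu i)⁻¹ * f' i τ, fun i τ hτ => (hf' i τ hτ).const_mul _,
      ih hs⟩

theorem inv {c : ℝ} (hc : 0 < c) (hf : SymbolBound n 0 f)
    (hfc : ∀ i, ∀ τ ∈ Ioc (0 : ℝ) 1, c ≤ f i τ) : SymbolBound n 0 fun i τ => (f i τ)⁻¹ := by
  have key : ∃ C, ∀ i, ∀ τ ∈ Ioc (0 : ℝ) 1, |(f i τ)⁻¹| * bagMu i ^ 0 ≤ C := by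
    refine ⟨c⁻¹, fun i τ hτ => ?_⟩
    have h := hfc i τ hτ
    rw [pow_zero, mul_one, abs_inv, abs_of_pos (hc.trans_le h)]
    gcongr
  induction n with
  | zero => exact key
  | succ n ih =>
    have h₁ := ih hf.of_succ
    obtain ⟨_, f', hf', hs⟩ := hf
    refine ⟨key, fun i τ => -(f' i τ * ((f i τ)⁻¹ * (f i τ)⁻¹)), fun i τ hτ => ?_,
      (hs.mul (h₁.mul h₁)).neg⟩
    refine ((hf' i τ hτ).inv (hc.trans_le (hfc i τ hτ)).ne').congr_deriv ?_
    rw [neg_div, div_eq_mul_inv, sq, mul_inv]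

theorem exists_deriv (h : SymbolBound (n + 1) k f) :
    ∃ f' : ℕ → ℝ → ℝ, (∀ i, ∀ τ ∈ Ioc (0 : ℝ) 1,
      HasDerivWithinAt (f i) (f' i τ) (Ioc 0 1) τ) ∧ SymbolBound n k f' := h.2

end SymbolBound

/-- Maximum principle: a function that increases whenever it exceeds `B` and does not exceed `B`
at the right end point stays below `B`. -/
theorem le_of_increasing_above {f f' : ℝ → ℝ} {τ₁ B : ℝ} (h1 : τ₁ ≤ 1)
    (hf : ∀ τ ∈ Ioc (0 : ℝ) 1, HasDerivWithinAt f (f' τ) (Ioc 0 1) τ)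
    (hpos : ∀ τ ∈ Ioo 0 τ₁, B < f τ → 0 < f' τ) (hB : f τ₁ ≤ B) :
    ∀ τ ∈ Ioc 0 τ₁, f τ ≤ B := by
  intro τ₀ hτ₀
  by_contra! hlt
  have hcont : ContinuousOn f (Icc τ₀ τ₁) := fun τ hτ =>
    ((hf τ ⟨hτ₀.1.trans_le hτ.1, hτ.2.trans h1⟩).continuousWithinAt).mono
      fun x hx => ⟨hτ₀.1.trans_le hx.1, hx.2.trans h1⟩
  obtain ⟨m, hm, hmax⟩ := isCompact_Icc.exists_isMaxOn (nonempty_Icc.2 hτ₀.2) hcont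
  have hm0 : B < f m := hlt.trans_le (hmax (left_mem_Icc.2 hτ₀.2))
  have hm1 : m < τ₁ := lt_of_le_of_ne hm.2 fun h => by rw [h] at hm0; linarith
  have hmpos : 0 < m := hτ₀.1.trans_le hm.1
  have hder : HasDerivAt f (f' m) m :=
    (hf m ⟨hmpos, hm.2.trans h1⟩).hasDerivAt (Ioc_mem_nhds hmpos (hm1.trans_le h1))
  have hp := hpos m ⟨hmpos, hm1⟩ hm0
  have hslope := (hasDerivAt_iff_tendsto_slope.1 hder).eventually (lt_mem_nhds hp)
  have hslope' : ∀ᶠ z in 𝓝[>] m, 0 < slope f m z :=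
    hslope.filter_mono (nhdsWithin_mono _ fun z hz => ne_of_gt hz)
  obtain ⟨z, hz, hz1, hz2⟩ := (hslope'.and (Ioo_mem_nhdsGT hm1)).exists
  have := hmax (show z ∈ Icc τ₀ τ₁ from ⟨hm.1.trans hz1.le, hz2.le⟩)
  rw [slope_def_field] at hz
  have h3 : 0 < f z - f m := by
    have := mul_pos hz (sub_pos.2 hz1)
    rwa [div_mul_cancel₀ _ (sub_pos.2 hz1).ne'] at this
  have h4 : f z ≤ f m := this
  linarith

theorem hasDerivAt_besselG (ν : ℕ) {x : ℝ} (hx : 0 ≤ x) :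
    ∃ d, HasDerivAt (besselG ν) d x ∧
      2 * x * d = 1 - 2 * (ν + 1) * besselG ν x - x * besselG ν x ^ 2 := by
  have h0 := (besselB_pos ν hx).ne'
  have h := (hasDerivAt_besselB (ν + 1) x).div ((hasDerivAt_besselB ν x).const_mul 2)
    (by positivity)
  refine ⟨_, h, ?_⟩
  have hr := besselB_recurrence ν x
  have e : besselG ν x = besselB (ν + 1) x / (2 * besselB ν x) := rfl
  rw [e]
  generalize besselB (ν + 1 + 1) x = B₂ at *
  generalize besselB (ν + 1) x = B₁ at *
  generalize besselB ν x = B₀ at *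
  field_simp
  linear_combination (-16 * B₀) * hr

/-- The scaled logarithmic derivative as a function of `τ = (1 + X)^(-1/2)`. -/
def bagG (i : ℕ) (τ : ℝ) : ℝ := bagMu i * besselG (i + 1) (bagMu i ^ 2 * ((1 - τ ^ 2) / τ ^ 2))

/-- The correction to the leading order uniform asymptotics of `bagG`. -/
def bagE (i : ℕ) (τ : ℝ) : ℝ := (1 - (1 + τ) / τ * bagG i τ) / τ ^ 2

theorem bagX_nonneg {τ : ℝ} (hτ : τ ∈ Ioc (0 : ℝ) 1) : 0 ≤ (1 - τ ^ 2) / τ ^ 2 := by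
  have h1 : 0 ≤ 1 - τ ^ 2 := by nlinarith [hτ.1, hτ.2]
  positivity

theorem bagG_pos (i : ℕ) {τ : ℝ} (hτ : τ ∈ Ioc (0 : ℝ) 1) : 0 < bagG i τ :=
  mul_pos (bagMu_pos i) (besselG_pos _ (mul_nonneg (sq_nonneg _) (bagX_nonneg hτ)))

theorem hasDerivAt_bagX {τ : ℝ} (hτ : 0 < τ) :
    HasDerivAt (fun τ : ℝ => (1 - τ ^ 2) / τ ^ 2) (-2 / τ ^ 3) τ := by
  have h := (((hasDerivAt_id τ).fun_pow 2).const_sub 1).div ((hasDerivAt_id τ).fun_pow 2)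
    (pow_ne_zero 2 hτ.ne')
  refine h.congr_deriv ?_
  simp only [id]
  field_simp
  ring

theorem hasDerivAt_bagG (i : ℕ) {τ : ℝ} (hτ : τ ∈ Ioc (0 : ℝ) 1) :
    ∃ d, HasDerivAt (bagG i) d τ ∧ τ ^ 3 * (1 - τ ^ 2) * d =
      -(bagMu i * τ ^ 2 - (2 * bagMu i + 1) * τ ^ 2 * bagG i τ -
        bagMu i * (1 - τ ^ 2) * bagG i τ ^ 2) := by
  have hμ := bagMu_ne_zero i
  have hτ0 := hτ.1.ne'
  obtain ⟨d, hd, he⟩ := hasDerivAt_besselG (i + 1) (x := bagMu i ^ 2 * ((1 - τ ^ 2) / τ ^ 2))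
    (mul_nonneg (sq_nonneg _) (bagX_nonneg hτ))
  have h := (hd.comp τ ((hasDerivAt_bagX hτ.1).const_mul (bagMu i ^ 2))).const_mul (bagMu i)
  refine ⟨_, h, ?_⟩
  have e : bagG i τ = bagMu i * besselG (i + 1) (bagMu i ^ 2 * ((1 - τ ^ 2) / τ ^ 2)) := rfl
  rw [e]
  generalize besselG (i + 1) (bagMu i ^ 2 * ((1 - τ ^ 2) / τ ^ 2)) = G at *
  have hi : (((i + 1 : ℕ) : ℝ) + 1) = bagMu i + 1 / 2 := by rw [bagMu]; push_cast; ring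
  rw [hi] at he
  field_simp at he ⊢
  linear_combination (-1 : ℝ) * he

theorem bagG_eq (i : ℕ) {τ : ℝ} (hτ : τ ∈ Ioc (0 : ℝ) 1) :
    bagG i τ = τ * (1 - τ ^ 2 * bagE i τ) / (1 + τ) := by
  have := hτ.1
  rw [bagE]
  field_simp
  ring

theorem hasDerivAt_bagE (i : ℕ) {τ : ℝ} (hτ : τ ∈ Ioc (0 : ℝ) 1) :
    ∃ d, HasDerivAt (bagE i) d τ ∧ τ ^ 2 * (1 - τ ^ 2) * d =
      bagMu i * bagE i τ * (2 - (1 - τ) * τ ^ 2 * bagE i τ) - 1 +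
        (τ ^ 2 - 2 * τ * (1 - τ ^ 2)) * bagE i τ := by
  obtain ⟨d, hd, he⟩ := hasDerivAt_bagG i hτ
  have hτ0 := hτ.1
  have h := (((((hasDerivAt_id τ).const_add 1).div (hasDerivAt_id τ) hτ0.ne').mul hd).const_sub
    1).div ((hasDerivAt_id τ).fun_pow 2) (pow_ne_zero 2 hτ0.ne')
  refine ⟨_, h, ?_⟩
  simp only [id, Pi.div_apply, Pi.mul_apply]
  rw [bagE]
  generalize bagG i τ = G at *
  field_simp
  norm_num
  linear_combination (-(1 + τ)) * he

theorem contDiffOn_bagE (i : ℕ) : ContDiffOn ℝ (⊤ : ℕ∞) (bagE i) (Ioc 0 1) := by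
  have hne : ∀ τ ∈ Ioc (0 : ℝ) 1, τ ≠ 0 := fun τ hτ => hτ.1.ne'
  have hne2 : ∀ τ ∈ Ioc (0 : ℝ) 1, τ ^ 2 ≠ 0 := fun τ hτ => pow_ne_zero 2 hτ.1.ne'
  have hX : ContDiffOn ℝ (⊤ : ℕ∞) (fun τ : ℝ => bagMu i ^ 2 * ((1 - τ ^ 2) / τ ^ 2)) (Ioc 0 1) :=
    contDiffOn_const.mul ((by fun_prop : ContDiffOn ℝ (⊤ : ℕ∞) (fun τ : ℝ => 1 - τ ^ 2) _).div
      (by fun_prop) hne2)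
  have hG : ContDiffOn ℝ (⊤ : ℕ∞) (bagG i) (Ioc 0 1) := by
    refine contDiffOn_const.mul (((contDiff_besselB (i + 1 + 1)).comp_contDiffOn hX).div
      (contDiffOn_const.mul ((contDiff_besselB (i + 1)).comp_contDiffOn hX)) fun τ hτ => ?_)
    have := besselB_pos (i + 1) (mul_nonneg (sq_nonneg (bagMu i)) (bagX_nonneg hτ))
    exact (mul_pos two_pos this).ne'
  exact (contDiffOn_const.sub (((by fun_prop : ContDiffOn ℝ (⊤ : ℕ∞) (fun τ : ℝ => 1 + τ) _).div
      contDiffOn_id hne).mul hG)).div (by fun_prop) hne2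

theorem bagE_lt (i : ℕ) {τ : ℝ} (hτ : τ ∈ Ioc (0 : ℝ) 1) : τ ^ 2 * bagE i τ < 1 := by
  have h := bagG_pos i hτ
  have h0 := hτ.1
  rw [bagE, mul_div_cancel₀ _ (pow_ne_zero 2 h0.ne')]
  have : 0 < (1 + τ) / τ * bagG i τ := by positivity
  linarith

theorem bagE_one (i : ℕ) : bagE i 1 = 1 / (2 * bagMu i + 1) := by
  obtain ⟨d, -, h⟩ := hasDerivAt_bagE i (τ := 1) ⟨one_pos, le_rfl⟩
  have := bagMu_pos i
  rw [eq_div_iff (by positivity)]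
  linear_combination -h

theorem exists_hasDerivWithinAt_bagE (i : ℕ) : ∃ d : ℝ → ℝ, ∀ τ ∈ Ioc (0 : ℝ) 1,
    HasDerivWithinAt (bagE i) (d τ) (Ioc 0 1) τ ∧ τ ^ 2 * (1 - τ ^ 2) * d τ =
      bagMu i * bagE i τ * (2 - (1 - τ) * τ ^ 2 * bagE i τ) - 1 +
        (τ ^ 2 - 2 * τ * (1 - τ ^ 2)) * bagE i τ := by
  have h : ∀ τ, ∃ d, τ ∈ Ioc (0 : ℝ) 1 → HasDerivWithinAt (bagE i) d (Ioc 0 1) τ ∧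
      τ ^ 2 * (1 - τ ^ 2) * d =
      bagMu i * bagE i τ * (2 - (1 - τ) * τ ^ 2 * bagE i τ) - 1 +
        (τ ^ 2 - 2 * τ * (1 - τ ^ 2)) * bagE i τ := by
    intro τ
    by_cases hτ : τ ∈ Ioc (0 : ℝ) 1
    · obtain ⟨d, h, h'⟩ := hasDerivAt_bagE i hτ
      exact ⟨d, fun _ => ⟨h.hasDerivWithinAt, h'⟩⟩
    · exact ⟨0, fun h => absurd h hτ⟩
  choose d hd using h
  exact ⟨d, fun τ => hd τ⟩

theorem bagE_nonneg (i : ℕ) {τ : ℝ} (hτ : τ ∈ Ioc (0 : ℝ) 1) : 0 ≤ bagE i τ := by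
  obtain ⟨d, hd⟩ := exists_hasDerivWithinAt_bagE i
  have hμ := bagMu_ge i
  have key := le_of_increasing_above (f := fun τ => -(τ ^ 2 * bagE i τ))
    (f' := fun τ => -(2 * τ * bagE i τ + τ ^ 2 * d τ)) (τ₁ := 1) (B := 0) le_rfl
    (fun τ hτ => by
      have h := (((hasDerivAt_id τ).fun_pow 2).hasDerivWithinAt.mul (hd τ hτ).1).neg
      refine h.congr_deriv ?_
      simp)
    (fun τ hτ hB => by
      have hτ' : τ ∈ Ioc (0 : ℝ) 1 := ⟨hτ.1, hτ.2.le⟩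
      have he := (hd τ hτ').2
      have h2 : 0 < τ ^ 2 := pow_pos hτ.1 2
      have hw : 0 < 1 - τ ^ 2 := by nlinarith [hτ.1, hτ.2]
      have hlt : bagE i τ < 0 := by
        by_contra! h
        have := mul_nonneg h2.le h
        linarith
      have e : (1 - τ ^ 2) * (2 * τ * bagE i τ + τ ^ 2 * d τ) =
          bagMu i * bagE i τ * (2 - (1 - τ) * τ ^ 2 * bagE i τ) - 1 + τ ^ 2 * bagE i τ := by
        linear_combination he
      have h3 : (1 - τ) * τ ^ 2 * bagE i τ ≤ 0 :=
        mul_nonpos_of_nonneg_of_nonpos (mul_nonneg (by linarith [hτ.2]) h2.le) hlt.le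
      have h4 : bagMu i * bagE i τ * (2 - (1 - τ) * τ ^ 2 * bagE i τ) < 0 :=
        mul_neg_of_neg_of_pos (mul_neg_of_pos_of_neg (by linarith) hlt) (by linarith)
      have h5 : (1 - τ ^ 2) * (2 * τ * bagE i τ + τ ^ 2 * d τ) < 0 := by rw [e]; linarith
      have := neg_of_mul_neg_right h5 hw.le
      linarith)
    (by rw [bagE_one]
        have : 0 < 1 / (2 * bagMu i + 1) := by positivity
        linarith) τ hτ
  have h2 : 0 < τ ^ 2 := pow_pos hτ.1 2
  by_contra! h
  have := mul_neg_of_pos_of_neg h2 h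
  linarith

theorem bagE_le (i : ℕ) {τ : ℝ} (hτ : τ ∈ Ioc (0 : ℝ) 1) : bagE i τ ≤ 3 / bagMu i := by
  obtain ⟨d, hd⟩ := exists_hasDerivWithinAt_bagE i
  have hμ := bagMu_ge i
  have hμ0 := bagMu_pos i
  refine le_of_increasing_above (f' := d) le_rfl (fun τ hτ => (hd τ hτ).1)
    (fun τ hτ hB => ?_) ?_ τ hτ
  · have hτ' : τ ∈ Ioc (0 : ℝ) 1 := ⟨hτ.1, hτ.2.le⟩
    have he := (hd τ hτ').2
    have h2 : 0 < τ ^ 2 := pow_pos hτ.1 2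
    have hw : 0 < 1 - τ ^ 2 := by nlinarith [hτ.1, hτ.2]
    rw [div_lt_iff₀ hμ0] at hB
    have hE := bagE_nonneg i hτ'
    have hE1 := bagE_lt i hτ'
    have h3 : (1 - τ) * τ ^ 2 * bagE i τ ≤ 1 := by nlinarith [hτ.1, hτ.2, mul_nonneg h2.le hE]
    have h4 : 2 * τ * (1 - τ ^ 2) ≤ 1 := by nlinarith [hτ.1, hτ.2, sq_nonneg (2 * τ - 1)]
    have h5 : bagMu i * bagE i τ ≤ bagMu i * bagE i τ * (2 - (1 - τ) * τ ^ 2 * bagE i τ) :=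
      le_mul_of_one_le_right (by positivity) (by linarith)
    have h6 : -bagE i τ ≤ (τ ^ 2 - 2 * τ * (1 - τ ^ 2)) * bagE i τ := by nlinarith
    have h7 : 0 < τ ^ 2 * (1 - τ ^ 2) * d τ := by rw [he]; nlinarith
    exact pos_of_mul_pos_right h7 (by positivity)
  · rw [bagE_one]
    rw [div_le_div_iff₀ (by positivity) hμ0]
    linarith

theorem abs_le_of_linear_ode {f f' A S : ℝ → ℝ} {τ₁ K M α : ℝ} (h1 : τ₁ ≤ 1) (hα : 0 < α)
    (hf : ∀ τ ∈ Ioc (0 : ℝ) 1, HasDerivWithinAt f (f' τ) (Ioc 0 1) τ)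
    (hode : ∀ τ ∈ Ioc (0 : ℝ) 1, τ ^ 2 * (1 - τ ^ 2) * f' τ = A τ * f τ + S τ)
    (hA : ∀ τ ∈ Ioo 0 τ₁, α ≤ A τ) (hS : ∀ τ ∈ Ioo 0 τ₁, |S τ| ≤ M)
    (hK : |f τ₁| ≤ K) (hMK : M ≤ α * K) :
    ∀ τ ∈ Ioc 0 τ₁, |f τ| ≤ K := by
  have hK0 : 0 ≤ K := (abs_nonneg _).trans hK
  have hw : ∀ τ ∈ Ioo 0 τ₁, 0 < τ ^ 2 * (1 - τ ^ 2) := fun τ hτ => by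
    have h2 : τ < 1 := hτ.2.trans_le h1
    have : 0 < 1 - τ ^ 2 := by nlinarith [hτ.1]
    have := hτ.1
    positivity
  intro τ hτ
  rw [abs_le]
  constructor
  · have := le_of_increasing_above (f := fun τ => -f τ) (f' := fun τ => -f' τ) (B := K) h1
      (fun τ hτ => (hf τ hτ).neg) (fun τ hτ hB => ?_) ((neg_le_abs _).trans hK) τ hτ
    · linarith
    · have hode' := hode τ ⟨hτ.1, (hτ.2.trans_le h1).le⟩
      have h2 : α * (-f τ) ≤ A τ * (-f τ) := mul_le_mul_of_nonneg_right (hA τ hτ) (by linarith)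
      have h3 := abs_le.1 (hS τ hτ)
      have h4 : α * K < α * (-f τ) := mul_lt_mul_of_pos_left hB hα
      have h5 : 0 < τ ^ 2 * (1 - τ ^ 2) * (-f' τ) := by linarith
      exact pos_of_mul_pos_right h5 (hw τ hτ).le
  · refine le_of_increasing_above (f' := f') (B := K) h1 hf (fun τ hτ hB => ?_)
      ((le_abs_self _).trans hK) τ hτ
    have hode' := hode τ ⟨hτ.1, (hτ.2.trans_le h1).le⟩
    have h2 : α * f τ ≤ A τ * f τ := mul_le_mul_of_nonneg_right (hA τ hτ) (by linarith)
    have h3 := abs_le.1 (hS τ hτ)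
    have h4 : α * K < α * f τ := mul_lt_mul_of_pos_left hB hα
    have h5 : 0 < τ ^ 2 * (1 - τ ^ 2) * f' τ := by linarith
    exact pos_of_mul_pos_right h5 (hw τ hτ).le

/-- The coefficient of the linearised equation. -/
def bagA (q : ℝ → ℝ) (i : ℕ) (τ : ℝ) : ℝ :=
  2 * bagMu i * (1 - (1 - τ) * τ ^ 2 * bagE i τ) + q τ

theorem bagA_ge_near_zero {q : ℝ → ℝ} {C : ℝ} (hC : ∀ τ ∈ Ioc (0 : ℝ) 1, |q τ| ≤ C * τ) (i : ℕ)
    {τ : ℝ} (hτ : τ ∈ Ioc (0 : ℝ) 1) (hτC : (6 + C) * τ ≤ 3 / 2) : bagMu i ≤ bagA q i τ := by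
  have hμ := bagMu_ge i
  have hμ0 := bagMu_pos i
  have hE := bagE_le i hτ
  rw [le_div_iff₀ hμ0] at hE
  have hE0 := bagE_nonneg i hτ
  have h2 : 0 < τ ^ 2 := pow_pos hτ.1 2
  have h3 : τ ^ 2 ≤ τ := by nlinarith [hτ.1, hτ.2]
  have h4 : (1 - τ) * τ ^ 2 ≤ τ := by nlinarith [hτ.1, hτ.2]
  have h5 : (1 - τ) * τ ^ 2 * (bagE i τ * bagMu i) ≤ τ * 3 :=
    mul_le_mul h4 hE (by positivity) hτ.1.le
  have h6 := (abs_le.1 (hC τ hτ)).1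
  rw [bagA]
  nlinarith

theorem bagA_ge_of_large {q : ℝ → ℝ} {C : ℝ} (hC : ∀ τ ∈ Ioc (0 : ℝ) 1, |q τ| ≤ C * τ) (i : ℕ)
    {τ : ℝ} (hτ : τ ∈ Ioc (0 : ℝ) 1) (hi : 12 + 2 * C ≤ bagMu i) : bagMu i / 2 ≤ bagA q i τ := by
  have hμ := bagMu_ge i
  have hμ0 := bagMu_pos i
  have hE := bagE_le i hτ
  rw [le_div_iff₀ hμ0] at hE
  have hE0 := bagE_nonneg i hτ
  have h2 : 0 < τ ^ 2 := pow_pos hτ.1 2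
  have h4 : (1 - τ) * τ ^ 2 ≤ 1 := by nlinarith [hτ.1, hτ.2]
  have h5 : (1 - τ) * τ ^ 2 * (bagE i τ * bagMu i) ≤ 1 * 3 :=
    mul_le_mul h4 hE (by positivity) zero_le_one
  have h6 := (abs_le.1 (hC τ hτ)).1
  have h7 : 0 ≤ C := by
    have := hC 1 ⟨one_pos, le_rfl⟩
    have := abs_nonneg (q 1)
    linarith
  have h8 : C * τ ≤ C := mul_le_of_le_one_right h7 hτ.2
  rw [bagA]
  nlinarith

theorem exists_abs_le_mul {q : ℝ → ℝ} (hq : ContDiff ℝ (⊤ : ℕ∞) q) (hq0 : q 0 = 0) :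
    ∃ C, 0 ≤ C ∧ ∀ τ ∈ Ioc (0 : ℝ) 1, |q τ| ≤ C * τ := by
  obtain ⟨C, hC⟩ := isCompact_Icc.exists_bound_of_continuousOn
    (s := Icc (0 : ℝ) 1) (contDiff_infty_iff_deriv.1 hq).2.continuous.continuousOn
  refine ⟨C, (norm_nonneg _).trans (hC 0 ⟨le_rfl, zero_le_one⟩), fun τ hτ => ?_⟩
  have := (convex_Icc (0 : ℝ) 1).norm_image_sub_le_of_norm_deriv_le (f := q) (C := C)
    (fun x _ => hq.differentiable (by simp) x) hC
    (left_mem_Icc.2 zero_le_one) (⟨hτ.1.le, hτ.2⟩ : τ ∈ Icc (0 : ℝ) 1)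
  simpa [hq0, abs_of_pos hτ.1] using this

theorem symbolBound_zero_of_linear_ode {q : ℝ → ℝ} (hq : ContDiff ℝ (⊤ : ℕ∞) q) (hq0 : q 0 = 0)
    {f f' S : ℕ → ℝ → ℝ}
    (hf : ∀ i, ∀ τ ∈ Ioc (0 : ℝ) 1, HasDerivWithinAt (f i) (f' i τ) (Ioc 0 1) τ)
    (hode : ∀ i, ∀ τ ∈ Ioc (0 : ℝ) 1,
      τ ^ 2 * (1 - τ ^ 2) * f' i τ = bagA q i τ * f i τ + S i τ)
    (hS : SymbolBound 0 0 S) : SymbolBound 0 1 f := by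
  obtain ⟨C, hC0, hC⟩ := exists_abs_le_mul hq hq0
  obtain ⟨M, hM⟩ := hS
  simp only [pow_zero, mul_one] at hM
  have hM0 : 0 ≤ M := (abs_nonneg _).trans (hM 0 1 ⟨one_pos, le_rfl⟩)
  have hlarge : ∀ i, 12 + 2 * C ≤ bagMu i → ∀ τ ∈ Ioc (0 : ℝ) 1, |f i τ| * bagMu i ≤ 2 * M := by
    intro i hi τ hτ
    have hμ := bagMu_pos i
    rw [← le_div_iff₀ hμ]
    refine abs_le_of_linear_ode (α := bagMu i / 2) (M := M) le_rfl (by positivity) (hf i) (hode i)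
      (fun τ hτ => bagA_ge_of_large hC i ⟨hτ.1, hτ.2.le⟩ hi) (fun τ hτ => hM i τ ⟨hτ.1, hτ.2.le⟩)
      ?_ (by field_simp; rfl) τ hτ
    have h1 : (1 : ℝ) ∈ Ioc (0 : ℝ) 1 := ⟨one_pos, le_rfl⟩
    have ho := hode i 1 h1
    have hA := bagA_ge_of_large hC i h1 hi
    have e : bagA q i 1 * f i 1 = -S i 1 := by linear_combination -ho
    have e' : bagA q i 1 * |f i 1| ≤ M := by
      rw [← abs_of_pos (show 0 < bagA q i 1 by linarith), ← abs_mul, e, abs_neg]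
      exact hM i 1 h1
    rw [le_div_iff₀ hμ]
    nlinarith [abs_nonneg (f i 1)]
  have hsmall : ∀ i, ∃ K, ∀ τ ∈ Ioc (0 : ℝ) 1, |f i τ| * bagMu i ≤ K := by
    intro i
    set τ₁ := 1 / (6 + C) with hτ₁
    have hpos : 0 < τ₁ := by positivity
    have hle : τ₁ ≤ 1 := by rw [hτ₁, div_le_one (by positivity)]; linarith
    have hμ := bagMu_pos i
    have hcont : ContinuousOn (f i) (Icc τ₁ 1) := fun τ hτ =>
      ((hf i τ ⟨hpos.trans_le hτ.1, hτ.2⟩).continuousWithinAt).mono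
        fun x hx => ⟨hpos.trans_le hx.1, hx.2⟩
    obtain ⟨K, hK⟩ := isCompact_Icc.exists_bound_of_continuousOn hcont
    refine ⟨max K (M / bagMu i) * bagMu i, fun τ hτ => mul_le_mul_of_nonneg_right ?_ hμ.le⟩
    rcases le_total τ₁ τ with h | h
    · exact (hK τ ⟨h, hτ.2⟩).trans (le_max_left _ _)
    · refine abs_le_of_linear_ode (α := bagMu i) (M := M) hle hμ (hf i) (hode i)
        (fun τ hτ => bagA_ge_near_zero hC i ⟨hτ.1, hτ.2.le.trans hle⟩ ?_)
        (fun τ hτ => hM i τ ⟨hτ.1, hτ.2.le.trans hle⟩)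
        ((hK τ₁ ⟨le_rfl, hle⟩).trans (le_max_left _ _)) ?_ τ ⟨hτ.1, h⟩
      · have : τ * (6 + C) ≤ 1 := by
          rw [← le_div_iff₀ (by positivity)]
          exact hτ.2.le
        linarith
      · calc M = bagMu i * (M / bagMu i) := by field_simp
          _ ≤ _ := by gcongr; exact le_max_right _ _
  choose K hK using hsmall
  obtain ⟨N, hN⟩ := exists_nat_ge (12 + 2 * C)
  refine ⟨2 * M + ∑ j ∈ Finset.range N, |K j|, fun i τ hτ => ?_⟩
  rw [pow_one]
  have hsum : 0 ≤ ∑ j ∈ Finset.range N, |K j| := Finset.sum_nonneg fun _ _ => abs_nonneg _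
  rcases lt_or_ge i N with h | h
  · have h1 := hK i τ hτ
    have h2 := Finset.single_le_sum (f := fun j => |K j|) (fun j _ => abs_nonneg _)
      (Finset.mem_range.2 h)
    have h3 := le_abs_self (K i)
    have h4 : |K i| ≤ ∑ j ∈ Finset.range N, |K j| := h2
    linarith
  · have h1 := hlarge i (by
      rw [bagMu]
      have : (N : ℝ) ≤ i := by exact_mod_cast h
      linarith) τ hτ
    linarith

theorem ContDiffOn.hasDerivWithinAt_Ioc {f : ℝ → ℝ} (hf : ContDiffOn ℝ (⊤ : ℕ∞) f (Ioc 0 1)) {τ : ℝ}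
    (hτ : τ ∈ Ioc (0 : ℝ) 1) :
    HasDerivWithinAt f (derivWithin f (Ioc 0 1) τ) (Ioc 0 1) τ :=
  (hf.differentiableOn (by simp) τ hτ).hasDerivWithinAt

theorem ContDiffOn.derivWithin_Ioc {f : ℝ → ℝ} (hf : ContDiffOn ℝ (⊤ : ℕ∞) f (Ioc 0 1)) :
    ContDiffOn ℝ (⊤ : ℕ∞) (derivWithin f (Ioc 0 1)) (Ioc 0 1) :=
  hf.derivWithin (uniqueDiffOn_Ioc 0 1) (by simp)

theorem hasDerivAt_weight (τ : ℝ) :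
    HasDerivAt (fun τ : ℝ => τ ^ 2 * (1 - τ ^ 2)) (2 * τ - 4 * τ ^ 3) τ := by
  have h := ((hasDerivAt_id τ).fun_pow 2).mul (((hasDerivAt_id τ).fun_pow 2).const_sub 1)
  refine h.congr_deriv ?_
  simp only [id]
  norm_num
  ring

theorem hasDerivAt_one_sub_mul_sq (τ : ℝ) :
    HasDerivAt (fun τ : ℝ => (1 - τ) * τ ^ 2) (2 * τ - 3 * τ ^ 2) τ := by
  have h := ((hasDerivAt_id τ).const_sub 1).mul ((hasDerivAt_id τ).fun_pow 2)
  refine h.congr_deriv ?_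
  simp only [id]
  norm_num
  ring

theorem symbolBound_of_linear_ode (n : ℕ) (hE : SymbolBound n 1 bagE) {q : ℝ → ℝ}
    (hq : ContDiff ℝ (⊤ : ℕ∞) q) (hq0 : q 0 = 0) {f S : ℕ → ℝ → ℝ}
    (hf : ∀ i, ContDiffOn ℝ (⊤ : ℕ∞) (f i) (Ioc 0 1))
    (hode : ∀ i, ∀ τ ∈ Ioc (0 : ℝ) 1,
      τ ^ 2 * (1 - τ ^ 2) * derivWithin (f i) (Ioc 0 1) τ = bagA q i τ * f i τ + S i τ)
    (hS : SymbolBound n 0 S) : SymbolBound n 1 f := by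
  induction n generalizing q f S with
  | zero =>
    exact symbolBound_zero_of_linear_ode hq hq0
      (fun i τ hτ => (hf i).hasDerivWithinAt_Ioc hτ) hode hS
  | succ n ih =>
    have hfn := ih hE.of_succ hq hq0 hf hode hS.of_succ
    refine ⟨hfn.bound, fun i => derivWithin (f i) (Ioc 0 1),
      fun i τ hτ => (hf i).hasDerivWithinAt_Ioc hτ, ?_⟩
    obtain ⟨S', hS', hSn⟩ := hS.exists_deriv
    obtain ⟨E', hE', hEn⟩ := hE.exists_deriv
    have hqd := (contDiff_infty_iff_deriv.1 hq).2
    set A' : ℕ → ℝ → ℝ := fun i τ =>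
      2 * bagMu i * (-((2 * τ - 3 * τ ^ 2) * bagE i τ + (1 - τ) * τ ^ 2 * E' i τ)) + deriv q τ
      with hA'
    refine ih hE.of_succ (q := fun τ => q τ - (2 * τ - 4 * τ ^ 3))
      (S := fun i τ => S' i τ + A' i τ * f i τ)
      (hq.sub (by fun_prop)) (by simp [hq0]) (fun i => (hf i).derivWithin_Ioc) ?_ ?_
    · intro i τ hτ
      have hl := (hasDerivAt_weight τ).hasDerivWithinAt.mul
        ((hf i).derivWithin_Ioc.hasDerivWithinAt_Ioc hτ)
      have hA : HasDerivWithinAt (bagA q i) (A' i τ) (Ioc 0 1) τ :=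
        ((((hasDerivAt_one_sub_mul_sq τ).hasDerivWithinAt.mul (hE' i τ hτ)).const_sub 1).const_mul
          (2 * bagMu i)).add (hq.differentiable (by simp) τ).hasDerivAt.hasDerivWithinAt
      have hr := (hA.mul ((hf i).hasDerivWithinAt_Ioc hτ)).add (hS' i τ hτ)
      have he := (uniqueDiffOn_Ioc (0 : ℝ) 1 τ hτ).eq_deriv _
        (hl.congr (fun x hx => (hode i x hx).symm) (hode i τ hτ).symm) hr
      have hA0 : bagA (fun τ => q τ - (2 * τ - 4 * τ ^ 3)) i τ =
        bagA q i τ - (2 * τ - 4 * τ ^ 3) := by rw [bagA, bagA]; ring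
      rw [hA0]
      linear_combination he
    · refine hSn.add ?_
      have h1 : SymbolBound n 1 fun i τ =>
          2 * (-((2 * τ - 3 * τ ^ 2) * bagE i τ + (1 - τ) * τ ^ 2 * E' i τ)) :=
        (((hE.of_succ.coeff_mul (q := fun τ => 2 * τ - 3 * τ ^ 2) (by fun_prop)).add
          (hEn.coeff_mul (q := fun τ => (1 - τ) * τ ^ 2) (by fun_prop))).neg).const_mul 2
      have h2 := (h1.mul hfn).mu_mul.mono_right (k := 0) (by norm_num)
      have h3 := (hfn.coeff_mul hqd).mono_right (k := 0) (by norm_num)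
      refine (h2.add h3).congr fun i τ _ => ?_
      rw [hA']
      ring

theorem derivWithin_bagE (i : ℕ) {τ : ℝ} (hτ : τ ∈ Ioc (0 : ℝ) 1) :
    τ ^ 2 * (1 - τ ^ 2) * derivWithin (bagE i) (Ioc 0 1) τ =
      bagMu i * bagE i τ * (2 - (1 - τ) * τ ^ 2 * bagE i τ) - 1 +
        (τ ^ 2 - 2 * τ * (1 - τ ^ 2)) * bagE i τ := by
  obtain ⟨d, hd, h⟩ := hasDerivAt_bagE i hτ
  rwa [hd.hasDerivWithinAt.derivWithin (uniqueDiffOn_Ioc (0 : ℝ) 1 τ hτ)]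

theorem symbolBound_bagE (n : ℕ) : SymbolBound n 1 bagE := by
  induction n with
  | zero =>
    refine ⟨3, fun i τ hτ => ?_⟩
    rw [pow_one, abs_of_nonneg (bagE_nonneg i hτ), ← le_div_iff₀ (bagMu_pos i)]
    exact bagE_le i hτ
  | succ n ih =>
    refine ⟨ih.bound, fun i => derivWithin (bagE i) (Ioc 0 1),
      fun i τ hτ => (contDiffOn_bagE i).hasDerivWithinAt_Ioc hτ, ?_⟩
    refine symbolBound_of_linear_ode n ih
      (q := fun τ => τ ^ 2 - 2 * τ * (1 - τ ^ 2) - (2 * τ - 4 * τ ^ 3))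
      (S := fun i τ => (2 * τ - 2 + 6 * τ ^ 2) * bagE i τ -
        bagMu i * ((2 * τ - 3 * τ ^ 2) * (bagE i τ * bagE i τ)))
      (by fun_prop) (by simp) (fun i => (contDiffOn_bagE i).derivWithin_Ioc) ?_ ?_
    · intro i τ hτ
      have hd := (contDiffOn_bagE i).hasDerivWithinAt_Ioc hτ
      have hl := (hasDerivAt_weight τ).hasDerivWithinAt.mul
        ((contDiffOn_bagE i).derivWithin_Ioc.hasDerivWithinAt_Ioc hτ)
      have hp : HasDerivAt (fun τ : ℝ => τ ^ 2 - 2 * τ * (1 - τ ^ 2)) (2 * τ - 2 + 6 * τ ^ 2) τ := by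
        have h := ((hasDerivAt_id τ).fun_pow 2).sub (((hasDerivAt_id τ).const_mul 2).mul
          (((hasDerivAt_id τ).fun_pow 2).const_sub 1))
        refine h.congr_deriv ?_
        simp only [id]
        norm_num
        ring
      have hr := (((hd.const_mul (bagMu i)).mul
        (((hasDerivAt_one_sub_mul_sq τ).hasDerivWithinAt.mul hd).const_sub 2)).sub_const 1).add
        (hp.hasDerivWithinAt.mul hd)
      have he := (uniqueDiffOn_Ioc (0 : ℝ) 1 τ hτ).eq_deriv _
        (hl.congr (fun x hx => (derivWithin_bagE i hx).symm) (derivWithin_bagE i hτ).symm) hr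
      simp only [Pi.mul_apply] at he
      rw [bagA]
      linear_combination he
    · have h1 := (ih.coeff_mul (q := fun τ => 2 * τ - 2 + 6 * τ ^ 2) (by fun_prop))
      have h2 := ((ih.mul ih).coeff_mul (q := fun τ => 2 * τ - 3 * τ ^ 2) (by fun_prop)).mu_mul
      exact (h1.mono_right (by norm_num)).sub (h2.mono_right (by norm_num))

/-- Second coefficient of the large order expansion of `bagE`. -/
def bagE₂ (τ : ℝ) : ℝ := τ / 2 - τ ^ 2 / 8 - 5 / 8 * τ ^ 3

/-- Third coefficient of the large order expansion of `bagE`. -/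
def bagE₃ (τ : ℝ) : ℝ :=
  3 / 4 * τ ^ 2 - 1 / 4 * τ ^ 3 - 41 / 16 * τ ^ 4 + 5 / 16 * τ ^ 5 + 15 / 8 * τ ^ 6

theorem contDiff_bagE₂ : ContDiff ℝ (⊤ : ℕ∞) bagE₂ := by unfold bagE₂; fun_prop

theorem contDiff_bagE₃ : ContDiff ℝ (⊤ : ℕ∞) bagE₃ := by unfold bagE₃; fun_prop

theorem hasDerivAt_bagE₂ (τ : ℝ) : HasDerivAt bagE₂ (1 / 2 - τ / 4 - 15 / 8 * τ ^ 2) τ := by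
  have h := ((hasDerivAt_id τ).div_const 2).sub (((hasDerivAt_id τ).fun_pow 2).div_const 8) |>.sub
    (((hasDerivAt_id τ).fun_pow 3).const_mul (5 / 8))
  refine h.congr_deriv ?_
  simp only [id]
  norm_num
  ring

theorem hasDerivAt_bagE₃ (τ : ℝ) : HasDerivAt bagE₃
    (3 / 2 * τ - 3 / 4 * τ ^ 2 - 41 / 4 * τ ^ 3 + 25 / 16 * τ ^ 4 + 45 / 4 * τ ^ 5) τ := by
  have h := ((((((hasDerivAt_id τ).fun_pow 2).const_mul (3 / 4)).sub
    (((hasDerivAt_id τ).fun_pow 3).const_mul (1 / 4))).sub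
    (((hasDerivAt_id τ).fun_pow 4).const_mul (41 / 16))).add
    (((hasDerivAt_id τ).fun_pow 5).const_mul (5 / 16))).add
    (((hasDerivAt_id τ).fun_pow 6).const_mul (15 / 8))
  refine h.congr_deriv ?_
  simp only [id]
  norm_num
  ring

theorem symbolBound_derivWithin_bagE (n : ℕ) :
    SymbolBound n 1 fun i => derivWithin (bagE i) (Ioc 0 1) :=
  (symbolBound_bagE (n + 1)).deriv_right fun i _ hτ => (contDiffOn_bagE i).hasDerivWithinAt_Ioc hτ

theorem symbolBound_bagE_sub_one (n : ℕ) :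
    SymbolBound n 2 fun i τ => bagE i τ - (bagMu i)⁻¹ / 2 := by
  have hE := symbolBound_bagE n
  have h1 := hE.coeff_mul (q := fun τ => -(τ ^ 2 - 2 * τ * (1 - τ ^ 2)) / 2) (by fun_prop)
  have h2 := (hE.mul hE).mu_mul.coeff_mul (q := fun τ => (1 - τ) * τ ^ 2 / 2) (by fun_prop)
  have h3 := (symbolBound_derivWithin_bagE n).coeff_mul (q := fun τ => τ ^ 2 * (1 - τ ^ 2) / 2)
    (by fun_prop)
  refine ((h1.add h2).add h3).inv_mu_mul.congr fun i τ hτ => ?_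
  have hμ := bagMu_ne_zero i
  have := derivWithin_bagE i hτ
  field_simp
  linear_combination (-this)

theorem symbolBound_bagE_sub_two (n : ℕ) :
    SymbolBound n 3 fun i τ => bagE i τ - (bagMu i)⁻¹ / 2 - (bagMu i)⁻¹ ^ 2 * bagE₂ τ := by
  have hE := symbolBound_bagE n
  have hR := symbolBound_bagE_sub_one n
  have hR' : SymbolBound n 2 fun i => derivWithin (bagE i) (Ioc 0 1) :=
    (symbolBound_bagE_sub_one (n + 1)).deriv_right fun i τ hτ =>
      ((contDiffOn_bagE i).hasDerivWithinAt_Ioc hτ).sub_const _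
  have hc : SymbolBound n 1 fun i _ => (bagMu i)⁻¹ * (1 / 2) := (SymbolBound.const _).inv_mu_mul
  have h1 := hR.coeff_mul (q := fun τ => -(τ ^ 2 - 2 * τ * (1 - τ ^ 2)) / 2) (by fun_prop)
  have h2 := (hR.mul (hE.add hc)).mu_mul.coeff_mul (q := fun τ => (1 - τ) * τ ^ 2 / 2)
    (by fun_prop)
  have h3 := hR'.coeff_mul (q := fun τ => τ ^ 2 * (1 - τ ^ 2) / 2) (by fun_prop)
  refine ((h1.add h2).add h3).inv_mu_mul.congr fun i τ hτ => ?_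
  have hμ := bagMu_ne_zero i
  have := derivWithin_bagE i hτ
  rw [bagE₂]
  field_simp
  linear_combination (-32 * bagMu i) * this

theorem symbolBound_bagE_sub_three (n : ℕ) :
    SymbolBound n 4 fun i τ => bagE i τ - (bagMu i)⁻¹ / 2 - (bagMu i)⁻¹ ^ 2 * bagE₂ τ -
      (bagMu i)⁻¹ ^ 3 * bagE₃ τ := by
  have hE := symbolBound_bagE n
  have hR := symbolBound_bagE_sub_two n
  have hR' : SymbolBound n 3 fun i τ => derivWithin (bagE i) (Ioc 0 1) τ -
      (bagMu i)⁻¹ ^ 2 * (1 / 2 - τ / 4 - 15 / 8 * τ ^ 2) :=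
    (symbolBound_bagE_sub_two (n + 1)).deriv_right fun i τ hτ =>
      (((contDiffOn_bagE i).hasDerivWithinAt_Ioc hτ).sub_const _).sub
        ((hasDerivAt_bagE₂ τ).const_mul _).hasDerivWithinAt
  have hc : SymbolBound n 1 fun i _ => (bagMu i)⁻¹ * (1 / 2) := (SymbolBound.const _).inv_mu_mul
  have hc2 : SymbolBound n 2 fun i τ => (bagMu i)⁻¹ * ((bagMu i)⁻¹ * bagE₂ τ) :=
    (SymbolBound.of_contDiff contDiff_bagE₂).inv_mu_mul.inv_mu_mul
  have h1 := hR.coeff_mul (q := fun τ => -(τ ^ 2 - 2 * τ * (1 - τ ^ 2)) / 2) (by fun_prop)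
  have h2 := ((hR.mul ((hE.add hc).add (hc2.mono_right (by norm_num)))).add
    (hc2.mul hc2)).mu_mul.coeff_mul (q := fun τ => (1 - τ) * τ ^ 2 / 2) (by fun_prop)
  have h3 := hR'.coeff_mul (q := fun τ => τ ^ 2 * (1 - τ ^ 2) / 2) (by fun_prop)
  refine ((h1.add h2).add h3).inv_mu_mul.congr fun i τ hτ => ?_
  have hμ := bagMu_ne_zero i
  have := derivWithin_bagE i hτ
  rw [bagE₂, bagE₃]
  field_simp
  linear_combination (-16384 * bagMu i ^ 3) * this

/-- Numerator of the scaled generating function. -/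
def bagN (i : ℕ) (τ : ℝ) : ℝ :=
  1 - τ ^ 2 * bagE i τ +
    (1 - τ ^ 2) * (2 * τ * bagE i τ + τ ^ 2 * derivWithin (bagE i) (Ioc 0 1) τ)

/-- Denominator of the scaled generating function. -/
def bagD (a : ℝ) (i : ℕ) (τ : ℝ) : ℝ :=
  1 + τ + a ^ 2 * (1 - τ) * (1 - τ ^ 2 * bagE i τ) ^ 2

/-- The scaled generating function. -/
def bagh (a : ℝ) (i : ℕ) (τ : ℝ) : ℝ := a * bagN i τ * (bagD a i τ)⁻¹

theorem one_le_bagD (a : ℝ) (i : ℕ) {τ : ℝ} (hτ : τ ∈ Ioc (0 : ℝ) 1) : 1 ≤ bagD a i τ := by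
  have h1 : 0 ≤ 1 - τ := by linarith [hτ.2]
  have := hτ.1
  have : 0 ≤ a ^ 2 * (1 - τ) * (1 - τ ^ 2 * bagE i τ) ^ 2 := by positivity
  rw [bagD]; linarith

theorem bagMu_mul_besselH (a : ℝ) (i : ℕ) {τ : ℝ} (hτ : τ ∈ Ioc (0 : ℝ) 1) :
    bagMu i * besselH (i + 1) a (bagMu i ^ 2 * ((1 - τ ^ 2) / τ ^ 2)) = τ ^ 2 * bagh a i τ := by
  have hμ := bagMu_ne_zero i
  have hτ0 := hτ.1
  have hD := one_le_bagD a i hτ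
  have hG : besselG (i + 1) (bagMu i ^ 2 * ((1 - τ ^ 2) / τ ^ 2)) = (bagMu i)⁻¹ * bagG i τ := by
    rw [bagG, inv_mul_cancel_left₀ hμ]
  have hode := derivWithin_bagE i hτ
  have hi : (2 * ((i + 1 : ℕ) : ℝ) + 1) = 2 * bagMu i := by rw [bagMu]; push_cast; ring
  rw [besselH, bagh, hG, bagG_eq i hτ, hi]
  have hN : bagN i τ = bagMu i * bagE i τ * (2 - (1 - τ) * (τ ^ 2 * bagE i τ)) := by
    rw [bagN]; linear_combination hode
  have hden : 1 + a ^ 2 * (bagMu i ^ 2 * ((1 - τ ^ 2) / τ ^ 2)) *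
      ((bagMu i)⁻¹ * (τ * (1 - τ ^ 2 * bagE i τ) / (1 + τ))) ^ 2 = bagD a i τ / (1 + τ) := by
    rw [bagD]
    field_simp
    ring
  have hnum : 1 - bagMu i ^ 2 * ((1 - τ ^ 2) / τ ^ 2) *
      ((bagMu i)⁻¹ * (τ * (1 - τ ^ 2 * bagE i τ) / (1 + τ))) ^ 2 -
      2 * bagMu i * ((bagMu i)⁻¹ * (τ * (1 - τ ^ 2 * bagE i τ) / (1 + τ))) =
      (τ ^ 2 * bagE i τ) * (2 - (1 - τ) * (τ ^ 2 * bagE i τ)) / (1 + τ) := by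
    field_simp
    ring
  rw [hden, hnum]
  have hD' : bagD a i τ ≠ 0 := by linarith
  have h1 : 1 + τ ≠ 0 := by positivity
  field_simp
  linear_combination (-a) * hN

/-- Leading order denominator. -/
def bagd (a τ : ℝ) : ℝ := 1 + τ + a ^ 2 * (1 - τ)

theorem one_le_bagd (a : ℝ) {τ : ℝ} (hτ : τ ∈ Ioc (0 : ℝ) 1) : 1 ≤ bagd a τ := by
  have h1 : 0 ≤ 1 - τ := by linarith [hτ.2]
  have := hτ.1
  have : 0 ≤ a ^ 2 * (1 - τ) := by positivity
  rw [bagd]; linarith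

/-- Coefficients of the expansion of `bagN`. -/
def bagN₁ (τ : ℝ) : ℝ := -(τ ^ 2 / 2) + (1 - τ ^ 2) * τ

def bagN₂ (τ : ℝ) : ℝ := -(τ ^ 2 * bagE₂ τ) +
  (1 - τ ^ 2) * (2 * τ * bagE₂ τ + τ ^ 2 * (1 / 2 - τ / 4 - 15 / 8 * τ ^ 2))

def bagN₃ (τ : ℝ) : ℝ := -(τ ^ 2 * bagE₃ τ) +
  (1 - τ ^ 2) * (2 * τ * bagE₃ τ + τ ^ 2 *
    (3 / 2 * τ - 3 / 4 * τ ^ 2 - 41 / 4 * τ ^ 3 + 25 / 16 * τ ^ 4 + 45 / 4 * τ ^ 5))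

/-- Coefficients of the expansion of `bagD`. -/
def bagD₁ (a τ : ℝ) : ℝ := a ^ 2 * (1 - τ) * (-τ ^ 2)

def bagD₂ (a τ : ℝ) : ℝ := a ^ 2 * (1 - τ) * (-(2 * τ ^ 2 * bagE₂ τ) + τ ^ 4 / 4)

def bagD₃ (a τ : ℝ) : ℝ := a ^ 2 * (1 - τ) * (-(2 * τ ^ 2 * bagE₃ τ) + τ ^ 4 * bagE₂ τ)

/-- Coefficients of the expansion of `bagh`. -/
def bagh₀ (a τ : ℝ) : ℝ := a * (bagd a τ)⁻¹

def bagh₁ (a τ : ℝ) : ℝ := (a * bagN₁ τ - bagD₁ a τ * bagh₀ a τ) * (bagd a τ)⁻¹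

def bagh₂ (a τ : ℝ) : ℝ :=
  (a * bagN₂ τ - bagD₁ a τ * bagh₁ a τ - bagD₂ a τ * bagh₀ a τ) * (bagd a τ)⁻¹

def bagh₃ (a τ : ℝ) : ℝ :=
  (a * bagN₃ τ - bagD₁ a τ * bagh₂ a τ - bagD₂ a τ * bagh₁ a τ - bagD₃ a τ * bagh₀ a τ) *
    (bagd a τ)⁻¹

section

variable (n : ℕ) (a : ℝ)

theorem symbolBound_bagd_inv : SymbolBound n 0 fun _ τ => (bagd a τ)⁻¹ :=
  SymbolBound.inv one_pos (SymbolBound.of_contDiff (by unfold bagd; fun_prop))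
    fun _ _ hτ => one_le_bagd a hτ

theorem contDiff_bagN₁ : ContDiff ℝ (⊤ : ℕ∞) bagN₁ := by unfold bagN₁; fun_prop
theorem contDiff_bagN₂ : ContDiff ℝ (⊤ : ℕ∞) bagN₂ := by
  have := contDiff_bagE₂; unfold bagN₂; fun_prop
theorem contDiff_bagN₃ : ContDiff ℝ (⊤ : ℕ∞) bagN₃ := by
  have := contDiff_bagE₃; unfold bagN₃; fun_prop
theorem contDiff_bagD₁ : ContDiff ℝ (⊤ : ℕ∞) (bagD₁ a) := by unfold bagD₁; fun_prop
theorem contDiff_bagD₂ : ContDiff ℝ (⊤ : ℕ∞) (bagD₂ a) := by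
  have := contDiff_bagE₂; unfold bagD₂; fun_prop
theorem contDiff_bagD₃ : ContDiff ℝ (⊤ : ℕ∞) (bagD₃ a) := by
  have := contDiff_bagE₂; have := contDiff_bagE₃; unfold bagD₃; fun_prop

theorem symbolBound_bagh₀ : SymbolBound n 0 fun _ => bagh₀ a :=
  (symbolBound_bagd_inv n a).const_mul a

theorem symbolBound_bagh₁ : SymbolBound n 0 fun _ => bagh₁ a :=
  ((((SymbolBound.of_contDiff contDiff_bagN₁).const_mul a).sub
    ((symbolBound_bagh₀ n a).coeff_mul (contDiff_bagD₁ a))).mul (symbolBound_bagd_inv n a))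

theorem symbolBound_bagh₂ : SymbolBound n 0 fun _ => bagh₂ a :=
  (((((SymbolBound.of_contDiff contDiff_bagN₂).const_mul a).sub
    ((symbolBound_bagh₁ n a).coeff_mul (contDiff_bagD₁ a))).sub
    ((symbolBound_bagh₀ n a).coeff_mul (contDiff_bagD₂ a))).mul (symbolBound_bagd_inv n a))

theorem symbolBound_bagh₃ : SymbolBound n 0 fun _ => bagh₃ a :=
  ((((((SymbolBound.of_contDiff contDiff_bagN₃).const_mul a).sub
    ((symbolBound_bagh₂ n a).coeff_mul (contDiff_bagD₁ a))).sub
    ((symbolBound_bagh₁ n a).coeff_mul (contDiff_bagD₂ a))).sub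
    ((symbolBound_bagh₀ n a).coeff_mul (contDiff_bagD₃ a))).mul (symbolBound_bagd_inv n a))

theorem symbolBound_bagD_inv : SymbolBound n 0 fun i τ => (bagD a i τ)⁻¹ := by
  have hE := ((symbolBound_bagE n).coeff_mul (q := fun τ => τ ^ 2) (by fun_prop)).mono_right
    (k := 0) (by norm_num)
  have h1 := (SymbolBound.const (n := n) 1).sub hE
  refine SymbolBound.inv one_pos (((SymbolBound.of_contDiff (q := fun τ => 1 + τ)
    (by fun_prop)).add ((h1.mul h1).coeff_mul (q := fun τ => a ^ 2 * (1 - τ))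
      (by fun_prop))).congr fun i τ _ => ?_) fun i τ hτ => one_le_bagD a i hτ
  rw [bagD]
  ring

/-- Fourth order remainder of `bagE`. -/
def bagR (i : ℕ) (τ : ℝ) : ℝ :=
  bagE i τ - (bagMu i)⁻¹ / 2 - (bagMu i)⁻¹ ^ 2 * bagE₂ τ - (bagMu i)⁻¹ ^ 3 * bagE₃ τ

theorem symbolBound_bagN_rem : SymbolBound n 4 fun i τ => bagN i τ - (1 + (bagMu i)⁻¹ * bagN₁ τ +
    (bagMu i)⁻¹ ^ 2 * bagN₂ τ + (bagMu i)⁻¹ ^ 3 * bagN₃ τ) := by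
  have hR : SymbolBound n 4 bagR := symbolBound_bagE_sub_three n
  have hR' : SymbolBound n 4 fun i τ => derivWithin (bagE i) (Ioc 0 1) τ -
      (bagMu i)⁻¹ ^ 2 * (1 / 2 - τ / 4 - 15 / 8 * τ ^ 2) - (bagMu i)⁻¹ ^ 3 *
        (3 / 2 * τ - 3 / 4 * τ ^ 2 - 41 / 4 * τ ^ 3 + 25 / 16 * τ ^ 4 + 45 / 4 * τ ^ 5) :=
    (symbolBound_bagE_sub_three (n + 1)).deriv_right fun i τ hτ =>
      ((((contDiffOn_bagE i).hasDerivWithinAt_Ioc hτ).sub_const _).sub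
        ((hasDerivAt_bagE₂ τ).const_mul _).hasDerivWithinAt).sub
        ((hasDerivAt_bagE₃ τ).const_mul _).hasDerivWithinAt
  refine ((hR.coeff_mul (q := fun τ => -τ ^ 2 + (1 - τ ^ 2) * (2 * τ)) (by fun_prop)).add
    (hR'.coeff_mul (q := fun τ => (1 - τ ^ 2) * τ ^ 2) (by fun_prop))).congr fun i τ _ => ?_
  rw [bagN, bagN₁, bagN₂, bagN₃, bagR]
  ring

theorem symbolBound_bagD_rem : SymbolBound n 4 fun i τ => bagD a i τ - (bagd a τ +
    (bagMu i)⁻¹ * bagD₁ a τ + (bagMu i)⁻¹ ^ 2 * bagD₂ a τ + (bagMu i)⁻¹ ^ 3 * bagD₃ a τ) := by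
  have hR : SymbolBound n 4 bagR := symbolBound_bagE_sub_three n
  have hE := symbolBound_bagE n
  have hc : SymbolBound n 1 fun i _ => (bagMu i)⁻¹ * (1 / 2) := (SymbolBound.const _).inv_mu_mul
  have hc2 : SymbolBound n 2 fun i τ => (bagMu i)⁻¹ * ((bagMu i)⁻¹ * bagE₂ τ) :=
    (SymbolBound.of_contDiff contDiff_bagE₂).inv_mu_mul.inv_mu_mul
  have hc3 : SymbolBound n 3 fun i τ => (bagMu i)⁻¹ * ((bagMu i)⁻¹ * ((bagMu i)⁻¹ * bagE₃ τ)) :=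
    (SymbolBound.of_contDiff contDiff_bagE₃).inv_mu_mul.inv_mu_mul.inv_mu_mul
  have h1 := hR.const_mul (-2)
  have h2 := (hR.mul (((hE.add hc).add (hc2.mono_right (by norm_num))).add
    (hc3.mono_right (by norm_num)))).mono_right (k := 4) (by norm_num)
  have h3 := (((hc.mul hc3).mono_right (k := 4) (by norm_num)).const_mul 2).add
    ((hc2.mul hc2).mono_right (k := 4) (by norm_num))
  have h4 := ((hc2.mul hc3).mono_right (k := 4) (by norm_num)).const_mul 2
  have h5 := (hc3.mul hc3).mono_right (k := 4) (by norm_num)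
  refine ((h1.coeff_mul (q := fun τ => a ^ 2 * (1 - τ) * τ ^ 2) (by fun_prop)).add
    ((((h2.add h3).add h4).add h5).coeff_mul (q := fun τ => a ^ 2 * (1 - τ) * τ ^ 4)
      (by fun_prop))).congr fun i τ _ => ?_
  rw [bagD, bagd, bagD₁, bagD₂, bagD₃, bagR]
  ring

/-- Fourth order remainder of `bagh`. -/
def baghRem (i : ℕ) (τ : ℝ) : ℝ := bagh a i τ - (bagh₀ a τ + (bagMu i)⁻¹ * bagh₁ a τ +
    (bagMu i)⁻¹ ^ 2 * bagh₂ a τ + (bagMu i)⁻¹ ^ 3 * bagh₃ a τ)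

theorem symbolBound_inv_mu_pow (m : ℕ) : SymbolBound n m fun i _ => (bagMu i)⁻¹ ^ m := by
  induction m with
  | zero => simpa using SymbolBound.const 1
  | succ m ih => simpa only [pow_succ'] using ih.inv_mu_mul

theorem symbolBound_baghRem : SymbolBound n 4 (baghRem a) := by
  have hN := symbolBound_bagN_rem n
  have hD := symbolBound_bagD_rem n a
  have hi := symbolBound_bagD_inv n a
  have p := symbolBound_inv_mu_pow n
  have H0 := symbolBound_bagh₀ n a
  have H1 := symbolBound_bagh₁ n a
  have H2 := symbolBound_bagh₂ n a
  have H3 := symbolBound_bagh₃ n a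
  have hsum : SymbolBound n 0 fun i τ => bagh₀ a τ + (bagMu i)⁻¹ ^ 1 * bagh₁ a τ +
      (bagMu i)⁻¹ ^ 2 * bagh₂ a τ + (bagMu i)⁻¹ ^ 3 * bagh₃ a τ :=
    ((H0.add (((p 1).mul H1).mono_right (Nat.zero_le _))).add
      (((p 2).mul H2).mono_right (Nat.zero_le _))).add
      (((p 3).mul H3).mono_right (Nat.zero_le _))
  have hx : SymbolBound n 4 fun i τ => (bagMu i)⁻¹ ^ 4 *
      (bagD₁ a τ * bagh₃ a τ + bagD₂ a τ * bagh₂ a τ + bagD₃ a τ * bagh₁ a τ) :=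
    (p 4).mul (((H3.coeff_mul (contDiff_bagD₁ a)).add (H2.coeff_mul (contDiff_bagD₂ a))).add
      (H1.coeff_mul (contDiff_bagD₃ a)))
  have hy : SymbolBound n 4 fun i τ => (bagMu i)⁻¹ ^ 5 *
      (bagD₂ a τ * bagh₃ a τ + bagD₃ a τ * bagh₂ a τ) :=
    ((p 5).mul ((H3.coeff_mul (contDiff_bagD₂ a)).add
      (H2.coeff_mul (contDiff_bagD₃ a)))).mono_right (by norm_num)
  have hz : SymbolBound n 4 fun i τ => (bagMu i)⁻¹ ^ 6 * (bagD₃ a τ * bagh₃ a τ) :=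
    ((p 6).mul (H3.coeff_mul (contDiff_bagD₃ a))).mono_right (by norm_num)
  refine (((((hN.const_mul a).sub (hD.mul hsum)).sub hx).sub hy).sub hz).mul hi |>.congr
    fun i τ hτ => ?_
  have hD0 : bagD a i τ ≠ 0 := by linarith [one_le_bagD a i hτ]
  have hd0 : bagd a τ ≠ 0 := by linarith [one_le_bagd a hτ]
  have e0 : bagh₀ a τ * bagd a τ = a := by rw [bagh₀]; field_simp
  have e1 : bagh₁ a τ * bagd a τ = a * bagN₁ τ - bagD₁ a τ * bagh₀ a τ := by
    rw [bagh₁]; field_simp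
  have e2 : bagh₂ a τ * bagd a τ = a * bagN₂ τ - bagD₁ a τ * bagh₁ a τ - bagD₂ a τ * bagh₀ a τ := by
    rw [bagh₂]; field_simp
  have e3 : bagh₃ a τ * bagd a τ = a * bagN₃ τ - bagD₁ a τ * bagh₂ a τ - bagD₂ a τ * bagh₁ a τ -
      bagD₃ a τ * bagh₀ a τ := by
    rw [bagh₃]; field_simp
  rw [baghRem, bagh, eq_mul_inv_iff_mul_eq₀ hD0, sub_mul, inv_mul_cancel_right₀ hD0]
  linear_combination -e0 - (bagMu i)⁻¹ * e1 - (bagMu i)⁻¹ ^ 2 * e2 - (bagMu i)⁻¹ ^ 3 * e3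

end

/-- The variable `τ = (1 + X)^(-1/2)`. -/
def bagTau (X : ℝ) : ℝ := (√(1 + X))⁻¹

theorem bagTau_mem {X : ℝ} (hX : 0 < X) : bagTau X ∈ Ioo (0 : ℝ) 1 := by
  have h : 1 < √(1 + X) := by
    rw [Real.lt_sqrt zero_le_one]; linarith
  exact ⟨inv_pos.2 (by linarith), inv_lt_one_of_one_lt₀ h⟩

theorem bagTau_mem_Ioc {X : ℝ} (hX : 0 < X) : bagTau X ∈ Ioc (0 : ℝ) 1 :=
  Ioo_subset_Ioc_self (bagTau_mem hX)

theorem bagTau_sq {X : ℝ} (hX : 0 < X) : bagTau X ^ 2 = (1 + X)⁻¹ := by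
  rw [bagTau, inv_pow, Real.sq_sqrt (by linarith)]

theorem bagTau_X {X : ℝ} (hX : 0 < X) : (1 - bagTau X ^ 2) / bagTau X ^ 2 = X := by
  rw [bagTau_sq hX]
  have : 1 + X ≠ 0 := by linarith
  field_simp
  ring

theorem hasDerivAt_bagTau {X : ℝ} (hX : 0 < X) : HasDerivAt bagTau (-(bagTau X ^ 3) / 2) X := by
  have h0 : √(1 + X) ≠ 0 := by
    rw [Real.sqrt_ne_zero'];linarith
  have h := (((hasDerivAt_id X).const_add 1).sqrt (by simp only [id]; linarith)).inv
    (by simpa using h0)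
  refine h.congr_deriv ?_
  simp only [id]
  rw [bagTau]
  field_simp

theorem tendsto_bagTau_atTop : Tendsto bagTau atTop (𝓝 0) :=
  tendsto_inv_atTop_zero.comp (Real.tendsto_sqrt_atTop.comp (tendsto_atTop_add_const_left _ _ tendsto_id))

theorem tendsto_bagTau_zero : Tendsto bagTau (𝓝[>] 0) (𝓝 1) := by
  have : ContinuousAt bagTau 0 := by
    unfold bagTau
    refine ContinuousAt.inv₀ (by fun_prop) (by simp)
  have h := this.tendsto.mono_left (nhdsWithin_le_nhds (s := Ioi 0))
  simpa [bagTau] using h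

theorem SymbolBound.continuousOn_Ioc {n k : ℕ} {f : ℕ → ℝ → ℝ} (h : SymbolBound (n + 1) k f)
    (i : ℕ) : ContinuousOn (f i) (Ioc 0 1) := by
  obtain ⟨f', h', -⟩ := h.exists_deriv
  exact fun τ hτ => (h' i τ hτ).continuousWithinAt

theorem SymbolBound.exists_deriv_comp_bagTau {n k : ℕ} {f : ℕ → ℝ → ℝ}
    (h : SymbolBound (n + 1) k f) (m : ℕ) :
    ∃ g : ℕ → ℝ → ℝ, SymbolBound n k g ∧ ∀ i, ∀ X, 0 < X →
      HasDerivAt (fun X => bagTau X ^ m * f i (bagTau X)) (bagTau X ^ (m + 2) * g i (bagTau X)) X := by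
  obtain ⟨f', h', hs⟩ := h.exists_deriv
  refine ⟨fun i τ => -(1 / 2) * (m * f i τ + τ * f' i τ), ?_, fun i X hX => ?_⟩
  · exact ((h.of_succ.const_mul _).add (hs.coeff_mul (q := fun τ => τ) (by fun_prop))).const_mul _
  · have ht := hasDerivAt_bagTau hX
    have hm := bagTau_mem hX
    have hf : HasDerivAt (f i) (f' i (bagTau X)) (bagTau X) :=
      (h' i _ (Ioo_subset_Ioc_self hm)).hasDerivAt (Ioc_mem_nhds hm.1 hm.2)
    refine ((ht.fun_pow m).mul (hf.comp X ht)).congr_deriv ?_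
    simp only [Function.comp]
    rcases m with _ | m
    · simp; ring
    · simp only [Nat.add_sub_cancel]
      push_cast
      ring

/-- Continuous functions on the half line with cubic decay and constant `C`. -/
def CubeDecay (C : ℝ) (p : ℝ → ℝ) : Prop :=
  ContinuousOn p (Ioi 0) ∧ ∀ X, 0 < X → |p X| ≤ C * ((1 + X) ^ 3)⁻¹

namespace CubeDecay

variable {C : ℝ} {p : ℝ → ℝ} {b : ℂ}

theorem continuousOn_ofReal (h : CubeDecay C p) : ContinuousOn (fun X => (p X : ℂ)) (Ioi 0) :=
  Complex.continuous_ofReal.comp_continuousOn h.1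

theorem locallyIntegrableOn (h : CubeDecay C p) :
    LocallyIntegrableOn (fun X => (p X : ℂ)) (Ioi 0) :=
  h.continuousOn_ofReal.locallyIntegrableOn measurableSet_Ioi

theorem nonneg (h : CubeDecay C p) : 0 ≤ C := by
  have := (abs_nonneg _).trans (h.2 1 one_pos)
  norm_num at this
  linarith

theorem isBigO_atTop (h : CubeDecay C p) :
    (fun X => (p X : ℂ)) =O[atTop] fun X : ℝ => X ^ (-(3 : ℝ)) := by
  refine Asymptotics.IsBigO.of_bound C ?_
  filter_upwards [eventually_gt_atTop 0] with X hX
  rw [Complex.norm_real, Real.norm_eq_abs, Real.norm_eq_abs, Real.rpow_neg hX.le,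
    abs_of_pos (a := (X ^ (3 : ℝ))⁻¹) (by positivity)]
  refine (h.2 X hX).trans (mul_le_mul_of_nonneg_left ?_ h.nonneg)
  norm_cast
  gcongr
  linarith

theorem isBigO_zero (h : CubeDecay C p) :
    (fun X => (p X : ℂ)) =O[𝓝[>] 0] fun X : ℝ => X ^ (-(0 : ℝ)) := by
  refine Asymptotics.IsBigO.of_bound C ?_
  filter_upwards [self_mem_nhdsWithin] with X hX
  have hX : 0 < X := hX
  rw [Complex.norm_real, Real.norm_eq_abs]
  simp only [neg_zero, Real.rpow_zero, norm_one]
  refine (h.2 X hX).trans (mul_le_mul_of_nonneg_left ?_ h.nonneg)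
  refine inv_le_one_of_one_le₀ (one_le_pow₀ (by linarith))

theorem mellinConvergent (h : CubeDecay C p) (h0 : 0 < b.re) (h3 : b.re < 3) :
    MellinConvergent (fun X => (p X : ℂ)) b :=
  mellinConvergent_of_isBigO_rpow h.locallyIntegrableOn h.isBigO_atTop h3 h.isBigO_zero h0

theorem differentiableAt_mellin (h : CubeDecay C p) (h0 : 0 < b.re) (h3 : b.re < 3) :
    DifferentiableAt ℂ (mellin fun X => (p X : ℂ)) b :=
  mellin_differentiableAt_of_isBigO_rpow h.locallyIntegrableOn h.isBigO_atTop h3 h.isBigO_zero h0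

theorem integrableOn_rpow {β : ℝ} (h0 : 0 < β) (h3 : β < 3) :
    IntegrableOn (fun X : ℝ => X ^ (β - 1) * ((1 + X) ^ 3)⁻¹) (Ioi 0) := by
  have h : CubeDecay 1 fun X => ((1 + X) ^ 3)⁻¹ := by
    refine ⟨fun X hX => ?_, fun X hX => ?_⟩
    · have hX : 0 < X := hX
      exact ContinuousAt.continuousWithinAt
        (ContinuousAt.inv₀ (by fun_prop) (by positivity))
    · rw [abs_of_pos (by positivity), one_mul]
  have := (h.mellinConvergent (b := (β : ℂ)) (by simpa) (by simpa)).re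
  refine this.congr ?_
  refine (ae_restrict_mem measurableSet_Ioi).mono fun X hX => ?_
  have hX : 0 < X := hX
  have e : (X : ℂ) ^ ((β : ℂ) - 1) • ((((1 + X) ^ 3)⁻¹ : ℝ) : ℂ) =
      ((X ^ (β - 1) * ((1 + X) ^ 3)⁻¹ : ℝ) : ℂ) := by
    rw [smul_eq_mul, Complex.ofReal_mul, Complex.ofReal_cpow hX.le]
    push_cast; rfl
  simp only [e]
  exact Complex.ofReal_re _

theorem exists_norm_mellin_le : ∃ K : ℝ, 0 ≤ K ∧ ∀ (C : ℝ) (p : ℝ → ℝ) (b : ℂ), CubeDecay C p →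
    1 / 4 ≤ b.re → b.re ≤ 11 / 4 → ‖mellin (fun X => (p X : ℂ)) b‖ ≤ C * K := by
  have i1 := integrableOn_rpow (β := 1 / 4) (by norm_num) (by norm_num)
  have i2 := integrableOn_rpow (β := 11 / 4) (by norm_num) (by norm_num)
  refine ⟨∫ X in Ioi (0 : ℝ), (X ^ ((1 / 4 : ℝ) - 1) * ((1 + X) ^ 3)⁻¹ +
    X ^ ((11 / 4 : ℝ) - 1) * ((1 + X) ^ 3)⁻¹), ?_, fun C p b h h1 h2 => ?_⟩
  · refine setIntegral_nonneg measurableSet_Ioi fun X hX => ?_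
    have hX : 0 < X := hX
    positivity
  · rw [mellin, ← integral_const_mul]
    refine norm_integral_le_of_norm_le ((i1.add i2).const_mul C) ?_
    refine (ae_restrict_mem measurableSet_Ioi).mono fun X hX => ?_
    have hX : 0 < X := hX
    rw [norm_smul, Complex.norm_cpow_eq_rpow_re_of_pos hX, Complex.norm_real, Real.norm_eq_abs,
      Complex.sub_re, Complex.one_re]
    have hr : X ^ (b.re - 1) ≤ X ^ ((1 / 4 : ℝ) - 1) + X ^ ((11 / 4 : ℝ) - 1) := by
      rcases le_total X 1 with hx | hx
      · have := Real.rpow_le_rpow_of_exponent_ge hX hx (sub_le_sub_right h1 1)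
        have h' : 0 ≤ X ^ ((11 / 4 : ℝ) - 1) := by positivity
        linarith
      · have := Real.rpow_le_rpow_of_exponent_le hx (sub_le_sub_right h2 1)
        have h' : 0 ≤ X ^ ((1 / 4 : ℝ) - 1) := by positivity
        linarith
    calc X ^ (b.re - 1) * |p X| ≤ (X ^ ((1 / 4 : ℝ) - 1) + X ^ ((11 / 4 : ℝ) - 1)) *
          (C * ((1 + X) ^ 3)⁻¹) := mul_le_mul hr (h.2 X hX) (abs_nonneg _) (by positivity)
      _ = _ := by ring

end CubeDecay

theorem SymbolBound.exists_cubeDecay {n k : ℕ} {g : ℕ → ℝ → ℝ} (h : SymbolBound (n + 1) k g) :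
    ∃ C, ∀ i, CubeDecay (C * (bagMu i ^ k)⁻¹) fun X => bagTau X ^ 6 * g i (bagTau X) := by
  obtain ⟨C, hC⟩ := h.bound
  refine ⟨C, fun i => ⟨fun X hX => ?_, fun X hX => ?_⟩⟩
  · have hm := bagTau_mem hX
    have hc := ((h.continuousOn_Ioc i).continuousAt (Ioc_mem_nhds hm.1 hm.2))
    have ht := (hasDerivAt_bagTau hX).continuousAt
    exact ((ht.pow 6).mul (ContinuousAt.comp (f := bagTau) hc ht)).continuousWithinAt
  · have := hC i _ (bagTau_mem_Ioc hX)
    have hμ := bagMu_pos i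
    have h6 : bagTau X ^ 6 = ((1 + X) ^ 3)⁻¹ := by
      rw [show 6 = 2 * 3 from rfl, pow_mul, bagTau_sq hX, inv_pow]
    have hp : 0 < ((1 + X) ^ 3)⁻¹ := by positivity
    rw [abs_mul, h6, abs_of_pos hp, mul_comm]
    refine mul_le_mul_of_nonneg_right ?_ hp.le
    rw [← div_eq_mul_inv, le_div_iff₀ (by positivity)]
    exact this

theorem integral_Ioi_of_hasDerivAt_of_tendsto_of_tendsto {f f' : ℝ → ℝ} {l m : ℝ}
    (hf : ∀ x ∈ Ioi (0 : ℝ), HasDerivAt f (f' x) x) (hi : IntegrableOn f' (Ioi 0))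
    (hl : Tendsto f (𝓝[>] 0) (𝓝 l)) (hm : Tendsto f atTop (𝓝 m)) :
    ∫ x in Ioi (0 : ℝ), f' x = m - l := by
  have := integral_Ioi_deriv_mul_eq_sub (A := ℝ) (a := 0) (u := fun _ => (1 : ℝ)) (u' := fun _ => 0)
    (v := f) (v' := f') (fun x _ => hasDerivAt_const x 1) hf
    (hi.congr_fun (fun x _ => by simp) measurableSet_Ioi)
    (a' := l) (b' := m) (hl.congr fun x => by simp) (hm.congr fun x => by simp)
  simpa using this

/-- A twice differentiable function on the half line whose derivatives up to order two decay
like those of `(1 + X)⁻¹`. -/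
structure TwiceDecay (F F₁ F₂ : ℝ → ℝ) : Prop where
  hasDerivAt : ∀ X, 0 < X → HasDerivAt F (F₁ X) X
  hasDerivAt₁ : ∀ X, 0 < X → HasDerivAt F₁ (F₂ X) X
  bound : ∃ C, ∀ X, 0 < X → |F X| ≤ C * (1 + X)⁻¹
  bound₁ : ∃ C, ∀ X, 0 < X → |F₁ X| ≤ C * ((1 + X) ^ 2)⁻¹
  cubeDecay : ∃ C, CubeDecay C F₂

theorem SymbolBound.exists_bound_comp_bagTau {n k : ℕ} {f : ℕ → ℝ → ℝ} (h : SymbolBound n k f)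
    (i m : ℕ) : ∃ C, ∀ X, 0 < X → |bagTau X ^ (2 * m) * f i (bagTau X)| ≤ C * ((1 + X) ^ m)⁻¹ := by
  obtain ⟨C, hC⟩ := h.bound
  refine ⟨C * (bagMu i ^ k)⁻¹, fun X hX => ?_⟩
  have := hC i _ (bagTau_mem_Ioc hX)
  have hμ := bagMu_pos i
  have hp : 0 < ((1 + X) ^ m)⁻¹ := by positivity
  rw [abs_mul, pow_mul, bagTau_sq hX, inv_pow, abs_of_pos hp, mul_comm]
  refine mul_le_mul_of_nonneg_right ?_ hp.le
  rw [← div_eq_mul_inv, le_div_iff₀ (by positivity)]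
  exact this

theorem SymbolBound.exists_twiceDecay {n k : ℕ} {f : ℕ → ℝ → ℝ} (h : SymbolBound (n + 3) k f) :
    ∃ F₁ F₂ : ℕ → ℝ → ℝ, (∀ i, TwiceDecay (fun X => bagTau X ^ 2 * f i (bagTau X)) (F₁ i) (F₂ i)) ∧
      ∃ C, ∀ i, CubeDecay (C * (bagMu i ^ k)⁻¹) (F₂ i) := by
  obtain ⟨f₁, h₁, hd₁⟩ := h.exists_deriv_comp_bagTau 2
  obtain ⟨f₂, h₂, hd₂⟩ := h₁.exists_deriv_comp_bagTau 4
  obtain ⟨C, hC⟩ := h₂.exists_cubeDecay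
  refine ⟨fun i X => bagTau X ^ 4 * f₁ i (bagTau X), fun i X => bagTau X ^ 6 * f₂ i (bagTau X),
    fun i => ⟨hd₁ i, hd₂ i, ?_, ?_, _, hC i⟩, C, hC⟩
  · simpa using h.exists_bound_comp_bagTau i 1
  · exact h₁.exists_bound_comp_bagTau i 2

namespace TwiceDecay

variable {F F₁ F₂ G G₁ G₂ : ℝ → ℝ}

theorem add (hF : TwiceDecay F F₁ F₂) (hG : TwiceDecay G G₁ G₂) :
    TwiceDecay (fun X => F X + G X) (fun X => F₁ X + G₁ X) (fun X => F₂ X + G₂ X) := by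
  obtain ⟨A, hA⟩ := hF.bound
  obtain ⟨A', hA'⟩ := hG.bound
  obtain ⟨B, hB⟩ := hF.bound₁
  obtain ⟨B', hB'⟩ := hG.bound₁
  obtain ⟨C, hC⟩ := hF.cubeDecay
  obtain ⟨C', hC'⟩ := hG.cubeDecay
  refine ⟨fun X hX => (hF.hasDerivAt X hX).add (hG.hasDerivAt X hX),
    fun X hX => (hF.hasDerivAt₁ X hX).add (hG.hasDerivAt₁ X hX), ⟨A + A', fun X hX => ?_⟩,
    ⟨B + B', fun X hX => ?_⟩, ⟨C + C', hC.1.add hC'.1, fun X hX => ?_⟩⟩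
  · exact (abs_add_le _ _).trans (by linarith [hA X hX, hA' X hX])
  · exact (abs_add_le _ _).trans (by linarith [hB X hX, hB' X hX])
  · exact (abs_add_le _ _).trans (by linarith [hC.2 X hX, hC'.2 X hX])

theorem const_mul (c : ℝ) (hF : TwiceDecay F F₁ F₂) :
    TwiceDecay (fun X => c * F X) (fun X => c * F₁ X) (fun X => c * F₂ X) := by
  obtain ⟨A, hA⟩ := hF.bound
  obtain ⟨B, hB⟩ := hF.bound₁
  obtain ⟨C, hC⟩ := hF.cubeDecay
  refine ⟨fun X hX => (hF.hasDerivAt X hX).const_mul c,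
    fun X hX => (hF.hasDerivAt₁ X hX).const_mul c, ⟨|c| * A, fun X hX => ?_⟩,
    ⟨|c| * B, fun X hX => ?_⟩, ⟨|c| * C, hC.1.const_smul c, fun X hX => ?_⟩⟩
  all_goals rw [abs_mul, mul_assoc]
  · exact mul_le_mul_of_nonneg_left (hA X hX) (abs_nonneg c)
  · exact mul_le_mul_of_nonneg_left (hB X hX) (abs_nonneg c)
  · exact mul_le_mul_of_nonneg_left (hC.2 X hX) (abs_nonneg c)

theorem mellin_congr {b : ℂ} (h : ∀ X, 0 < X → F X = G X) :
    mellin (fun X => (F X : ℂ)) b = mellin (fun X => (G X : ℂ)) b :=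
  setIntegral_congr_fun measurableSet_Ioi fun X hX => by simp only [h X hX]

theorem mellin_five_halves (hF : TwiceDecay F F₁ F₂) {Θ : ℝ → ℝ} {l m : ℝ}
    (hΘ : ∀ X, 0 < X → HasDerivAt Θ (F X / (2 * √X)) X)
    (hl : Tendsto Θ (𝓝[>] 0) (𝓝 l)) (hm : Tendsto Θ atTop (𝓝 m)) :
    mellin (fun X => (F₂ X : ℂ)) (5 / 2) = ((3 / 2 * (m - l) : ℝ) : ℂ) := by
  obtain ⟨A, hA⟩ := hF.bound
  obtain ⟨B, hB⟩ := hF.bound₁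
  obtain ⟨C, hC⟩ := hF.cubeDecay
  have e : ∀ X ∈ Ioi (0 : ℝ), (X : ℂ) ^ ((5 / 2 : ℂ) - 1) • (F₂ X : ℂ) =
      ((X * √X * F₂ X : ℝ) : ℂ) := by
    intro X hX
    have hX : 0 < X := hX
    have : (X : ℂ) ^ ((5 / 2 : ℂ) - 1) = ((X ^ (3 / 2 : ℝ) : ℝ) : ℂ) := by
      rw [Complex.ofReal_cpow hX.le]; norm_num
    rw [this, smul_eq_mul, ← Complex.ofReal_mul, show (3 / 2 : ℝ) = 1 + 1 / 2 by norm_num,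
      Real.rpow_add hX, Real.rpow_one, ← Real.sqrt_eq_rpow]
  have hconv := hC.mellinConvergent (b := 5 / 2) (by norm_num) (by norm_num)
  have hinteg : IntegrableOn (fun X : ℝ => X * √X * F₂ X) (Ioi 0) := by
    have := (IntegrableOn.congr_fun hconv e measurableSet_Ioi).re
    rw [IntegrableOn]
    simpa using this
  rw [mellin, setIntegral_congr_fun measurableSet_Ioi e, integral_complex_ofReal]
  congr 1
  have hsq : Tendsto (fun X : ℝ => √X) (𝓝[>] 0) (𝓝 0) := by
    simpa using (Real.continuous_sqrt.tendsto 0).mono_left nhdsWithin_le_nhds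
  have hid : Tendsto (fun X : ℝ => X) (𝓝[>] 0) (𝓝 0) :=
    tendsto_id.mono_left nhdsWithin_le_nhds
  have hA0 : 0 ≤ A := by
    have := (abs_nonneg _).trans (hA 1 one_pos); norm_num at this; linarith
  have hB0 : 0 ≤ B := by
    have := (abs_nonneg _).trans (hB 1 one_pos); norm_num at this; linarith
  have hinv : Tendsto (fun X : ℝ => (√X)⁻¹) atTop (𝓝 0) :=
    tendsto_inv_atTop_zero.comp Real.tendsto_sqrt_atTop
  have hF0 : Tendsto (fun X => √X * F X) (𝓝[>] 0) (𝓝 0) := by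
    refine squeeze_zero_norm' (a := fun X => √X * A) ?_ (by simpa using hsq.mul_const A)
    filter_upwards [self_mem_nhdsWithin] with X hX
    have hX : 0 < X := hX
    rw [norm_mul, Real.norm_eq_abs, Real.norm_eq_abs, abs_of_nonneg (Real.sqrt_nonneg _)]
    refine mul_le_mul_of_nonneg_left ((hA X hX).trans ?_) (Real.sqrt_nonneg _)
    exact mul_le_of_le_one_right hA0 (inv_le_one_of_one_le₀ (by linarith))
  have hF1 : Tendsto (fun X => X * √X * F₁ X) (𝓝[>] 0) (𝓝 0) := by
    refine squeeze_zero_norm' (a := fun X => X * √X * B) ?_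
      (by simpa using (hid.mul hsq).mul_const B)
    filter_upwards [self_mem_nhdsWithin] with X hX
    have hX : 0 < X := hX
    rw [norm_mul, Real.norm_eq_abs, Real.norm_eq_abs, abs_of_nonneg (by positivity)]
    refine mul_le_mul_of_nonneg_left ((hB X hX).trans ?_) (by positivity)
    exact mul_le_of_le_one_right hB0 (inv_le_one_of_one_le₀ (one_le_pow₀ (by linarith)))
  have hG0 : Tendsto (fun X => √X * F X) atTop (𝓝 0) := by
    refine squeeze_zero_norm' (a := fun X => A * (√X)⁻¹) ?_ (by simpa using hinv.const_mul A)
    filter_upwards [eventually_gt_atTop 0] with X hX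
    have hs := Real.sqrt_pos.2 hX
    rw [norm_mul, Real.norm_eq_abs, Real.norm_eq_abs, abs_of_nonneg (Real.sqrt_nonneg _)]
    calc √X * |F X| ≤ √X * (A * X⁻¹) := by
          refine mul_le_mul_of_nonneg_left ((hA X hX).trans ?_) hs.le
          refine mul_le_mul_of_nonneg_left ?_ hA0
          gcongr; linarith
      _ = A * (√X)⁻¹ := by
          nth_rewrite 2 [← Real.mul_self_sqrt hX.le]
          field_simp
  have hG1 : Tendsto (fun X => X * √X * F₁ X) atTop (𝓝 0) := by
    refine squeeze_zero_norm' (a := fun X => B * (√X)⁻¹) ?_ (by simpa using hinv.const_mul B)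
    filter_upwards [eventually_gt_atTop 0] with X hX
    have hs := Real.sqrt_pos.2 hX
    rw [norm_mul, Real.norm_eq_abs, Real.norm_eq_abs, abs_of_nonneg (by positivity)]
    calc X * √X * |F₁ X| ≤ X * √X * (B * (X ^ 2)⁻¹) := by
          refine mul_le_mul_of_nonneg_left ((hB X hX).trans ?_) (by positivity)
          refine mul_le_mul_of_nonneg_left ?_ hB0
          gcongr; linarith
      _ = B * (√X)⁻¹ := by
          have h2 : X = √X ^ 2 := (Real.sq_sqrt hX.le).symm
          set y := √X
          rw [h2]
          field_simp
  have hlim0 := ((hF1.sub (hF0.const_mul (3 / 2))).add (hl.const_mul (3 / 2)))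
  have hlim1 := ((hG1.sub (hG0.const_mul (3 / 2))).add (hm.const_mul (3 / 2)))
  rw [integral_Ioi_of_hasDerivAt_of_tendsto_of_tendsto (fun X hX => ?_) hinteg hlim0 hlim1]
  · ring
  have hX : 0 < X := hX
  have hs := Real.sqrt_pos.2 hX
  have hd := ((((hasDerivAt_id X).mul (Real.hasDerivAt_sqrt hX.ne')).mul (hF.hasDerivAt₁ X hX)).sub
    (((Real.hasDerivAt_sqrt hX.ne').mul (hF.hasDerivAt X hX)).const_mul (3 / 2))).add
    ((hΘ X hX).const_mul (3 / 2))
  refine hd.congr_deriv ?_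
  simp only [id, Pi.mul_apply]
  have h2 : X = √X ^ 2 := (Real.sq_sqrt hX.le).symm
  generalize F₁ X = p, F₂ X = q, F X = r
  set y := √X
  rw [h2]
  field_simp
  ring

theorem mellin_eq_of_eq_add {F₃ : ℝ → ℝ} {C : ℝ} (hF : TwiceDecay F F₁ F₂)
    (hF₃ : ∀ X, 0 < X → HasDerivAt F₂ (F₃ X) X) (hC₃ : CubeDecay C fun X => X * F₃ X)
    (hG : TwiceDecay G G₁ G₂) (h : ∀ X, 0 < X → G X = F X + 2 * X * F₁ X) {b : ℂ}
    (h0 : 0 < b.re) (h3 : b.re < 3) :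
    mellin (fun X => (G₂ X : ℂ)) b = (5 - 2 * b) * mellin (fun X => (F₂ X : ℂ)) b := by
  obtain ⟨D, hD⟩ := hF.cubeDecay
  have h1 : ∀ X, 0 < X → G₁ X = 3 * F₁ X + 2 * X * F₂ X := fun X hX => by
    have hd := (hF.hasDerivAt X hX).add (((hasDerivAt_id X).const_mul 2).mul (hF.hasDerivAt₁ X hX))
    rw [(hG.hasDerivAt X hX).unique (hd.congr_of_eventuallyEq ((eventually_gt_nhds hX).mono h))]
    simp only [id]; ring
  have h2 : ∀ X, 0 < X → G₂ X = 5 * F₂ X + 2 * (X * F₃ X) := fun X hX => by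
    have hd := ((hF.hasDerivAt₁ X hX).const_mul 3).add
      (((hasDerivAt_id X).const_mul 2).mul (hF₃ X hX))
    rw [(hG.hasDerivAt₁ X hX).unique (hd.congr_of_eventuallyEq ((eventually_gt_nhds hX).mono h1))]
    simp only [id]; ring
  have hb : b ≠ 0 := fun hb => by simp [hb] at h0
  have hpow : ∀ X ∈ Ioi (0 : ℝ), (X : ℂ) ^ (b - 1) * X = (X : ℂ) ^ b := fun X hX => by
    have hX : (X : ℂ) ≠ 0 := Complex.ofReal_ne_zero.2 (ne_of_gt hX)
    rw [Complex.cpow_sub _ _ hX, Complex.cpow_one, div_mul_cancel₀ _ hX]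
  have c2 := hD.mellinConvergent h0 h3
  have c3 := hC₃.mellinConvergent h0 h3
  have e3 : ∀ X ∈ Ioi (0 : ℝ), (X : ℂ) ^ (b - 1) • ((X * F₃ X : ℝ) : ℂ) = (X : ℂ) ^ b * F₃ X :=
    fun X hX => by rw [← hpow X hX]; push_cast; rw [smul_eq_mul]; ring
  have lim : ∀ l : Filter ℝ, (∀ᶠ X in l, 0 < X) →
      Tendsto (fun X : ℝ => X ^ b.re * ((1 + X) ^ 3)⁻¹) l (𝓝 0) →
      Tendsto ((fun X : ℝ => (X : ℂ) ^ b) * fun X => (F₂ X : ℂ)) l (𝓝 0) := by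
    intro l hl hlim
    refine squeeze_zero_norm' (a := fun X => D * (X ^ b.re * ((1 + X) ^ 3)⁻¹)) ?_
      (by simpa using hlim.const_mul D)
    filter_upwards [hl] with X hX
    rw [Pi.mul_apply, norm_mul, Complex.norm_cpow_eq_rpow_re_of_pos hX, Complex.norm_real,
      Real.norm_eq_abs]
    have hp : 0 < X ^ b.re := Real.rpow_pos_of_pos hX _
    calc X ^ b.re * |F₂ X| ≤ X ^ b.re * (D * ((1 + X) ^ 3)⁻¹) :=
          mul_le_mul_of_nonneg_left (hD.2 X hX) hp.le
      _ = _ := by ring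
  have l0 : Tendsto (fun X : ℝ => X ^ b.re * ((1 + X) ^ 3)⁻¹) (𝓝[>] 0) (𝓝 0) := by
    have : ContinuousAt (fun X : ℝ => X ^ b.re * ((1 + X) ^ 3)⁻¹) 0 :=
      (Real.continuousAt_rpow_const _ _ (Or.inr h0.le)).mul
        (ContinuousAt.inv₀ (by fun_prop) (by norm_num))
    have := this.tendsto.mono_left (nhdsWithin_le_nhds (s := Ioi 0))
    simpa [Real.zero_rpow h0.ne'] using this
  have l1 : Tendsto (fun X : ℝ => X ^ b.re * ((1 + X) ^ 3)⁻¹) atTop (𝓝 0) := by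
    have ht := tendsto_rpow_neg_atTop (y := 3 - b.re) (by linarith)
    refine squeeze_zero' ?_ ?_ ht
    · filter_upwards [eventually_gt_atTop 0] with X hX
      positivity
    · filter_upwards [eventually_gt_atTop 0] with X hX
      have : X ^ (-(3 - b.re)) = X ^ b.re * (X ^ 3)⁻¹ := by
        rw [neg_sub, Real.rpow_sub hX, div_eq_mul_inv]; norm_cast
      rw [this]
      refine mul_le_mul_of_nonneg_left ?_ (by positivity)
      gcongr; linarith
  have hibp := integral_Ioi_mul_deriv_eq_deriv_mul (A := ℂ) (a := 0) (u := fun X : ℝ => (X : ℂ) ^ b)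
    (u' := fun X : ℝ => b * (X : ℂ) ^ (b - 1)) (v := fun X => (F₂ X : ℂ)) (v' := fun X => (F₃ X : ℂ))
    (fun X hX => hasDerivAt_ofReal_cpow_const (ne_of_gt hX) hb)
    (fun X hX => (hF₃ X hX).ofReal_comp)
    (IntegrableOn.congr_fun c3 e3 measurableSet_Ioi)
    (IntegrableOn.congr_fun (c2.const_mul b) (fun X _ => by
      simp only [Pi.mul_apply, smul_eq_mul]; ring) measurableSet_Ioi)
    (lim _ self_mem_nhdsWithin l0) (lim _ (eventually_gt_atTop 0) l1)
  have hmel : mellin (fun X => ((X * F₃ X : ℝ) : ℂ)) b = -(b * mellin (fun X => (F₂ X : ℂ)) b) := by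
    rw [mellin, setIntegral_congr_fun measurableSet_Ioi e3, hibp, mellin, ← integral_const_mul]
    simp only [sub_zero, zero_sub, smul_eq_mul, mul_assoc]
  have hsum := (hasMellin_add (hasMellin_const_smul c2 (5 : ℂ)).1
    (hasMellin_const_smul c3 (2 : ℂ)).1).2
  rw [mellin_congr h2]
  have hcast : (fun X => ((5 * F₂ X + 2 * (X * F₃ X) : ℝ) : ℂ)) =
      fun X => (5 : ℂ) • (F₂ X : ℂ) + (2 : ℂ) • ((X * F₃ X : ℝ) : ℂ) := by
    funext X; push_cast; simp only [smul_eq_mul]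
  rw [hcast, hsum, mellin_const_smul, mellin_const_smul, hmel, smul_eq_mul, smul_eq_mul]
  ring

end TwiceDecay

theorem exists_mellin_eq_of_eq_sub {φ φ' h : ℝ → ℝ} (hφ : SymbolBound 5 0 fun _ => φ)
    (hh : SymbolBound 5 0 fun _ => h) (hd : ∀ τ ∈ Ioc (0 : ℝ) 1, HasDerivAt φ (φ' τ) τ)
    (heq : ∀ τ ∈ Ioc (0 : ℝ) 1, h τ = φ τ - (1 - τ ^ 2) * (2 * φ τ + τ * φ' τ)) :
    ∃ Φ₁ Φ₂ H₁ H₂, TwiceDecay (fun X => bagTau X ^ 2 * φ (bagTau X)) Φ₁ Φ₂ ∧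
      TwiceDecay (fun X => bagTau X ^ 2 * h (bagTau X)) H₁ H₂ ∧ ∀ b : ℂ, 0 < b.re → b.re < 3 →
        mellin (fun X => (H₂ X : ℂ)) b = (5 - 2 * b) * mellin (fun X => (Φ₂ X : ℂ)) b := by
  obtain ⟨f₁, h₁, hd₁⟩ := hφ.exists_deriv_comp_bagTau 2
  obtain ⟨f₂, h₂, hd₂⟩ := h₁.exists_deriv_comp_bagTau 4
  obtain ⟨f₃, h₃, hd₃⟩ := h₂.exists_deriv_comp_bagTau 6
  obtain ⟨H₁, H₂, hH, -⟩ := hh.exists_twiceDecay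
  obtain ⟨C, hC⟩ := h₂.exists_cubeDecay
  obtain ⟨C₃, hC₃⟩ := (h₃.coeff_mul (q := fun τ => 1 - τ ^ 2) (by fun_prop)).exists_cubeDecay
  have hΦ : TwiceDecay (fun X => bagTau X ^ 2 * φ (bagTau X))
      (fun X => bagTau X ^ 4 * f₁ 0 (bagTau X)) (fun X => bagTau X ^ 6 * f₂ 0 (bagTau X)) :=
    ⟨hd₁ 0, hd₂ 0, by simpa using hφ.exists_bound_comp_bagTau 0 1, h₁.exists_bound_comp_bagTau 0 2,
      _, hC 0⟩
  refine ⟨_, _, H₁ 0, H₂ 0, hΦ, hH 0, fun b hb hb3 => ?_⟩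
  have hX₃ : ∀ X, 0 < X → bagTau X ^ 6 * ((1 - bagTau X ^ 2) * f₃ 0 (bagTau X)) =
      X * (bagTau X ^ 8 * f₃ 0 (bagTau X)) := fun X hX => by
    have h0 := (bagTau_mem hX).1.ne'
    have e : 1 - bagTau X ^ 2 = X * bagTau X ^ 2 := by
      nth_rewrite 2 [← bagTau_X hX]; field_simp
    rw [e]; ring
  refine TwiceDecay.mellin_eq_of_eq_add hΦ (hd₃ 0)
    ⟨(hC₃ 0).1.congr fun X hX => (hX₃ X hX).symm, fun X hX =>
      (congrArg abs (hX₃ X hX)).symm.trans_le ((hC₃ 0).2 X hX)⟩ (hH 0)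
    (fun X hX => ?_) hb hb3
  have hm := bagTau_mem_Ioc hX
  have ht := hasDerivAt_bagTau hX
  have e := (hd₁ 0 X hX).unique ((ht.fun_pow 2).mul ((hd _ hm).comp X ht))
  have h0 := hm.1.ne'
  have eX : X * bagTau X ^ 2 = 1 - bagTau X ^ 2 := by
    nth_rewrite 1 [← bagTau_X hX]; field_simp
  push_cast at e
  simp only [heq _ hm]
  rw [show bagTau X ^ 4 * f₁ 0 (bagTau X) = _ from e]
  linear_combination (bagTau X ^ 2 * (2 * φ (bagTau X) + bagTau X * φ' (bagTau X))) * eX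

section

variable (a : ℝ)

/-- Primitives of the coefficients of the expansion of `bagh`. -/
def bagK₁ (τ : ℝ) : ℝ := -(a / 2) * (τ * (bagd a τ)⁻¹)

def bagK₂ (τ : ℝ) : ℝ := -a * (τ * bagE₂ τ * (bagd a τ)⁻¹ +
  a ^ 2 * (1 - τ) * τ ^ 3 / 4 * (bagd a τ)⁻¹ ^ 2)

def bagK₃ (τ : ℝ) : ℝ := -a * (τ * bagE₃ τ * (bagd a τ)⁻¹ +
  a ^ 2 * (1 - τ) * τ ^ 3 * bagE₂ τ * (bagd a τ)⁻¹ ^ 2 +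
  (a ^ 4 * (1 - τ) ^ 2 * τ ^ 5 / 8 - a ^ 2 * (1 - τ ^ 2) * τ ^ 5 / 24) * (bagd a τ)⁻¹ ^ 3)

variable (n : ℕ)

theorem symbolBound_bagK₁ : SymbolBound n 0 fun _ => bagK₁ a :=
  ((symbolBound_bagd_inv n a).coeff_mul (q := fun τ => τ) (by fun_prop)).const_mul _

theorem symbolBound_bagK₂ : SymbolBound n 0 fun _ => bagK₂ a := by
  have h := symbolBound_bagd_inv n a
  have := contDiff_bagE₂
  refine (((h.coeff_mul (q := fun τ => τ * bagE₂ τ) (by fun_prop)).add ((h.mul h).coeff_mul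
    (q := fun τ => a ^ 2 * (1 - τ) * τ ^ 3 / 4) (by fun_prop))).const_mul (-a)).congr fun i τ _ => ?_
  rw [bagK₂]; ring

theorem symbolBound_bagK₃ : SymbolBound n 0 fun _ => bagK₃ a := by
  have h := symbolBound_bagd_inv n a
  have := contDiff_bagE₂
  have := contDiff_bagE₃
  refine ((((h.coeff_mul (q := fun τ => τ * bagE₃ τ) (by fun_prop)).add ((h.mul h).coeff_mul
    (q := fun τ => a ^ 2 * (1 - τ) * τ ^ 3 * bagE₂ τ) (by fun_prop))).add ((h.mul (h.mul h)).coeff_mul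
    (q := fun τ => a ^ 4 * (1 - τ) ^ 2 * τ ^ 5 / 8 - a ^ 2 * (1 - τ ^ 2) * τ ^ 5 / 24)
    (by fun_prop))).const_mul (-a)).congr fun i τ _ => ?_
  rw [bagK₃]; ring

variable {a}

theorem hasDerivAt_bagd_inv {τ : ℝ} (hτ : τ ∈ Ioc (0 : ℝ) 1) :
    HasDerivAt (fun τ => (bagd a τ)⁻¹) (-(1 - a ^ 2) * (bagd a τ)⁻¹ ^ 2) τ := by
  have h : HasDerivAt (bagd a) (1 - a ^ 2) τ := by
    refine (((hasDerivAt_id τ).const_add 1).add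
      (((hasDerivAt_id τ).const_sub 1).const_mul (a ^ 2))).congr_deriv ?_
    ring
  refine (h.inv (by linarith [one_le_bagd a hτ])).congr_deriv ?_
  rw [div_eq_mul_inv, inv_pow]

theorem exists_mellin_bagh₁ : ∃ Φ₁ Φ₂ H₁ H₂,
    TwiceDecay (fun X => bagTau X ^ 2 * bagK₁ a (bagTau X)) Φ₁ Φ₂ ∧
      TwiceDecay (fun X => bagTau X ^ 2 * bagh₁ a (bagTau X)) H₁ H₂ ∧ ∀ b : ℂ, 0 < b.re → b.re < 3 →
        mellin (fun X => (H₂ X : ℂ)) b = (5 - 2 * b) * mellin (fun X => (Φ₂ X : ℂ)) b := by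
  refine exists_mellin_eq_of_eq_sub (symbolBound_bagK₁ a 5) (symbolBound_bagh₁ 5 a)
    (fun τ hτ => ((hasDerivAt_id τ).mul (hasDerivAt_bagd_inv hτ)).const_mul (-(a / 2)))
    fun τ hτ => ?_
  have hd := one_le_bagd a hτ
  simp only [id, bagh₁, bagh₀, bagK₁, bagN₁, bagD₁]
  have hd0 : bagd a τ ≠ 0 := by linarith
  field_simp
  rw [bagd]
  ring

theorem exists_mellin_bagh₂ : ∃ Φ₁ Φ₂ H₁ H₂,
    TwiceDecay (fun X => bagTau X ^ 2 * bagK₂ a (bagTau X)) Φ₁ Φ₂ ∧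
      TwiceDecay (fun X => bagTau X ^ 2 * bagh₂ a (bagTau X)) H₁ H₂ ∧ ∀ b : ℂ, 0 < b.re → b.re < 3 →
        mellin (fun X => (H₂ X : ℂ)) b = (5 - 2 * b) * mellin (fun X => (Φ₂ X : ℂ)) b := by
  refine exists_mellin_eq_of_eq_sub (symbolBound_bagK₂ a 5) (symbolBound_bagh₂ 5 a)
    (fun τ hτ => ((((hasDerivAt_id τ).mul (hasDerivAt_bagE₂ τ)).mul (hasDerivAt_bagd_inv hτ)).add
      ((((((hasDerivAt_id τ).const_sub 1).const_mul (a ^ 2)).mul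
        ((hasDerivAt_id τ).fun_pow 3)).div_const 4).mul
        ((hasDerivAt_bagd_inv hτ).fun_pow 2))).const_mul (-a))
    fun τ hτ => ?_
  have hd := one_le_bagd a hτ
  simp only [id, bagh₂, bagh₁, bagh₀, bagK₂, bagN₂, bagN₁, bagD₂, bagD₁, bagE₂, Pi.mul_apply]
  have hd0 : bagd a τ ≠ 0 := by linarith
  push_cast
  field_simp
  rw [bagd]
  ring

theorem exists_mellin_bagh₃ : ∃ Φ₁ Φ₂ H₁ H₂,
    TwiceDecay (fun X => bagTau X ^ 2 * bagK₃ a (bagTau X)) Φ₁ Φ₂ ∧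
      TwiceDecay (fun X => bagTau X ^ 2 * bagh₃ a (bagTau X)) H₁ H₂ ∧ ∀ b : ℂ, 0 < b.re → b.re < 3 →
        mellin (fun X => (H₂ X : ℂ)) b = (5 - 2 * b) * mellin (fun X => (Φ₂ X : ℂ)) b := by
  refine exists_mellin_eq_of_eq_sub (symbolBound_bagK₃ a 5) (symbolBound_bagh₃ 5 a)
    (fun τ hτ => (((((hasDerivAt_id τ).mul (hasDerivAt_bagE₃ τ)).mul (hasDerivAt_bagd_inv hτ)).add
      ((((((hasDerivAt_id τ).const_sub 1).const_mul (a ^ 2)).mul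
        ((hasDerivAt_id τ).fun_pow 3)).mul (hasDerivAt_bagE₂ τ)).mul
        ((hasDerivAt_bagd_inv hτ).fun_pow 2))).add
      (((((((hasDerivAt_id τ).const_sub 1).fun_pow 2).const_mul (a ^ 4)).mul
        ((hasDerivAt_id τ).fun_pow 5)).div_const 8 |>.sub
        ((((((hasDerivAt_id τ).fun_pow 2).const_sub 1).const_mul (a ^ 2)).mul
        ((hasDerivAt_id τ).fun_pow 5)).div_const 24)).mul
        ((hasDerivAt_bagd_inv hτ).fun_pow 3))).const_mul (-a))
    fun τ hτ => ?_
  have hd := one_le_bagd a hτ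
  simp only [id, bagh₃, bagh₂, bagh₁, bagh₀, bagK₃, bagN₃, bagN₂, bagN₁, bagD₃, bagD₂, bagD₁, bagE₃,
    bagE₂, Pi.mul_apply, Pi.sub_apply]
  have hd0 : bagd a τ ≠ 0 := by linarith
  push_cast
  field_simp
  rw [bagd]
  ring

end

theorem sqrt_mul_bagTau {X : ℝ} (hX : 0 < X) : √X * bagTau X = √(1 - bagTau X ^ 2) := by
  have hm := bagTau_mem hX
  have eX : X * bagTau X ^ 2 = 1 - bagTau X ^ 2 := by
    have := hm.1.ne'
    nth_rewrite 1 [← bagTau_X hX]; field_simp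
  rw [← eX, Real.sqrt_mul hX.le, Real.sqrt_sq hm.1.le]

theorem hasDerivAt_arctan_besselG (a : ℝ) (i : ℕ) {X : ℝ} (hX : 0 < X) :
    HasDerivAt (fun X => Real.arctan (a * (√X * (bagMu i * besselG (i + 1) (bagMu i ^ 2 * X)))))
      (bagMu i * besselH (i + 1) a (bagMu i ^ 2 * X) / (2 * √X)) X := by
  have hμ := bagMu_pos i
  have hs := Real.sqrt_pos.2 hX
  obtain ⟨d, hd, he⟩ := hasDerivAt_besselG (i + 1) (x := bagMu i ^ 2 * X) (by positivity)
  have h := ((Real.hasDerivAt_sqrt hX.ne').mul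
    ((hd.comp X ((hasDerivAt_id X).const_mul (bagMu i ^ 2))).const_mul (bagMu i))).const_mul a
  refine h.arctan.congr_deriv ?_
  have hi : (((i + 1 : ℕ) : ℝ)) = bagMu i - 1 / 2 := by rw [bagMu]; push_cast; ring
  rw [hi] at he
  simp only [Pi.mul_apply, Function.comp, besselH, hi]
  generalize besselG (i + 1) (bagMu i ^ 2 * X) = G at *
  have h2 : X = √X ^ 2 := (Real.sq_sqrt hX.le).symm
  set y := √X
  rw [h2] at he ⊢
  have hD : 1 + a ^ 2 * (bagMu i ^ 2 * y ^ 2) * G ^ 2 ≠ 0 := by positivity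
  have hD' : 1 + (a * (y * (bagMu i * G))) ^ 2 ≠ 0 := by positivity
  field_simp
  linear_combination a * he

theorem hasDerivAt_arctan_bagTau (a : ℝ) {X : ℝ} (hX : 0 < X) :
    HasDerivAt (fun X => Real.arctan (a * (√X * (bagTau X / (1 + bagTau X)))))
      (bagTau X ^ 2 * bagh₀ a (bagTau X) / (2 * √X)) X := by
  have hs := Real.sqrt_pos.2 hX
  have hm := bagTau_mem hX
  have ht := hasDerivAt_bagTau hX
  have hd := one_le_bagd a (bagTau_mem_Ioc hX)
  have h1 : 1 + bagTau X ≠ 0 := by linarith [hm.1]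
  have h := ((Real.hasDerivAt_sqrt hX.ne').mul (ht.div (ht.const_add 1) h1)).const_mul a
  refine h.arctan.congr_deriv ?_
  have eX : X * bagTau X ^ 2 = 1 - bagTau X ^ 2 := by
    have := hm.1.ne'
    nth_rewrite 1 [← bagTau_X hX]; field_simp
  simp only [Pi.mul_apply, Pi.div_apply, bagh₀]
  have h0 := hm.1
  generalize bagTau X = t at *
  have h2 : X = √X ^ 2 := (Real.sq_sqrt hX.le).symm
  set y := √X
  rw [h2] at eX
  have hden : 1 + (a * (y * (t / (1 + t)))) ^ 2 = bagd a t / (1 + t) := by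
    rw [bagd]
    field_simp
    linear_combination a ^ 2 * eX
  rw [hden]
  have hd0 : bagd a t ≠ 0 := by linarith
  field_simp
  linear_combination (-a) * eX

theorem tendsto_sqrt_one_sub_bagTau_zero :
    Tendsto (fun X => √(1 - bagTau X ^ 2)) (𝓝[>] 0) (𝓝 0) := by
  have := ((tendsto_bagTau_zero.pow 2).const_sub 1).sqrt
  simpa using this

theorem tendsto_sqrt_one_sub_bagTau_atTop :
    Tendsto (fun X => √(1 - bagTau X ^ 2)) atTop (𝓝 1) := by
  have := ((tendsto_bagTau_atTop.pow 2).const_sub 1).sqrt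
  simpa using this

theorem tendsto_arctan_bagTau_zero (a : ℝ) :
    Tendsto (fun X => Real.arctan (a * (√X * (bagTau X / (1 + bagTau X))))) (𝓝[>] 0) (𝓝 0) := by
  have h := (tendsto_sqrt_one_sub_bagTau_zero.div (tendsto_bagTau_zero.const_add 1)
    (by norm_num)).const_mul a
  have h' := (Real.continuous_arctan.tendsto _).comp h
  simp only [zero_div, mul_zero, Real.arctan_zero] at h'
  refine h'.congr' ?_
  filter_upwards [self_mem_nhdsWithin] with X hX
  simp only [Function.comp, ← sqrt_mul_bagTau hX, Pi.div_apply, mul_div_assoc]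

theorem tendsto_arctan_bagTau_atTop (a : ℝ) :
    Tendsto (fun X => Real.arctan (a * (√X * (bagTau X / (1 + bagTau X))))) atTop
      (𝓝 (Real.arctan a)) := by
  have h := (tendsto_sqrt_one_sub_bagTau_atTop.div (tendsto_bagTau_atTop.const_add 1)
    (by norm_num)).const_mul a
  have h' := (Real.continuous_arctan.tendsto _).comp h
  simp only [add_zero, div_one, mul_one] at h'
  refine h'.congr' ?_
  filter_upwards [eventually_gt_atTop 0] with X hX
  simp only [Function.comp, ← sqrt_mul_bagTau hX, Pi.div_apply, mul_div_assoc]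

theorem sqrt_mul_besselG (i : ℕ) {X : ℝ} (hX : 0 < X) :
    √X * (bagMu i * besselG (i + 1) (bagMu i ^ 2 * X)) =
      √(1 - bagTau X ^ 2) * (1 - bagTau X ^ 2 * bagE i (bagTau X)) / (1 + bagTau X) := by
  have h : bagMu i * besselG (i + 1) (bagMu i ^ 2 * X) = bagG i (bagTau X) := by
    rw [bagG, bagTau_X hX]
  rw [h, bagG_eq i (bagTau_mem_Ioc hX), ← sqrt_mul_bagTau hX]
  ring

theorem tendsto_arctan_besselG_zero (a : ℝ) (i : ℕ) :
    Tendsto (fun X => Real.arctan (a * (√X * (bagMu i * besselG (i + 1) (bagMu i ^ 2 * X)))))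
      (𝓝[>] 0) (𝓝 0) := by
  have h : Tendsto (fun X => √X * (bagMu i * besselG (i + 1) (bagMu i ^ 2 * X))) (𝓝[>] 0) (𝓝 0) := by
    refine squeeze_zero' ?_ ?_ tendsto_sqrt_one_sub_bagTau_zero
    · filter_upwards [self_mem_nhdsWithin] with X hX
      have hm := bagTau_mem_Ioc hX
      have := bagE_lt i hm
      rw [sqrt_mul_besselG i hX]
      exact div_nonneg (mul_nonneg (Real.sqrt_nonneg _) (by linarith)) (by linarith [hm.1])
    · filter_upwards [self_mem_nhdsWithin] with X hX
      have hm := bagTau_mem_Ioc hX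
      have := mul_nonneg (sq_nonneg (bagTau X)) (bagE_nonneg i hm)
      rw [sqrt_mul_besselG i hX, mul_div_assoc]
      refine mul_le_of_le_one_right (Real.sqrt_nonneg _) ?_
      rw [div_le_one (by linarith [hm.1])]
      linarith [hm.1]
  have h' := (Real.continuous_arctan.tendsto _).comp (h.const_mul a)
  simpa [Function.comp_def] using h'

theorem tendsto_arctan_besselG_atTop (a : ℝ) (i : ℕ) :
    Tendsto (fun X => Real.arctan (a * (√X * (bagMu i * besselG (i + 1) (bagMu i ^ 2 * X)))))
      atTop (𝓝 (Real.arctan a)) := by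
  have hE : Tendsto (fun X => bagTau X ^ 2 * bagE i (bagTau X)) atTop (𝓝 0) := by
    have hb : Tendsto (fun X => bagTau X ^ 2 * (3 / bagMu i)) atTop (𝓝 0) := by
      simpa using (tendsto_bagTau_atTop.pow 2).mul_const (3 / bagMu i)
    refine squeeze_zero' ?_ ?_ hb
    · filter_upwards [eventually_gt_atTop 0] with X hX
      exact mul_nonneg (sq_nonneg _) (bagE_nonneg i (bagTau_mem_Ioc hX))
    · filter_upwards [eventually_gt_atTop 0] with X hX
      exact mul_le_mul_of_nonneg_left (bagE_le i (bagTau_mem_Ioc hX)) (sq_nonneg _)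
  have h := ((tendsto_sqrt_one_sub_bagTau_atTop.mul (hE.const_sub 1)).div
    (tendsto_bagTau_atTop.const_add 1) (by norm_num)).const_mul a
  have h' := (Real.continuous_arctan.tendsto _).comp h
  simp only [add_zero, div_one, mul_one, sub_zero] at h'
  refine h'.congr' ?_
  filter_upwards [eventually_gt_atTop 0] with X hX
  simp only [Function.comp, sqrt_mul_besselG i hX, Pi.div_apply]

theorem mellin_besselOddZeta {i : ℕ} {a : ℝ} {T T₁ T₂ : ℝ → ℝ} (hT : TwiceDecay T T₁ T₂)
    (h : ∀ X, 0 < X → T X = bagMu i * besselH (i + 1) a (bagMu i ^ 2 * X)) {b : ℂ} (h0 : 0 < b.re)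
    (h3 : b.re ≤ 3 / 2) :
    Complex.Gamma b * Complex.Gamma (3 - b) * besselOddZeta (i + 1) a (5 - 2 * b) =
      (bagMu i : ℂ) ^ (-(5 - 2 * b)) * mellin (fun X => (T₂ X : ℂ)) b := by
  have hμ := bagMu_pos i
  have hc : 0 < (bagMu i ^ 2)⁻¹ := by positivity
  have hx : ∀ x, 0 < x → HasDerivAt (besselH (i + 1) a)
      ((bagMu i)⁻¹ ^ 3 * T₁ ((bagMu i ^ 2)⁻¹ * x)) x := fun x hx => by
    have hd := ((hT.hasDerivAt _ (mul_pos hc hx)).comp x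
      ((hasDerivAt_id x).const_mul (bagMu i ^ 2)⁻¹)).const_mul (bagMu i)⁻¹
    refine (hd.congr_of_eventuallyEq ((eventually_gt_nhds hx).mono fun y hy => ?_)).congr_deriv ?_
    · simp only [Function.comp]
      rw [h _ (mul_pos hc hy), inv_mul_cancel_left₀ hμ.ne', mul_inv_cancel_left₀ (by positivity)]
    · field_simp
  have hx₂ : ∀ x, 0 < x → HasDerivAt (fun x => (bagMu i)⁻¹ ^ 3 * T₁ ((bagMu i ^ 2)⁻¹ * x))
      ((bagMu i)⁻¹ ^ 5 * T₂ ((bagMu i ^ 2)⁻¹ * x)) x := fun x hx => by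
    have hd := ((hT.hasDerivAt₁ _ (mul_pos hc hx)).comp x
      ((hasDerivAt_id x).const_mul (bagMu i ^ 2)⁻¹)).const_mul ((bagMu i)⁻¹ ^ 3)
    refine hd.congr_deriv ?_
    field_simp
  rw [← mellin_besselH_deriv_deriv hx hx₂ h0 h3]
  have e : (fun x => (((bagMu i)⁻¹ ^ 5 * T₂ ((bagMu i ^ 2)⁻¹ * x) : ℝ) : ℂ)) =
      fun x => (((bagMu i)⁻¹ ^ 5 : ℝ) : ℂ) • (fun X => (T₂ X : ℂ)) ((bagMu i ^ 2)⁻¹ * x) := by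
    funext x; push_cast; simp
  rw [e, mellin_const_smul, mellin_comp_mul_left (fun X => (T₂ X : ℂ)) _ hc, smul_smul]
  rw [smul_eq_mul]
  congr 1
  have hμ' : (bagMu i : ℂ) ≠ 0 := Complex.ofReal_ne_zero.2 hμ.ne'
  have e1 : (((bagMu i ^ 2)⁻¹ : ℝ) : ℂ) ^ (-b) = (bagMu i : ℂ) ^ (2 * b) := by
    have : (((bagMu i ^ 2)⁻¹ : ℝ) : ℂ) = (((bagMu i) ^ (-2 : ℝ) : ℝ) : ℂ) := by
      rw [Real.rpow_neg hμ.le]; norm_cast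
    rw [this, ← Complex.cpow_mul_ofReal_nonneg hμ.le]
    push_cast
    ring_nf
  rw [e1, neg_sub, Complex.cpow_sub _ _ hμ', div_eq_inv_mul]
  congr 1
  push_cast
  rw [inv_pow]
  congr 1
  norm_cast

theorem CubeDecay.hasMellin_add_const_mul {D c : ℝ} {p q : ℝ → ℝ} {b M : ℂ} 
    (hp : HasMellin (fun X => (p X : ℂ)) b M) (hq : CubeDecay D q) (h0 : 0 < b.re) (h3 : b.re < 3) :
    HasMellin (fun X => ((p X + c * q X : ℝ) : ℂ)) b
      (M + c * mellin (fun X => (q X : ℂ)) b) := by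
  have h := hasMellin_add hp.1 (hasMellin_const_smul (hq.mellinConvergent h0 h3) (c : ℂ)).1
  rw [hp.2, mellin_const_smul] at h
  simpa using h

/-- The Mellin transform of the generating function, expanded to third order. -/
theorem exists_bag_expansion (a : ℝ) : ∃ (H P₁ Φ₁ Φ₂ P₃ Φ₃ : ℝ → ℝ) (R : ℕ → ℝ → ℝ),
    (∃ C, CubeDecay C H) ∧ (∃ C, CubeDecay C Φ₂) ∧
    TwiceDecay (fun X => bagTau X ^ 2 * bagK₁ a (bagTau X)) P₁ Φ₁ ∧
    TwiceDecay (fun X => bagTau X ^ 2 * bagK₃ a (bagTau X)) P₃ Φ₃ ∧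
    (∃ C, ∀ i, CubeDecay (C * (bagMu i ^ 4)⁻¹) (R i)) ∧
    (∀ i, mellin (fun X => (R i X : ℂ)) (5 / 2) = 0) ∧
    ∀ (i : ℕ) (b : ℂ), 0 < b.re → b.re ≤ 3 / 2 →
      Complex.Gamma b * Complex.Gamma (3 - b) * besselOddZeta (i + 1) a (5 - 2 * b) =
        (bagMu i : ℂ) ^ (-(5 - 2 * b)) * (mellin (fun X => (H X : ℂ)) b + (5 - 2 * b) *
          ((bagMu i : ℂ)⁻¹ * mellin (fun X => (Φ₁ X : ℂ)) b +
          (bagMu i : ℂ)⁻¹ ^ 2 * mellin (fun X => (Φ₂ X : ℂ)) b +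
          (bagMu i : ℂ)⁻¹ ^ 3 * mellin (fun X => (Φ₃ X : ℂ)) b) +
          mellin (fun X => (R i X : ℂ)) b) := by
  obtain ⟨H₁, H₂, hH, -⟩ := (symbolBound_bagh₀ 3 a).exists_twiceDecay
  obtain ⟨R₁, R₂, hR, hRC⟩ := (symbolBound_baghRem 3 a).exists_twiceDecay
  obtain ⟨P₁, Φ₁, A₁, B₁, hΦ₁, hB₁, e₁⟩ := exists_mellin_bagh₁ (a := a)
  obtain ⟨P₂, Φ₂, A₂, B₂, hΦ₂, hB₂, e₂⟩ := exists_mellin_bagh₂ (a := a)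
  obtain ⟨P₃, Φ₃, A₃, B₃, hΦ₃, hB₃, e₃⟩ := exists_mellin_bagh₃ (a := a)
  have hT := fun i => ((((hH 0).add (hB₁.const_mul (bagMu i)⁻¹)).add
    (hB₂.const_mul ((bagMu i)⁻¹ ^ 2))).add (hB₃.const_mul ((bagMu i)⁻¹ ^ 3))).add
    ((hR i).const_mul 1)
  have hTeq : ∀ i, ∀ X, 0 < X → bagTau X ^ 2 * bagh₀ a (bagTau X) +
      (bagMu i)⁻¹ * (bagTau X ^ 2 * bagh₁ a (bagTau X)) +
      (bagMu i)⁻¹ ^ 2 * (bagTau X ^ 2 * bagh₂ a (bagTau X)) +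
      (bagMu i)⁻¹ ^ 3 * (bagTau X ^ 2 * bagh₃ a (bagTau X)) +
      1 * (bagTau X ^ 2 * baghRem a i (bagTau X)) =
        bagMu i * besselH (i + 1) a (bagMu i ^ 2 * X) := fun i X hX => by
    have h := bagMu_mul_besselH a i (bagTau_mem_Ioc hX)
    rw [bagTau_X hX] at h
    rw [h, baghRem]
    ring
  obtain ⟨D₀, hD₀⟩ := (hH 0).cubeDecay
  obtain ⟨D₁, hD₁⟩ := hB₁.cubeDecay
  obtain ⟨D₂, hD₂⟩ := hB₂.cubeDecay
  obtain ⟨D₃, hD₃⟩ := hB₃.cubeDecay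
  have hmel : ∀ (i : ℕ) (b : ℂ), 0 < b.re → b.re < 3 →
      mellin (fun X => ((H₂ 0 X + (bagMu i)⁻¹ * B₁ X + (bagMu i)⁻¹ ^ 2 * B₂ X +
        (bagMu i)⁻¹ ^ 3 * B₃ X + 1 * R₂ i X : ℝ) : ℂ)) b =
      mellin (fun X => (H₂ 0 X : ℂ)) b + (5 - 2 * b) *
          ((bagMu i : ℂ)⁻¹ * mellin (fun X => (Φ₁ X : ℂ)) b +
          (bagMu i : ℂ)⁻¹ ^ 2 * mellin (fun X => (Φ₂ X : ℂ)) b +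
          (bagMu i : ℂ)⁻¹ ^ 3 * mellin (fun X => (Φ₃ X : ℂ)) b) +
          mellin (fun X => (R₂ i X : ℂ)) b := fun i b h0 h3 => by
    obtain ⟨D, hD⟩ := (hR i).cubeDecay
    have hM : HasMellin (fun X => (H₂ 0 X : ℂ)) b _ := ⟨hD₀.mellinConvergent h0 h3, rfl⟩
    have h := CubeDecay.hasMellin_add_const_mul (c := 1) (CubeDecay.hasMellin_add_const_mul
      (c := (bagMu i)⁻¹ ^ 3) (CubeDecay.hasMellin_add_const_mul (c := (bagMu i)⁻¹ ^ 2)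
      (CubeDecay.hasMellin_add_const_mul (c := (bagMu i)⁻¹) hM hD₁ h0 h3) hD₂ h0 h3) hD₃ h0 h3) hD
      h0 h3
    rw [h.2, e₁ b h0 h3, e₂ b h0 h3, e₃ b h0 h3]
    push_cast
    ring
  refine ⟨H₂ 0, P₁, Φ₁, Φ₂, P₃, Φ₃, R₂, ⟨D₀, hD₀⟩, hΦ₂.cubeDecay, hΦ₁, hΦ₃, hRC, fun i => ?_,
    fun i b h0 h3 => ?_⟩
  · have h1 := (hT i).mellin_five_halves (Θ := fun X =>
      Real.arctan (a * (√X * (bagMu i * besselG (i + 1) (bagMu i ^ 2 * X)))))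
      (fun X hX => by rw [hTeq i X hX]; exact hasDerivAt_arctan_besselG a i hX)
      (tendsto_arctan_besselG_zero a i) (tendsto_arctan_besselG_atTop a i)
    have h2 := (hH 0).mellin_five_halves (fun X hX => hasDerivAt_arctan_bagTau a hX)
      (tendsto_arctan_bagTau_zero a) (tendsto_arctan_bagTau_atTop a)
    rw [hmel i _ (by norm_num) (by norm_num), h2] at h1
    linear_combination h1
  · rw [mellin_besselOddZeta (hT i) (hTeq i) h0 h3, hmel i b h0 (by linarith)]

/-- `BagIntegral f v` states that `∫₀^{π/2} f (cos φ) dφ = v`, in terms of a primitive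
in the variable `X = tan² φ`. -/
def BagIntegral (f : ℝ → ℝ) (v : ℝ) : Prop :=
  ∃ (Θ : ℝ → ℝ) (l m : ℝ),
    (∀ X, 0 < X → HasDerivAt Θ (bagTau X ^ 2 * f (bagTau X) / (2 * √X)) X) ∧
    Tendsto Θ (𝓝[>] 0) (𝓝 l) ∧ Tendsto Θ atTop (𝓝 m) ∧ m - l = v

namespace BagIntegral

variable {f g : ℝ → ℝ} {v w : ℝ}

theorem add (hf : BagIntegral f v) (hg : BagIntegral g w) :
    BagIntegral (fun τ => f τ + g τ) (v + w) := by
  obtain ⟨Θ, l, m, h1, h2, h3, h4⟩ := hf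
  obtain ⟨Θ', l', m', h1', h2', h3', h4'⟩ := hg
  refine ⟨fun X => Θ X + Θ' X, l + l', m + m', fun X hX => ?_, h2.add h2', h3.add h3', by linarith⟩
  refine ((h1 X hX).add (h1' X hX)).congr_deriv ?_
  ring

theorem const_mul (c : ℝ) (hf : BagIntegral f v) : BagIntegral (fun τ => c * f τ) (c * v) := by
  obtain ⟨Θ, l, m, h1, h2, h3, h4⟩ := hf
  refine ⟨fun X => c * Θ X, c * l, c * m, fun X hX => ?_, h2.const_mul c, h3.const_mul c,
    by rw [← h4]; ring⟩
  refine ((h1 X hX).const_mul c).congr_deriv ?_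
  ring

theorem sub (hf : BagIntegral f v) (hg : BagIntegral g w) :
    BagIntegral (fun τ => f τ - g τ) (v - w) := by
  simpa [sub_eq_add_neg] using hf.add (hg.const_mul (-1))

theorem congr (hf : BagIntegral f v) (h : ∀ τ ∈ Ioo (0 : ℝ) 1, g τ = f τ) (hv : w = v) :
    BagIntegral g w := by
  obtain ⟨Θ, l, m, h1, h2, h3, h4⟩ := hf
  refine ⟨Θ, l, m, fun X hX => ?_, h2, h3, hv ▸ h4⟩
  rw [h _ (bagTau_mem hX)]
  exact h1 X hX

theorem of_hasDerivAt {g' : ℝ → ℝ} (h : ∀ τ ∈ Ioo (0 : ℝ) 1, HasDerivAt g (g' τ) τ)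
    (h0 : ContinuousAt g 0) (h1 : ContinuousAt g 1) :
    BagIntegral (fun τ => τ * g τ - (1 - τ ^ 2) * g' τ) (g 0) := by
  refine ⟨fun X => √X * bagTau X * g (bagTau X), 0, g 0, fun X hX => ?_, ?_, ?_, sub_zero _⟩
  · have hs := Real.sqrt_pos.2 hX
    have hm := bagTau_mem hX
    have ht := hasDerivAt_bagTau hX
    have hg := (h _ hm).comp X ht
    have h := ((Real.hasDerivAt_sqrt hX.ne').mul ht).mul hg
    refine h.congr_deriv ?_
    have eX : X * bagTau X ^ 2 = 1 - bagTau X ^ 2 := by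
      have := hm.1.ne'
      nth_rewrite 1 [← bagTau_X hX]; field_simp
    simp only [Pi.mul_apply, Function.comp_apply]
    generalize g (bagTau X) = p
    generalize g' (bagTau X) = q
    generalize bagTau X = t at *
    have h2 : X = √X ^ 2 := (Real.sq_sqrt hX.le).symm
    set y := √X
    rw [h2] at eX
    field_simp
    linear_combination (-p * t - q * t ^ 2) * eX
  · have h := tendsto_sqrt_one_sub_bagTau_zero.mul (h1.tendsto.comp tendsto_bagTau_zero)
    rw [zero_mul] at h
    refine h.congr' ?_
    filter_upwards [self_mem_nhdsWithin] with X hX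
    rw [sqrt_mul_bagTau hX, Function.comp_apply]
  · have h := tendsto_sqrt_one_sub_bagTau_atTop.mul (h0.tendsto.comp tendsto_bagTau_atTop)
    rw [one_mul] at h
    refine h.congr' ?_
    filter_upwards [eventually_gt_atTop 0] with X hX
    rw [sqrt_mul_bagTau hX, Function.comp_apply]

theorem inv_bagd {a : ℝ} (ha : a ≠ 0) :
    BagIntegral (fun τ => (bagd a τ)⁻¹) (Real.arctan a / a) := by
  have h : BagIntegral (bagh₀ a) (Real.arctan a) :=
    ⟨_, 0, _, fun X hX => hasDerivAt_arctan_bagTau a hX, tendsto_arctan_bagTau_zero a,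
      tendsto_arctan_bagTau_atTop a, sub_zero _⟩
  refine (h.const_mul a⁻¹).congr (fun τ _ => ?_) (by ring)
  rw [bagh₀]
  field_simp

theorem one : BagIntegral (fun _ => 1) (Real.pi / 2) := by
  refine ((inv_bagd one_ne_zero).const_mul 2).congr (fun τ _ => ?_) ?_
  · rw [bagd]; ring
  · rw [Real.arctan_one]; ring

theorem id : BagIntegral (fun τ => τ) 1 := by
  refine (of_hasDerivAt (g := fun _ => 1) (g' := fun _ => 0) (fun τ _ => hasDerivAt_const _ _)
    continuousAt_const continuousAt_const).congr (fun τ _ => ?_) rfl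
  ring

theorem pow_add_two {n : ℕ} (h : BagIntegral (fun τ => τ ^ n) v) :
    BagIntegral (fun τ => τ ^ (n + 2)) ((n + 1) / (n + 2) * v) := by
  have hg := of_hasDerivAt (g := fun τ => τ ^ (n + 1)) (g' := fun τ => (n + 1 : ℝ) * τ ^ n)
    (fun τ _ => by simpa using hasDerivAt_pow (n + 1) τ) (by fun_prop) (by fun_prop)
  refine ((hg.add (h.const_mul (n + 1))).const_mul ((n + 2 : ℝ)⁻¹)).congr (fun τ _ => ?_) ?_
  · field_simp
    ring
  · simp only [ne_eq, Nat.add_eq_zero_iff, one_ne_zero, and_false, not_false_eq_true, zero_pow]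
    ring

theorem _root_.hasDerivAt_bagd (a τ : ℝ) : HasDerivAt (bagd a) (1 - a ^ 2) τ := by
  unfold bagd
  refine (((hasDerivAt_id τ).const_add 1).add
    (((hasDerivAt_id τ).const_sub 1).const_mul (a ^ 2))).congr_deriv ?_
  ring

theorem inv_bagd_sq {a : ℝ} (ha : a ≠ 0) : BagIntegral (fun τ => (bagd a τ)⁻¹ ^ 2)
    ((1 + a ^ 2) / (4 * a ^ 2) * (Real.arctan a / a) -
      (1 - a ^ 2) / (4 * a ^ 2) * (1 + a ^ 2)⁻¹) := by
  have hd : ∀ τ ∈ Icc (0 : ℝ) 1, bagd a τ ≠ 0 := fun τ hτ => by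
    rw [bagd]; have := hτ.1; have : 0 ≤ a ^ 2 * (1 - τ) := mul_nonneg (sq_nonneg a) (by linarith [hτ.2])
    positivity
  have hg := of_hasDerivAt (g := fun τ => (bagd a τ)⁻¹)
    (g' := fun τ => -(1 - a ^ 2) / bagd a τ ^ 2)
    (fun τ hτ => (hasDerivAt_bagd a τ).fun_inv (hd τ (Ioo_subset_Icc_self hτ)))
    ((hasDerivAt_bagd a 0).continuousAt.inv₀ (hd 0 (by simp)))
    ((hasDerivAt_bagd a 1).continuousAt.inv₀ (hd 1 (by simp)))
  refine (((inv_bagd ha).const_mul ((1 + a ^ 2) / (4 * a ^ 2))).sub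
    (hg.const_mul ((1 - a ^ 2) / (4 * a ^ 2)))).congr (fun τ hτ => ?_) ?_
  · have := hd τ (Ioo_subset_Icc_self hτ)
    field_simp
    rw [bagd]; ring
  · simp [bagd]

theorem inv_bagd_cube {a : ℝ} (ha : a ≠ 0) : BagIntegral (fun τ => (bagd a τ)⁻¹ ^ 3)
    (3 * (1 + a ^ 2) / (8 * a ^ 2) * ((1 + a ^ 2) / (4 * a ^ 2) * (Real.arctan a / a) -
      (1 - a ^ 2) / (4 * a ^ 2) * (1 + a ^ 2)⁻¹) - (8 * a ^ 2)⁻¹ * (Real.arctan a / a) -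
      (1 - a ^ 2) / (8 * a ^ 2) * (1 + a ^ 2)⁻¹ ^ 2) := by
  have hd : ∀ τ ∈ Icc (0 : ℝ) 1, bagd a τ ≠ 0 := fun τ hτ => by
    rw [bagd]; have := hτ.1; have : 0 ≤ a ^ 2 * (1 - τ) := mul_nonneg (sq_nonneg a) (by linarith [hτ.2])
    positivity
  have hg := of_hasDerivAt (g := fun τ => (bagd a τ)⁻¹ ^ 2)
    (g' := fun τ => 2 * (bagd a τ)⁻¹ * (-(1 - a ^ 2) / bagd a τ ^ 2))
    (fun τ hτ => by
      simpa using ((hasDerivAt_bagd a τ).fun_inv (hd τ (Ioo_subset_Icc_self hτ))).fun_pow 2)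
    (((hasDerivAt_bagd a 0).continuousAt.inv₀ (hd 0 (by simp))).pow 2)
    (((hasDerivAt_bagd a 1).continuousAt.inv₀ (hd 1 (by simp))).pow 2)
  refine ((((inv_bagd_sq ha).const_mul (3 * (1 + a ^ 2) / (8 * a ^ 2))).sub
    ((inv_bagd ha).const_mul ((8 * a ^ 2)⁻¹))).sub
    (hg.const_mul ((1 - a ^ 2) / (8 * a ^ 2)))).congr (fun τ hτ => ?_) ?_
  · have := hd τ (Ioo_subset_Icc_self hτ)
    field_simp
    rw [bagd]; ring
  · simp [bagd]

end BagIntegral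

theorem bagK_partial_fractions {c τ d : ℝ} (hc : c ≠ 0) (hd0 : d ≠ 0) (hd : d = 2 - c + c * τ) :
    -(τ * bagE₃ τ * d⁻¹ + (1 - c) * (1 - τ) * τ ^ 3 * bagE₂ τ * d⁻¹ ^ 2 +
      ((1 - c) ^ 2 * (1 - τ) ^ 2 * τ ^ 5 / 8 - (1 - c) * (1 - τ ^ 2) * τ ^ 5 / 24) * d⁻¹ ^ 3) +
      1 / 8 * (τ * d⁻¹) =
    (-320 + 960 * c - 1088 * c ^ 2 + 576 * c ^ 3 - 140 * c ^ 4 + 12 * c ^ 5 + c ^ 6) /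
      (8 * c ^ 7) * 1 +
    (280 - 700 * c + 594 * c ^ 2 - 191 * c ^ 3 + 17 * c ^ 4) / (12 * c ^ 6) * τ +
    (-42 + 84 * c - 46 * c ^ 2 + 4 * c ^ 3) / (3 * c ^ 5) * τ ^ 2 +
    (34 - 51 * c + 11 * c ^ 2 + 3 * c ^ 3) / (4 * c ^ 4) * τ ^ 3 +
    (-31 + 31 * c + 6 * c ^ 2) / (6 * c ^ 3) * τ ^ 4 +
    (50 - 25 * c) / (16 * c ^ 2) * τ ^ 5 + -15 / (8 * c) * τ ^ 6 +
    (1728 - 6048 * c + 8512 * c ^ 2 - 6160 * c ^ 3 + 2412 * c ^ 4 - 482 * c ^ 5 + 32 * c ^ 6 +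
      3 * c ^ 7) / (24 * c ^ 7) * d⁻¹ +
    (64 - 256 * c + 400 * c ^ 2 - 304 * c ^ 3 + 108 * c ^ 4 - 8 * c ^ 5 - 5 * c ^ 6 + c ^ 7) /
      (12 * c ^ 7) * d⁻¹ ^ 2 +
    (64 - 288 * c + 544 * c ^ 2 - 560 * c ^ 3 + 340 * c ^ 4 - 122 * c ^ 5 + 24 * c ^ 6 -
      2 * c ^ 7) / (3 * c ^ 7) * d⁻¹ ^ 3 := by
  simp only [bagE₂, bagE₃]
  field_simp
  rw [hd]
  ring

/-- The coefficient combination which determines the value of the continuation at `0`. -/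
def bagK (a τ : ℝ) : ℝ := bagK₃ a τ - 1 / 4 * bagK₁ a τ

theorem bagIntegral_bagK {a c : ℝ} (ha : 0 < a) (h1 : a ≠ 1) (hcd : c = 1 - a ^ 2) :
    BagIntegral (bagK a)
      (a * (-15360 + 46080 * c - 54912 * c ^ 2 + 33024 * c ^ 3 - 10408 * c ^ 4 + 1576 * c ^ 5 -
        33 * c ^ 6) / (768 * c ^ 7) * Real.pi +
      (960 - 3360 * c + 4752 * c ^ 2 - 3480 * c ^ 3 + 1396 * c ^ 4 - 294 * c ^ 5 + 24 * c ^ 6 +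
        c ^ 7) / (12 * c ^ 7) * Real.arctan a +
      a * (480 - 1200 * c + 1136 * c ^ 2 - 504 * c ^ 3 + 102 * c ^ 4 - 7 * c ^ 5) / (24 * c ^ 6)) := by
  have ha0 := ha.ne'
  have hc : 1 - a ^ 2 ≠ 0 := by
    have : 1 - a ^ 2 = (1 - a) * (1 + a) := by ring
    rw [this]
    exact mul_ne_zero (sub_ne_zero.2 h1.symm) (by positivity)
  have t2 := BagIntegral.pow_add_two (n := 0) (by simpa using BagIntegral.one)
  have t3 := BagIntegral.pow_add_two (n := 1) (by simpa using BagIntegral.id)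
  have t4 := BagIntegral.pow_add_two t2
  have t5 := BagIntegral.pow_add_two t3
  have t6 := BagIntegral.pow_add_two t4
  norm_num at t2 t3 t4 t5 t6
  have h := ((((((((((BagIntegral.one.const_mul
    ((-320 + 960 * c - 1088 * c ^ 2 + 576 * c ^ 3 - 140 * c ^ 4 + 12 * c ^ 5 + c ^ 6) /
      (8 * c ^ 7))).add (BagIntegral.id.const_mul
    ((280 - 700 * c + 594 * c ^ 2 - 191 * c ^ 3 + 17 * c ^ 4) / (12 * c ^ 6)))).add (t2.const_mul
    ((-42 + 84 * c - 46 * c ^ 2 + 4 * c ^ 3) / (3 * c ^ 5)))).add (t3.const_mul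
    ((34 - 51 * c + 11 * c ^ 2 + 3 * c ^ 3) / (4 * c ^ 4)))).add (t4.const_mul
    ((-31 + 31 * c + 6 * c ^ 2) / (6 * c ^ 3)))).add (t5.const_mul
    ((50 - 25 * c) / (16 * c ^ 2)))).add (t6.const_mul (-15 / (8 * c)))).add
    ((BagIntegral.inv_bagd ha0).const_mul
    ((1728 - 6048 * c + 8512 * c ^ 2 - 6160 * c ^ 3 + 2412 * c ^ 4 - 482 * c ^ 5 + 32 * c ^ 6 +
      3 * c ^ 7) / (24 * c ^ 7)))).add
    ((BagIntegral.inv_bagd_sq ha0).const_mul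
    ((64 - 256 * c + 400 * c ^ 2 - 304 * c ^ 3 + 108 * c ^ 4 - 8 * c ^ 5 - 5 * c ^ 6 + c ^ 7) /
      (12 * c ^ 7)))).add
    ((BagIntegral.inv_bagd_cube ha0).const_mul
    ((64 - 288 * c + 544 * c ^ 2 - 560 * c ^ 3 + 340 * c ^ 4 - 122 * c ^ 5 + 24 * c ^ 6 -
      2 * c ^ 7) / (3 * c ^ 7)))).const_mul a
  refine h.congr (fun τ hτ => ?_) ?_
  · have hd := one_le_bagd a (Ioo_subset_Ioc_self hτ)
    rw [← bagK_partial_fractions (hcd ▸ hc) (by linarith) (by rw [hcd, bagd]; ring), bagK, bagK₃,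
      bagK₁, hcd]
    ring
  · have hp : (1 + a ^ 2) ≠ 0 := by positivity
    rw [← hcd] at hc
    field_simp
    obtain rfl : c = 1 - a ^ 2 := hcd
    ring

/-- The spectral asymmetry as a rational function of `a = exp θ`. -/
def bagAsymmetry (a : ℝ) : ℝ :=
  (a - 1) * (16 + 161 * a + 344 * a ^ 2 + 518 * a ^ 3 + 344 * a ^ 4 + 161 * a ^ 5 + 16 * a ^ 6) /
    (192 * (a + 1) ^ 7)

theorem bagIntegral_bagK_sub {a : ℝ} (ha : 0 < a) :
    BagIntegral (fun τ => bagK a τ - bagK a⁻¹ τ) (Real.pi / 2 * bagAsymmetry a) := by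
  by_cases h1 : a = 1
  · subst h1
    refine (BagIntegral.one.const_mul 0).congr (fun τ _ => ?_) ?_
    · simp
    · simp [bagAsymmetry]
  · refine ((bagIntegral_bagK ha h1 rfl).sub (bagIntegral_bagK (inv_pos.2 ha)
      (inv_ne_one.2 h1) rfl)).congr (fun τ _ => rfl) ?_
    have hc : 1 - a ≠ 0 := sub_ne_zero.2 (Ne.symm h1)
    have hc1 : a - 1 ≠ 0 := sub_ne_zero.2 h1
    have hp : a + 1 ≠ 0 := by positivity
    have ha0 := ha.ne'
    have e1 : 1 - a ^ 2 = -((a - 1) * (a + 1)) := by ring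
    have e2 : 1 - a⁻¹ ^ 2 = (a - 1) * (a + 1) * a⁻¹ ^ 2 := by field_simp; ring
    rw [Real.arctan_inv_of_pos ha, bagAsymmetry, e1, e2]
    generalize Real.arctan a = t
    field_simp
    ring

theorem bagAsymmetry_exp (θ : ℝ) : bagAsymmetry (Real.exp θ) =
    (1 / 6144) * (Real.tanh (θ / 2) / Real.cosh (θ / 2) ^ 6) *
        (259 + 344 * Real.cosh θ + 161 * Real.cosh (2 * θ) + 16 * Real.cosh (3 * θ)) := by
  obtain ⟨x, hx⟩ : ∃ x, x = Real.exp (θ / 2) := ⟨_, rfl⟩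
  have hx0 : 0 < x := hx ▸ Real.exp_pos _
  have e1 : Real.exp θ = x ^ 2 := by rw [hx, ← Real.exp_nat_mul]; congr 1; push_cast; ring
  have e2 : Real.exp (2 * θ) = x ^ 4 := by rw [hx, ← Real.exp_nat_mul]; congr 1; push_cast; ring
  have e3 : Real.exp (3 * θ) = x ^ 6 := by rw [hx, ← Real.exp_nat_mul]; congr 1; push_cast; ring
  rw [Real.tanh_eq_sinh_div_cosh, Real.sinh_eq]
  simp only [Real.cosh_eq, Real.exp_neg, e1, e2, e3, ← hx, bagAsymmetry]
  have h1 : x ^ 2 + 1 ≠ 0 := by positivity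
  field_simp
  ring

theorem mellin_five_halves_bagK_sub {a : ℝ} (ha : 0 < a) {P₁ Φ₁ P₃ Φ₃ P₁' Φ₁' P₃' Φ₃' : ℝ → ℝ}
    (h₁ : TwiceDecay (fun X => bagTau X ^ 2 * bagK₁ a (bagTau X)) P₁ Φ₁)
    (h₃ : TwiceDecay (fun X => bagTau X ^ 2 * bagK₃ a (bagTau X)) P₃ Φ₃)
    (h₁' : TwiceDecay (fun X => bagTau X ^ 2 * bagK₁ a⁻¹ (bagTau X)) P₁' Φ₁')
    (h₃' : TwiceDecay (fun X => bagTau X ^ 2 * bagK₃ a⁻¹ (bagTau X)) P₃' Φ₃') :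
    (mellin (fun X => (Φ₃ X : ℂ)) (5 / 2) - 1 / 4 * mellin (fun X => (Φ₁ X : ℂ)) (5 / 2)) -
      (mellin (fun X => (Φ₃' X : ℂ)) (5 / 2) - 1 / 4 * mellin (fun X => (Φ₁' X : ℂ)) (5 / 2)) =
      ((3 / 4 * Real.pi * bagAsymmetry a : ℝ) : ℂ) := by
  obtain ⟨Θ, l, m, hΘ, hl, hm, hlm⟩ := bagIntegral_bagK_sub ha
  have hF := ((h₃.add (h₁.const_mul (-1 / 4))).add (h₃'.const_mul (-1))).add
    (h₁'.const_mul (1 / 4))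
  have key := hF.mellin_five_halves (Θ := Θ) (fun X hX => (hΘ X hX).congr_deriv (by
    simp only [bagK]; ring)) hl hm
  obtain ⟨C₁, hC₁⟩ := h₁.cubeDecay
  obtain ⟨C₃, hC₃⟩ := h₃.cubeDecay
  obtain ⟨C₁', hC₁'⟩ := h₁'.cubeDecay
  obtain ⟨C₃', hC₃'⟩ := h₃'.cubeDecay
  have b0 : 0 < (5 / 2 : ℂ).re := by norm_num
  have b3 : (5 / 2 : ℂ).re < 3 := by norm_num
  have hM := CubeDecay.hasMellin_add_const_mul (c := 1 / 4) (CubeDecay.hasMellin_add_const_mul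
    (c := -1) (CubeDecay.hasMellin_add_const_mul (c := -1 / 4)
    ⟨hC₃.mellinConvergent b0 b3, rfl⟩ hC₁ b0 b3) hC₃' b0 b3) hC₁' b0 b3
  have e := hM.2.symm.trans key
  rw [hlm] at e
  have e' : 3 / 4 * Real.pi * bagAsymmetry a = 3 / 2 * (Real.pi / 2 * bagAsymmetry a) := by ring
  rw [e', ← e]
  push_cast
  ring

/-- The Hurwitz zeta function with parameter `1/2`. -/
def halfZeta (s : ℂ) : ℂ := HurwitzZeta.hurwitzZetaEven (((1 / 2 : ℝ) : UnitAddCircle)) s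

theorem differentiableAt_halfZeta {s : ℂ} (hs : s ≠ 1) : DifferentiableAt ℂ halfZeta s :=
  HurwitzZeta.differentiableAt_hurwitzZetaEven _ hs

theorem half_ne_zero_unitAddCircle : ((1 / 2 : ℝ) : UnitAddCircle) ≠ 0 := by
  intro h
  rw [AddCircle.coe_eq_zero_iff] at h
  obtain ⟨n, hn⟩ := h
  have h2 : (2 * n : ℤ) = 1 := by
    have : (2 * n : ℝ) = 1 := by
      simp at hn
      rw [hn]; norm_num
    exact_mod_cast this
  omega

theorem halfZeta_zero : halfZeta 0 = 0 := by
  rw [halfZeta, HurwitzZeta.hurwitzZetaEven_apply_zero, if_neg half_ne_zero_unitAddCircle]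

theorem halfZeta_neg_two : halfZeta (-2) = 0 := by
  simpa [halfZeta] using HurwitzZeta.hurwitzZetaEven_neg_two_mul_nat_add_one (((1 / 2 : ℝ) : UnitAddCircle)) 0

theorem hasSum_halfZeta {s : ℂ} (hs : 1 < s.re) :
    HasSum (fun n : ℕ => 1 / ((n : ℂ) + 1 / 2) ^ s) (halfZeta s) := by
  have h := HurwitzZeta.hasSum_hurwitzZeta_of_one_lt_re (a := 1 / 2) ⟨by norm_num, by norm_num⟩ hs
  have e : -((1 / 2 : ℝ) : UnitAddCircle) = ((1 / 2 : ℝ) : UnitAddCircle) := by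
    rw [← AddCircle.coe_neg, ← sub_eq_zero, ← AddCircle.coe_sub, AddCircle.coe_eq_zero_iff]
    exact ⟨-1, by norm_num⟩
  rw [halfZeta, HurwitzZeta.hurwitzZetaEven_eq, e, add_self_div_two]
  simpa using h

/-- The entire function `s * halfZeta (s + 1)`. -/
def mulHalfZeta : ℂ → ℂ := Function.update (fun s => s * halfZeta (s + 1)) 0 1

theorem mulHalfZeta_zero : mulHalfZeta 0 = 1 := Function.update_self ..

theorem mulHalfZeta_of_ne {s : ℂ} (hs : s ≠ 0) : mulHalfZeta s = s * halfZeta (s + 1) :=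
  Function.update_of_ne hs _ _

theorem differentiable_mulHalfZeta : Differentiable ℂ mulHalfZeta := by
  rw [← differentiableOn_univ, ← Complex.differentiableOn_compl_singleton_and_continuousAt_iff
    (c := 0) univ_mem]
  constructor
  · intro s hs
    have hs0 : s ≠ 0 := hs.2
    have h : DifferentiableAt ℂ (fun s => s * halfZeta (s + 1)) s :=
      differentiableAt_id.mul ((differentiableAt_halfZeta (by simpa using hs0)).comp s
        (differentiableAt_id.add_const 1))
    refine (h.congr_of_eventuallyEq ?_).differentiableWithinAt
    filter_upwards [isOpen_ne.mem_nhds hs0] with t ht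
    exact mulHalfZeta_of_ne ht
  · rw [continuousAt_iff_punctured_nhds, mulHalfZeta_zero]
    have h := HurwitzZeta.hurwitzZetaEven_residue_one (((1 / 2 : ℝ) : UnitAddCircle))
    have hm : Tendsto (fun s : ℂ => s + 1) (𝓝[≠] 0) (𝓝[≠] 1) := by
      refine tendsto_nhdsWithin_iff.2 ⟨?_, ?_⟩
      · have : Tendsto (fun s : ℂ => s + 1) (𝓝 0) (𝓝 (0 + 1)) := tendsto_id.add_const 1
        simpa using this.mono_left nhdsWithin_le_nhds
      · filter_upwards [self_mem_nhdsWithin] with s hs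
        simpa using hs
    refine (h.comp hm).congr' ?_
    filter_upwards [self_mem_nhdsWithin] with s hs
    rw [mulHalfZeta_of_ne hs]
    simp [halfZeta]

theorem hasSum_bagMu_cpow {w : ℂ} (hw : 3 < w.re) :
    HasSum (fun i : ℕ => (((i : ℂ) + 1) * ((i : ℂ) + 2)) * (bagMu i : ℂ) ^ (-w))
      (halfZeta (w - 2) - 1 / 4 * halfZeta w) := by
  have h1 := hasSum_halfZeta (s := w - 2) (by simp; linarith)
  have h2 := hasSum_halfZeta (s := w) (by linarith)
  have h := h1.sub (h2.mul_left (1 / 4))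
  rw [← hasSum_nat_add_iff' 1] at h
  simp only [Finset.sum_range_one] at h
  have hμ : ∀ x : ℂ, x ≠ 0 → x ^ (w - 2) = x ^ w / x ^ 2 := fun x hx => by
    rw [Complex.cpow_sub _ _ hx]; norm_cast
  have e0 : 1 / (((0 : ℕ) : ℂ) + 1 / 2) ^ (w - 2) - 1 / 4 * (1 / (((0 : ℕ) : ℂ) + 1 / 2) ^ w) = 0 := by
    rw [hμ _ (by norm_num)]
    field_simp
    norm_num
  rw [e0, sub_zero] at h
  refine (congrArg (HasSum · _) (funext fun i => ?_)).mp h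
  have e1 : ((i + 1 : ℕ) : ℂ) + 1 / 2 = (bagMu i : ℂ) := by rw [bagMu]; push_cast; ring
  have e2 : (bagMu i : ℂ) ≠ 0 := by exact_mod_cast bagMu_ne_zero i
  have e3 : (bagMu i : ℂ) ^ w ≠ 0 := by simp [Complex.cpow_eq_zero_iff, e2]
  rw [e1, hμ _ e2, Complex.cpow_neg]
  have e4 : ((i : ℂ) + 1) * ((i : ℂ) + 2) = (bagMu i : ℂ) ^ 2 - 1 / 4 := by
    rw [bagMu]; push_cast; ring
  rw [e4]
  field_simp

theorem norm_bagMu_cpow (i : ℕ) (s : ℂ) : ‖(bagMu i : ℂ) ^ s‖ = bagMu i ^ s.re :=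
  Complex.norm_cpow_eq_rpow_re_of_pos (bagMu_pos i) s

theorem degeneracy_eq (i : ℕ) : ((i : ℂ) + 1) * ((i : ℂ) + 2) = ((bagMu i ^ 2 - 1 / 4 : ℝ) : ℂ) := by
  rw [bagMu]; push_cast; ring

theorem norm_degeneracy_le (i : ℕ) : ‖((i : ℂ) + 1) * ((i : ℂ) + 2)‖ ≤ bagMu i ^ 2 := by
  have := bagMu_ge i
  rw [degeneracy_eq, Complex.norm_real, Real.norm_eq_abs, abs_of_nonneg (by nlinarith)]
  linarith

theorem summable_bagMu_rpow {r : ℝ} (hr : r < -1) : Summable fun i : ℕ => bagMu i ^ r := by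
  have h := (summable_nat_add_iff 1).2 (Real.summable_nat_rpow.2 hr)
  refine h.of_nonneg_of_le (fun i => Real.rpow_nonneg (bagMu_pos i).le _) fun i => ?_
  refine Real.rpow_le_rpow_of_nonpos (by positivity) ?_ (by linarith)
  rw [bagMu]; push_cast; linarith

/-- The remainder series is summable, uniformly in the strip. -/
theorem exists_summable_norm_remainder {R : ℕ → ℝ → ℝ} {C : ℝ}
    (hR : ∀ i, CubeDecay (C * (bagMu i ^ 4)⁻¹) (R i)) :
    ∃ u : ℕ → ℝ, Summable u ∧ ∀ (i : ℕ) (s : ℂ), -(1 / 2) < s.re → s.re < 9 / 2 →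
      ‖(((i : ℂ) + 1) * ((i : ℂ) + 2)) * ((bagMu i : ℂ) ^ (-s) *
        mellin (fun X => (R i X : ℂ)) ((5 - s) / 2))‖ ≤ u i := by
  obtain ⟨K, hK, h⟩ := CubeDecay.exists_norm_mellin_le
  refine ⟨fun i => bagMu i ^ (-3 / 2 : ℝ) * (C * K),
    (summable_bagMu_rpow (by norm_num)).mul_right _, fun i s h1 h2 => ?_⟩
  have hμ := bagMu_pos i
  have hb := h _ _ ((5 - s) / 2) (hR i) (by simp; linarith) (by simp; linarith)
  have hC : 0 ≤ C * (bagMu i ^ 4)⁻¹ := (hR i).nonneg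
  have hs : ‖(bagMu i : ℂ) ^ (-s)‖ ≤ bagMu i ^ (1 / 2 : ℝ) := by
    rw [norm_bagMu_cpow]
    refine Real.rpow_le_rpow_of_exponent_le (by linarith [bagMu_ge i]) ?_
    simp only [Complex.neg_re]; linarith
  rw [norm_mul _ ((bagMu i : ℂ) ^ (-s) * _), norm_mul ((bagMu i : ℂ) ^ (-s))]
  calc _ ≤ bagMu i ^ 2 * (bagMu i ^ (1 / 2 : ℝ) * (C * (bagMu i ^ 4)⁻¹ * K)) := by
        gcongr
        exact norm_degeneracy_le i
    _ = _ := by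
        have e : bagMu i ^ (-3 / 2 : ℝ) = bagMu i ^ 2 * bagMu i ^ (1 / 2 : ℝ) * (bagMu i ^ 4)⁻¹ := by
          rw [← Real.rpow_natCast, ← Real.rpow_natCast, ← Real.rpow_neg hμ.le,
            ← Real.rpow_add hμ, ← Real.rpow_add hμ]
          norm_num
        simp only [e]; ring

/-- The normalizing factor `1 / (Γ((5 - s)/2) Γ((1 + s)/2))`. -/
def bagGammaInv (s : ℂ) : ℂ :=
  (Complex.Gamma ((5 - s) / 2))⁻¹ * (Complex.Gamma ((1 + s) / 2))⁻¹

theorem differentiable_bagGammaInv : Differentiable ℂ bagGammaInv := by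
  unfold bagGammaInv
  exact (Complex.differentiable_one_div_Gamma.comp (by fun_prop)).mul
    (Complex.differentiable_one_div_Gamma.comp (by fun_prop))

theorem bagGammaInv_zero : bagGammaInv 0 = 4 / (3 * (Real.pi : ℂ)) := by
  have h1 : Complex.Gamma (1 / 2) * Complex.Gamma (1 / 2) = Real.pi := by
    rw [Complex.Gamma_one_half_eq, ← Complex.cpow_add _ _ (by exact_mod_cast Real.pi_ne_zero)]
    norm_num
  have h2 : Complex.Gamma (5 / 2) = 3 / 4 * Complex.Gamma (1 / 2) := by
    have e1 := Complex.Gamma_add_one (3 / 2) (by norm_num)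
    have e2 := Complex.Gamma_add_one (1 / 2) (by norm_num)
    norm_num at e1 e2
    rw [e1, e2]; ring
  rw [bagGammaInv, sub_zero, add_zero, h2, ← mul_inv, mul_assoc, h1, ← inv_div]
  ring

theorem exists_bag_continuation (a : ℝ) : ∃ (f : ℂ → ℂ) (P₁ Φ₁ P₃ Φ₃ : ℝ → ℝ),
    (∀ s : ℂ, -(1 / 2) < s.re → s.re < 9 / 2 → s ≠ 1 → s ≠ 2 → s ≠ 3 → DifferentiableAt ℂ f s) ∧
    (∀ s : ℂ, 4 < s.re → s.re < 9 / 2 → HasSum (fun i : ℕ =>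
      (((i : ℂ) + 1) * ((i : ℂ) + 2)) * besselOddZeta (i + 1) a s) (f s)) ∧
    TwiceDecay (fun X => bagTau X ^ 2 * bagK₁ a (bagTau X)) P₁ Φ₁ ∧
    TwiceDecay (fun X => bagTau X ^ 2 * bagK₃ a (bagTau X)) P₃ Φ₃ ∧
    f 0 = 4 / (3 * (Real.pi : ℂ)) * (mellin (fun X => (Φ₃ X : ℂ)) (5 / 2) -
      1 / 4 * mellin (fun X => (Φ₁ X : ℂ)) (5 / 2)) := by
  obtain ⟨H, P₁, Φ₁, Φ₂, P₃, Φ₃, R, ⟨C₀, hH⟩, ⟨C₂, h₂⟩, h₁, h₃, ⟨C, hR⟩, hR0, hz⟩ :=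
    exists_bag_expansion a
  obtain ⟨C₁, h₁'⟩ := h₁.cubeDecay
  obtain ⟨C₃, h₃'⟩ := h₃.cubeDecay
  obtain ⟨u, hu, hle⟩ := exists_summable_norm_remainder hR
  set N : (ℝ → ℝ) → ℂ → ℂ := fun Φ s => mellin (fun X => (Φ X : ℂ)) ((5 - s) / 2) with hN
  have hNd : ∀ {D : ℝ} {Φ : ℝ → ℝ}, CubeDecay D Φ → ∀ s : ℂ, -(1 / 2) < s.re → s.re < 9 / 2 →
      DifferentiableAt ℂ (N Φ) s := fun {D Φ} h s h1 h2 =>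
    DifferentiableAt.comp (g := mellin fun X => (Φ X : ℂ)) s
      (h.differentiableAt_mellin (by simp; linarith) (by simp; linarith)) (by fun_prop)
  set S : ℂ → ℂ := fun s => ∑' i : ℕ,
    (((i : ℂ) + 1) * ((i : ℂ) + 2)) * ((bagMu i : ℂ) ^ (-s) * N (R i) s) with hS
  have hopen : IsOpen {s : ℂ | -(1 / 2) < s.re ∧ s.re < 9 / 2} :=
    (isOpen_lt continuous_const Complex.continuous_re).inter
      (isOpen_lt Complex.continuous_re continuous_const)
  have hSd : DifferentiableOn ℂ S {s : ℂ | -(1 / 2) < s.re ∧ s.re < 9 / 2} := by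
    refine Complex.differentiableOn_tsum_of_summable_norm hu (fun i s hs => ?_) hopen
      fun i s hs => hle i s hs.1 hs.2
    have hμ : (bagMu i : ℂ) ≠ 0 := by exact_mod_cast bagMu_ne_zero i
    refine DifferentiableAt.differentiableWithinAt ?_
    refine (DifferentiableAt.mul ?_ (hNd (hR i) s hs.1 hs.2)).const_mul _
    exact differentiableAt_id.neg.const_cpow (Or.inl hμ)
  refine ⟨fun s => bagGammaInv s * (N H s * (halfZeta (s - 2) - 1 / 4 * halfZeta s) +
    N Φ₁ s * (s * halfZeta (s - 1) - 1 / 4 * mulHalfZeta s) +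
    N Φ₂ s * (s * (halfZeta s - 1 / 4 * halfZeta (s + 2))) +
    N Φ₃ s * (mulHalfZeta s - 1 / 4 * (s * halfZeta (s + 3))) + S s),
    P₁, Φ₁, P₃, Φ₃, ?_, ?_, h₁, h₃, ?_⟩
  · intro s hs1 hs2 n1 n2 n3
    have d1 : DifferentiableAt ℂ (fun s => halfZeta (s - 2)) s :=
      (differentiableAt_halfZeta (fun h => n3 (by linear_combination h))).comp s (by fun_prop)
    have d2 : DifferentiableAt ℂ (fun s => halfZeta (s - 1)) s :=
      (differentiableAt_halfZeta (fun h => n2 (by linear_combination h))).comp s (by fun_prop)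
    have d3 := differentiableAt_halfZeta n1
    have d4 : DifferentiableAt ℂ (fun s => halfZeta (s + 2)) s :=
      (differentiableAt_halfZeta (fun h => by
        have := congrArg Complex.re h; simp at this; linarith)).comp s (by fun_prop)
    have d5 : DifferentiableAt ℂ (fun s => halfZeta (s + 3)) s :=
      (differentiableAt_halfZeta (fun h => by
        have := congrArg Complex.re h; simp at this; linarith)).comp s (by fun_prop)
    have d6 := differentiable_mulHalfZeta s
    have d7 := differentiable_bagGammaInv s
    have d8 := hSd.differentiableAt (hopen.mem_nhds ⟨hs1, hs2⟩)
    have c0 := hNd hH s hs1 hs2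
    have c1 := hNd h₁' s hs1 hs2
    have c2 := hNd h₂ s hs1 hs2
    have c3 := hNd h₃' s hs1 hs2
    have cid : DifferentiableAt ℂ (fun s : ℂ => s) s := differentiableAt_id
    exact d7.mul (((((c0.mul (d1.sub (d3.const_mul _))).add
      (c1.mul ((cid.mul d2).sub (d6.const_mul _)))).add
      (c2.mul (cid.mul (d3.sub (d4.const_mul _))))).add
      (c3.mul (d6.sub ((cid.mul d5).const_mul _)))).add d8)
  · intro s hs4 hs9
    have hs0 : s ≠ 0 := by rintro rfl; simp at hs4; linarith
    have k0 := hasSum_bagMu_cpow (w := s) (by linarith)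
    have k1 := hasSum_bagMu_cpow (w := s + 1) (by simp; linarith)
    have k2 := hasSum_bagMu_cpow (w := s + 2) (by simp; linarith)
    have k3 := hasSum_bagMu_cpow (w := s + 3) (by simp; linarith)
    have kS : HasSum (fun i : ℕ => (((i : ℂ) + 1) * ((i : ℂ) + 2)) *
        ((bagMu i : ℂ) ^ (-s) * N (R i) s)) (S s) :=
      (Summable.of_norm_bounded hu fun i => hle i s (by linarith) hs9).hasSum
    have k := (((((k0.mul_left (N H s)).add (k1.mul_left (N Φ₁ s * s))).add
      (k2.mul_left (N Φ₂ s * s))).add (k3.mul_left (N Φ₃ s * s))).add kS).mul_left (bagGammaInv s)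
    have e1 : s + 1 - 2 = s - 1 := by ring
    have e2 : s + 2 - 2 = s := by ring
    have e3 : s + 3 - 2 = s + 1 := by ring
    rw [e1, e2, e3] at k
    simp only [mulHalfZeta_of_ne hs0]
    have hval : ∀ x y : ℂ, x = y → HasSum (fun i : ℕ => (((i : ℂ) + 1) * ((i : ℂ) + 2)) *
      besselOddZeta (i + 1) a s) x → HasSum (fun i : ℕ => (((i : ℂ) + 1) * ((i : ℂ) + 2)) *
      besselOddZeta (i + 1) a s) y := fun x y h h' => h ▸ h'
    refine hval _ _ ?_ ((congrArg (HasSum · _) (funext fun i => ?_)).mp k)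
    · ring
    · have hb := hz i ((5 - s) / 2) (by simp; linarith) (by simp; linarith)
      have es : 5 - 2 * ((5 - s) / 2) = s := by ring
      have es' : 3 - (5 - s) / 2 = (1 + s) / 2 := by ring
      rw [es, es'] at hb
      have g1 : Complex.Gamma ((5 - s) / 2) ≠ 0 :=
        Complex.Gamma_ne_zero_of_re_pos (by simp; linarith)
      have g2 : Complex.Gamma ((1 + s) / 2) ≠ 0 :=
        Complex.Gamma_ne_zero_of_re_pos (by simp; linarith)
      have hb' : besselOddZeta (i + 1) a s = bagGammaInv s * (Complex.Gamma ((5 - s) / 2) *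
          Complex.Gamma ((1 + s) / 2) * besselOddZeta (i + 1) a s) := by
        rw [bagGammaInv]; field_simp
      have hμ : (bagMu i : ℂ) ≠ 0 := by exact_mod_cast bagMu_ne_zero i
      have q : ∀ n : ℕ, (bagMu i : ℂ) ^ (-(s + n)) = (bagMu i : ℂ) ^ (-s) * (bagMu i : ℂ)⁻¹ ^ n := by
        intro n
        rw [neg_add, Complex.cpow_add _ _ hμ, Complex.cpow_neg _ (n : ℂ), Complex.cpow_natCast,
          inv_pow]
      have q1 := q 1
      have q2 := q 2
      have q3 := q 3
      push_cast at q1 q2 q3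
      rw [hb', hb, q1, q2, q3]
      simp only [hN]
      ring
  · have hS0 : S 0 = 0 := by
      simp only [hS, hN, sub_zero, hR0, mul_zero, tsum_zero]
    simp only [hS0, bagGammaInv_zero, zero_sub, halfZeta_neg_two, halfZeta_zero, mulHalfZeta_zero,
      hN, sub_zero]
    ring

/-- The positive zeros of `J_ν - a J_{ν+1}`. -/
def besselPosZeros (ν : ℕ) (a : ℝ) : Set ℝ :=
  {k | 0 < k ∧ besselJn ν k - a * besselJn (ν + 1) k = 0}

theorem besselPosZeros_subset (ν : ℕ) (a : ℝ) : besselPosZeros ν a ⊆ besselZeros ν a :=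
  fun _ hk => ⟨hk.1.ne', hk.2⟩

theorem neg_mem_besselZeros_iff {ν : ℕ} {a k : ℝ} :
    -k ∈ besselZeros ν a ↔ k ∈ besselZeros ν (-a) := by
  have h : besselJn ν (-k) - a * besselJn (ν + 1) (-k) =
      (-1) ^ ν * (besselJn ν k - -a * besselJn (ν + 1) k) := by
    rw [besselJn_neg, besselJn_neg]; ring
  simp [besselZeros, h]

theorem summable_sigma_besselZeros (a : ℝ) {σ : ℝ} (hσ : 4 < σ) :
    Summable fun p : (ℓ : ℕ) × besselZeros (ℓ + 1) a => bagMu p.1 ^ 2 * |(p.2 : ℝ)| ^ (-σ) := by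
  rw [summable_sigma_of_nonneg fun p => mul_nonneg (sq_nonneg _) (Real.rpow_nonneg (abs_nonneg _) _)]
  have h2 : 2 ≤ σ := by linarith
  refine ⟨fun ℓ => (summable_rpow_neg_abs_besselZeros (ℓ + 1) a h2).mul_left (bagMu ℓ ^ 2), ?_⟩
  have hs : Summable fun ℓ : ℕ => ((ℓ : ℝ) + 2) ^ (3 - σ) := by
    have h := (summable_nat_add_iff 2).2 (Real.summable_nat_rpow (p := 3 - σ) |>.2 (by linarith))
    simpa using h
  refine (hs.mul_left (((2 + |a|) / 2) ^ (σ - 2) * (1 + a ^ 2))).of_nonneg_of_le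
    (fun ℓ => tsum_nonneg fun k => mul_nonneg (sq_nonneg _) (Real.rpow_nonneg (abs_nonneg _) _))
    fun ℓ => ?_
  dsimp only
  rw [tsum_mul_left]
  have h := tsum_rpow_neg_abs_besselZeros_le (ℓ + 1) a (σ := σ) (by linarith)
  have hn : (0 : ℝ) < ℓ + 2 := by positivity
  have e1 : ((ℓ + 1 : ℕ) : ℝ) + 1 = ℓ + 2 := by push_cast; ring
  rw [e1] at h
  have e2 : (2 + |a|) / (2 * ((ℓ : ℝ) + 2)) = (2 + |a|) / 2 * ((ℓ : ℝ) + 2)⁻¹ := by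
    field_simp
  rw [e2, Real.mul_rpow (by positivity) (by positivity), Real.inv_rpow hn.le,
    ← Real.rpow_neg hn.le] at h
  have hμ : bagMu ℓ ^ 2 ≤ ((ℓ : ℝ) + 2) ^ 2 := by
    have := bagMu_pos ℓ
    refine pow_le_pow_left₀ this.le ?_ 2
    rw [bagMu]; linarith
  have e3 : ((ℓ : ℝ) + 2) ^ (3 - σ) = (ℓ + 2) ^ 2 * ((ℓ : ℝ) + 2) ^ (-(σ - 2)) * ((ℓ : ℝ) + 2)⁻¹ := by
    rw [← Real.rpow_natCast, ← Real.rpow_neg_one, ← Real.rpow_add hn, ← Real.rpow_add hn]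
    congr 1; push_cast; ring
  calc _ ≤ ((ℓ : ℝ) + 2) ^ 2 * (((2 + |a|) / 2) ^ (σ - 2) * ((ℓ : ℝ) + 2) ^ (-(σ - 2)) *
        ((1 + a ^ 2) / (ℓ + 2))) := by
        refine mul_le_mul hμ h ?_ (by positivity)
        exact tsum_nonneg fun k => Real.rpow_nonneg (abs_nonneg _) _
    _ = _ := by rw [e3]; ring

theorem norm_sign_mul_cpow (x : ℝ) (s : ℂ) (hx : x ≠ 0) :
    ‖((SignType.sign x : ℝ) : ℂ) * ((|x| : ℝ) : ℂ) ^ (-s)‖ = |x| ^ (-s.re) := by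
  rw [norm_mul, Complex.norm_cpow_eq_rpow_re_of_pos (abs_pos.2 hx), Complex.norm_real]
  rcases lt_or_gt_of_ne hx with h | h
  · simp [sign_neg h]
  · simp [sign_pos h]

theorem summable_norm_besselPosZeros (a : ℝ) {s : ℂ} (hs : 4 < s.re) :
    Summable fun p : (ℓ : ℕ) × besselPosZeros (ℓ + 1) a =>
      ‖(((p.1 : ℂ) + 1) * ((p.1 : ℂ) + 2)) * ((p.2 : ℝ) : ℂ) ^ (-s)‖ := by
  have h := (summable_sigma_besselZeros a hs).comp_injective
    (i := fun p : (ℓ : ℕ) × besselPosZeros (ℓ + 1) a =>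
      ⟨p.1, Set.inclusion (besselPosZeros_subset (p.1 + 1) a) p.2⟩)
    (by
      rintro ⟨ℓ, k⟩ ⟨ℓ', k'⟩ hp
      obtain rfl : ℓ = ℓ' := congrArg Sigma.fst hp
      have hk := eq_of_heq (Sigma.mk.inj hp).2
      exact congrArg (Sigma.mk ℓ)
        (Set.inclusion_injective (besselPosZeros_subset (ℓ + 1) a) hk))
  refine h.of_nonneg_of_le (fun _ => norm_nonneg _) fun p => ?_
  obtain ⟨ℓ, k, hk⟩ := p
  rw [norm_mul]
  refine mul_le_mul (norm_degeneracy_le ℓ) ?_ (norm_nonneg _) (sq_nonneg _)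
  simp only [Complex.norm_cpow_eq_rpow_re_of_pos hk.1, Complex.neg_re,
    abs_of_pos hk.1, le_refl]

theorem summable_besselPosZeros (ν : ℕ) (a : ℝ) {s : ℂ} (hs : 2 ≤ s.re) :
    Summable fun k : besselPosZeros ν a => ((k : ℝ) : ℂ) ^ (-s) := by
  have h := (summable_rpow_neg_abs_besselZeros ν a hs).comp_injective
    (Set.inclusion_injective (besselPosZeros_subset ν a))
  refine Summable.of_norm (h.of_nonneg_of_le (fun _ => norm_nonneg _) fun k => ?_)
  obtain ⟨k, hk⟩ := k
  simp only [Complex.norm_cpow_eq_rpow_re_of_pos hk.1, Complex.neg_re, Function.comp_apply,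
    abs_of_pos hk.1, le_refl]

/-- The nonzero zeros, split according to their sign. -/
def besselZerosEquiv (ν : ℕ) (a : ℝ) :
    besselPosZeros ν a ⊕ besselPosZeros ν (-a) ≃ besselZeros ν a :=
  Equiv.ofBijective (Sum.elim (Set.inclusion (besselPosZeros_subset ν a))
    fun k => ⟨-k, neg_mem_besselZeros_iff.2 (besselPosZeros_subset ν (-a) k.2)⟩) <| by
  constructor
  · rintro (⟨x, hx⟩ | ⟨x, hx⟩) (⟨y, hy⟩ | ⟨y, hy⟩) h
    · simpa using h
    · have h' : x = -y := congrArg Subtype.val h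
      linarith [hx.1, hy.1]
    · have h' : -x = y := congrArg Subtype.val h
      linarith [hx.1, hy.1]
    · simpa using h
  · rintro ⟨k, hk⟩
    rcases lt_or_gt_of_ne hk.1 with h | h
    · have hm : -k ∈ besselZeros ν (-a) := neg_mem_besselZeros_iff.1 (by simpa using hk)
      exact ⟨Sum.inr ⟨-k, neg_pos.2 h, hm.2⟩, Subtype.ext (neg_neg k)⟩
    · exact ⟨Sum.inl ⟨k, h, hk.2⟩, rfl⟩

theorem besselOddZeta_eq_sub (ν : ℕ) (a : ℝ) {s : ℂ} (hs : 2 ≤ s.re) :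
    besselOddZeta ν a s = (∑' k : besselPosZeros ν a, ((k : ℝ) : ℂ) ^ (-s)) -
      ∑' k : besselPosZeros ν (-a), ((k : ℝ) : ℂ) ^ (-s) := by
  have h1 := (summable_besselPosZeros ν a hs).hasSum
  have h2 := (summable_besselPosZeros ν (-a) hs).hasSum.neg
  rw [sub_eq_add_neg, besselOddZeta, ← (besselZerosEquiv ν a).tsum_eq]
  refine (HasSum.sum ?_ ?_).tsum_eq
  · refine (congrArg (HasSum · _) (funext fun k => ?_)).mp h1
    obtain ⟨k, hk⟩ := k
    change _ = ((SignType.sign k : ℝ) : ℂ) * ((|k| : ℝ) : ℂ) ^ (-s)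
    simp [sign_pos hk.1, abs_of_pos hk.1]
  · refine (congrArg (HasSum · _) (funext fun k => ?_)).mp h2
    obtain ⟨k, hk⟩ := k
    change _ = ((SignType.sign (-k) : ℝ) : ℂ) * ((|-k| : ℝ) : ℂ) ^ (-s)
    rw [sign_neg (neg_lt_zero.2 hk.1), abs_neg, abs_of_pos hk.1]
    simp

/-- The odd zeta function summed over all angular momenta. -/
def bagEta (a : ℝ) (s : ℂ) : ℂ :=
  ∑' p : (ℓ : ℕ) × besselZeros (ℓ + 1) a, (((p.1 : ℂ) + 1) * ((p.1 : ℂ) + 2)) *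
    (((SignType.sign (p.2 : ℝ) : ℝ) : ℂ) * ((|(p.2 : ℝ)| : ℝ) : ℂ) ^ (-s))

theorem norm_bagEta_term_le {a : ℝ} (p : (ℓ : ℕ) × besselZeros (ℓ + 1) a) (s : ℂ) :
    ‖(((p.1 : ℂ) + 1) * ((p.1 : ℂ) + 2)) *
      (((SignType.sign (p.2 : ℝ) : ℝ) : ℂ) * ((|(p.2 : ℝ)| : ℝ) : ℂ) ^ (-s))‖ ≤
      bagMu p.1 ^ 2 * |(p.2 : ℝ)| ^ (-s.re) := by
  rw [norm_mul, norm_sign_mul_cpow _ _ p.2.2.1]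
  exact mul_le_mul_of_nonneg_right (norm_degeneracy_le _) (Real.rpow_nonneg (abs_nonneg _) _)

theorem hasSum_bagEta (a : ℝ) {s : ℂ} (hs : 4 < s.re) :
    HasSum (fun ℓ : ℕ => (((ℓ : ℂ) + 1) * ((ℓ : ℂ) + 2)) * besselOddZeta (ℓ + 1) a s)
      (bagEta a s) := by
  have h := (Summable.of_norm_bounded (summable_sigma_besselZeros a hs)
    fun p => norm_bagEta_term_le p s).hasSum
  have h2 : 2 ≤ s.re := by linarith
  have hf : ∀ ℓ : ℕ, HasSum (fun k : besselZeros (ℓ + 1) a =>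
      ((SignType.sign (k : ℝ) : ℝ) : ℂ) * ((|(k : ℝ)| : ℝ) : ℂ) ^ (-s))
      (besselOddZeta (ℓ + 1) a s) := fun ℓ =>
    (Summable.of_norm_bounded (summable_rpow_neg_abs_besselZeros (ℓ + 1) a h2)
      fun k => (norm_sign_mul_cpow _ _ k.2.1).le).hasSum
  exact h.sigma fun ℓ => (hf ℓ).mul_left (((ℓ : ℂ) + 1) * ((ℓ : ℂ) + 2))

theorem differentiableAt_bagEta (a : ℝ) {s : ℂ} (hs : 4 < s.re) :
    DifferentiableAt ℂ (bagEta a) s := by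
  set U : Set ℂ := {w : ℂ | (4 + s.re) / 2 < w.re ∧ w.re < s.re + 1}
  have hU : IsOpen U := (isOpen_lt continuous_const Complex.continuous_re).inter
    (isOpen_lt Complex.continuous_re continuous_const)
  have hsU : s ∈ U := ⟨by linarith, by linarith⟩
  have hu := (summable_sigma_besselZeros a (σ := (4 + s.re) / 2) (by linarith)).add
    (summable_sigma_besselZeros a (σ := s.re + 1) (by linarith))
  refine (Complex.differentiableOn_tsum_of_summable_norm hu (fun p w _ => ?_) hU
    fun p w hw => ?_).differentiableAt (hU.mem_nhds hsU)
  · have hp : ((|(p.2 : ℝ)| : ℝ) : ℂ) ≠ 0 := by exact_mod_cast abs_ne_zero.2 p.2.2.1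
    refine DifferentiableAt.differentiableWithinAt ?_
    exact ((differentiableAt_id.neg.const_cpow (Or.inl hp)).const_mul _).const_mul _
  · refine (norm_bagEta_term_le p w).trans ?_
    rw [← mul_add]
    refine mul_le_mul_of_nonneg_left ?_ (sq_nonneg _)
    have hp := abs_pos.2 p.2.2.1
    have n1 := Real.rpow_nonneg hp.le (-((4 + s.re) / 2))
    have n2 := Real.rpow_nonneg hp.le (-(s.re + 1))
    rcases le_total 1 |(p.2 : ℝ)| with h | h
    · have := Real.rpow_le_rpow_of_exponent_le h (show -w.re ≤ -((4 + s.re) / 2) by linarith [hw.1])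
      linarith
    · have := Real.rpow_le_rpow_of_exponent_ge hp h (show -(s.re + 1) ≤ -w.re by linarith [hw.2])
      linarith

theorem Z1p4_eq (θ : ℝ) : Z1p4 θ = fun ℓ => besselPosZeros (ℓ + 1) (Real.exp θ) := rfl

theorem Z1m4_eq (θ : ℝ) : Z1m4 θ = fun ℓ => besselPosZeros (ℓ + 1) (-Real.exp θ) := by
  funext ℓ
  simp only [Z1m4, besselPosZeros, neg_mul, sub_neg_eq_add]

theorem Z2m4_eq (θ : ℝ) : Z2m4 θ = fun ℓ => besselPosZeros (ℓ + 1) (Real.exp θ)⁻¹ := by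
  funext ℓ
  simp only [Z2m4, besselPosZeros, Real.exp_neg]

theorem Z2p4_eq (θ : ℝ) : Z2p4 θ = fun ℓ => besselPosZeros (ℓ + 1) (-(Real.exp θ)⁻¹) := by
  funext ℓ
  simp only [Z2p4, besselPosZeros, neg_mul, sub_neg_eq_add, Real.exp_neg]

/-- The difference of the two continuations, glued to the series on the far half-plane. -/
theorem exists_bagEta_sub_continuation {a : ℝ} (ha : 0 < a) :
    ∃ h : ℂ → ℂ,
      (∀ s : ℂ, -(1 / 2) < s.re → s ≠ 1 → s ≠ 2 → s ≠ 3 → DifferentiableAt ℂ h s) ∧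
      (∀ s : ℂ, 4 < s.re → h s = bagEta a s - bagEta a⁻¹ s) ∧
      h 0 = (bagAsymmetry a : ℂ) := by
  obtain ⟨f, P₁, Φ₁, P₃, Φ₃, hf, hfs, h₁, h₃, hf0⟩ := exists_bag_continuation a
  obtain ⟨g, Q₁, Ψ₁, Q₃, Ψ₃, hg, hgs, k₁, k₃, hg0⟩ := exists_bag_continuation a⁻¹
  set h : ℂ → ℂ := fun s => if s.re < 9 / 2 then f s - g s else bagEta a s - bagEta a⁻¹ s
    with hh
  have hη : ∀ s : ℂ, 4 < s.re → h s = bagEta a s - bagEta a⁻¹ s := by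
    intro s hs
    by_cases hs' : s.re < 9 / 2
    · rw [hh]
      simp only [hs', if_true]
      rw [(hfs s hs hs').unique (hasSum_bagEta a hs), (hgs s hs hs').unique (hasSum_bagEta a⁻¹ hs)]
    · simp only [hh, hs', if_false]
  refine ⟨h, fun s hs h1 h2 h3 => ?_, hη, ?_⟩
  · by_cases hs' : s.re < 9 / 2
    · refine ((hf s hs hs' h1 h2 h3).sub (hg s hs hs' h1 h2 h3)).congr_of_eventuallyEq ?_
      filter_upwards [(isOpen_lt Complex.continuous_re continuous_const).mem_nhds hs'] with z hz
      have hz' : z.re < 9 / 2 := hz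
      simp [hh, hz']
    · have hs4 : 4 < s.re := by linarith
      refine ((differentiableAt_bagEta a hs4).sub
        (differentiableAt_bagEta a⁻¹ hs4)).congr_of_eventuallyEq ?_
      filter_upwards [(isOpen_lt continuous_const Complex.continuous_re).mem_nhds hs4] with z hz
      exact hη z hz
  · have h0 : h 0 = f 0 - g 0 := by simp [hh]
    rw [h0, hf0, hg0, ← mul_sub, mellin_five_halves_bagK_sub ha h₁ h₃ k₁ k₃]
    have := Complex.ofReal_ne_zero.2 Real.pi_ne_zero
    push_cast
    field_simp

end

/-- the eta function of the Dirac operator on the four-dimensional unit ball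
with chiral bag boundary conditions, with degeneracies `d_ℓ = (ℓ+1)(ℓ+2)`, converges
absolutely for `Re s > 4`, extends to a function holomorphic on `{Re s > −1/2}` minus a
finite set not containing `0`, and its value at `0` (the spectral asymmetry) equals
`(1/6144)(tanh(θ/2)/cosh⁶(θ/2))(259 + 344 cosh θ + 161 cosh 2θ + 16 cosh 3θ)`. -/
theorem stmt_10 (θ : ℝ) :
    (∀ s : ℂ, 4 < s.re →
      (Summable fun p : (ℓ : ℕ) × ↥(Z1p4 θ ℓ) =>
        ‖(((p.1 : ℂ) + 1) * ((p.1 : ℂ) + 2)) * ((p.2 : ℝ) : ℂ) ^ (-s)‖) ∧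
      (Summable fun p : (ℓ : ℕ) × ↥(Z2p4 θ ℓ) =>
        ‖(((p.1 : ℂ) + 1) * ((p.1 : ℂ) + 2)) * ((p.2 : ℝ) : ℂ) ^ (-s)‖) ∧
      (Summable fun p : (ℓ : ℕ) × ↥(Z1m4 θ ℓ) =>
        ‖(((p.1 : ℂ) + 1) * ((p.1 : ℂ) + 2)) * ((p.2 : ℝ) : ℂ) ^ (-s)‖) ∧
      (Summable fun p : (ℓ : ℕ) × ↥(Z2m4 θ ℓ) =>
        ‖(((p.1 : ℂ) + 1) * ((p.1 : ℂ) + 2)) * ((p.2 : ℝ) : ℂ) ^ (-s)‖)) ∧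
    ∃ (F : Finset ℂ) (h : ℂ → ℂ),
      (0 : ℂ) ∉ F ∧
      DifferentiableOn ℂ h ({s : ℂ | -(1 / 2) < s.re} \ (F : Set ℂ)) ∧
      (∀ s : ℂ, 4 < s.re →
        h s = ∑' ℓ : ℕ,
          (((ℓ : ℂ) + 1) * ((ℓ : ℂ) + 2)) *
            ((∑' k : ↥(Z1p4 θ ℓ), ((k : ℝ) : ℂ) ^ (-s)) +
              (∑' k : ↥(Z2p4 θ ℓ), ((k : ℝ) : ℂ) ^ (-s)) -
              (∑' k : ↥(Z1m4 θ ℓ), ((k : ℝ) : ℂ) ^ (-s)) -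
              (∑' k : ↥(Z2m4 θ ℓ), ((k : ℝ) : ℂ) ^ (-s)))) ∧
      h 0 = (((1 / 6144) * (Real.tanh (θ / 2) / Real.cosh (θ / 2) ^ 6) *
        (259 + 344 * Real.cosh θ + 161 * Real.cosh (2 * θ) +
          16 * Real.cosh (3 * θ)) : ℝ) : ℂ) := by
  rw [Z1p4_eq, Z2p4_eq, Z1m4_eq, Z2m4_eq]
  refine ⟨fun s hs => ⟨summable_norm_besselPosZeros _ hs, summable_norm_besselPosZeros _ hs,
    summable_norm_besselPosZeros _ hs, summable_norm_besselPosZeros _ hs⟩, ?_⟩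
  obtain ⟨h, hd, hη, h0⟩ := exists_bagEta_sub_continuation (Real.exp_pos θ)
  refine ⟨{1, 2, 3}, h, by norm_num, ?_, fun s hs => ?_, ?_⟩
  · rintro s ⟨hs, hF⟩
    simp only [Finset.coe_insert, Finset.coe_singleton, mem_insert_iff, mem_singleton_iff,
      not_or] at hF
    exact (hd s hs hF.1 hF.2.1 hF.2.2).differentiableWithinAt
  · rw [hη s hs, ← ((hasSum_bagEta _ hs).sub (hasSum_bagEta _ hs)).tsum_eq]
    refine tsum_congr fun ℓ => ?_
    rw [besselOddZeta_eq_sub _ _ (by linarith), besselOddZeta_eq_sub _ _ (by linarith)]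
    ring
  · rw [h0, bagAsymmetry_exp]
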